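/- In the Coxeter group of affine type D̃_{n+2}, the set of star irreducible fully commutative elements is exactly the disjoint union of the candy elements, the complete zigzag elements, and the products of pairwise commuting generators (including the identity). Moreover, when n is odd the set of candy elements is empty. -/

import Mathlib

open CoxeterSystem

namespace CoxFC


open CoxeterSystem


variable {B : Type*} {W : Type*} [Group W] {M : CoxeterMatrix B}

/-- One commutation move: swap two adjacent commuting letters. -/
def CommStep (M : CoxeterMatrix B) (l l' : List B) : Prop :=
  ∃ (l₁ l₂ : List B) (a b : B), M a b = 2 ∧
    l = l₁ ++ a :: b :: l₂ ∧ l' = l₁ ++ b :: a :: l₂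

/-- Two words are commutation equivalent if related by a sequence of commutation moves. -/
def CommEquiv (M : CoxeterMatrix B) : List B → List B → Prop :=
  Relation.ReflTransGen (CommStep M)

/-- A fully commutative element: any two reduced expressions are commutation equivalent. -/
def IsFC (cs : CoxeterSystem M W) (w : W) : Prop :=
  ∀ l l' : List B, cs.IsReduced l → cs.IsReduced l' →
    cs.wordProd l = w → cs.wordProd l' = w → CommEquiv M l l'

/-- `m s t ≥ 3`, where a matrix entry `0` denotes `∞`. -/
def Big (M : CoxeterMatrix B) (s t : B) : Prop := 3 ≤ M s t ∨ M s t = 0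

/-- `w` is left star reducible by `s` with respect to `t`. -/
def IsLeftStarReducible (cs : CoxeterSystem M W) (s t : B) (w : W) : Prop :=
  Big M s t ∧ cs.IsLeftDescent w s ∧ cs.IsLeftDescent (cs.simple s * w) t

/-- `w` is right star reducible by `s` with respect to `t`. -/
def IsRightStarReducible (cs : CoxeterSystem M W) (s t : B) (w : W) : Prop :=
  Big M s t ∧ cs.IsRightDescent w s ∧ cs.IsRightDescent (w * cs.simple s) t

/-- A single left star reduction step from `w` to `v`. -/
def LeftStarStep (cs : CoxeterSystem M W) (w v : W) : Prop :=
  ∃ s t : B, IsLeftStarReducible cs s t w ∧ v = cs.simple s * w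

/-- A single (left or right) star reduction step from `w` to `v`. -/
def StarStep (cs : CoxeterSystem M W) (w v : W) : Prop :=
  ∃ s t : B, (IsLeftStarReducible cs s t w ∧ v = cs.simple s * w) ∨
    (IsRightStarReducible cs s t w ∧ v = w * cs.simple s)

/-- `w` admits no left star reduction. -/
def LeftStarIrreducible (cs : CoxeterSystem M W) (w : W) : Prop :=
  ∀ s t : B, ¬ IsLeftStarReducible cs s t w

/-- `w` admits no star reduction at all. -/
def StarIrreducible (cs : CoxeterSystem M W) (w : W) : Prop :=
  ∀ s t : B, ¬ IsLeftStarReducible cs s t w ∧ ¬ IsRightStarReducible cs s t w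

/-- A product of pairwise commuting generators (including the identity). -/
def IsCC (cs : CoxeterSystem M W) (w : W) : Prop :=
  ∃ l : List B, cs.IsReduced l ∧ cs.wordProd l = w ∧
    ∀ a ∈ l, ∀ b ∈ l, a ≠ b → M a b = 2

/-- The support of `w`: generators appearing in some reduced expression. -/
def Supp (cs : CoxeterSystem M W) (w : W) : Set B :=
  {a | ∃ l : List B, cs.IsReduced l ∧ cs.wordProd l = w ∧ a ∈ l}

/-- `us` is the Cartier–Foata normal form of `w`, presented as a list of words,
each a product of pairwise commuting generators. -/
def IsCFNF (cs : CoxeterSystem M W) (w : W) (us : List (List B)) : Prop :=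
  (∀ l ∈ us, l ≠ []) ∧
  cs.wordProd us.flatten = w ∧
  cs.IsReduced us.flatten ∧
  (∀ l ∈ us, ∀ a ∈ l, ∀ b ∈ l, a ≠ b → M a b = 2) ∧
  (∀ a : B, (∃ l ∈ us.head?, a ∈ l) ↔ cs.IsLeftDescent w a) ∧
  (∀ j : ℕ, j + 1 < us.length → ∀ t ∈ us.getD (j+1) [],
      ∃ s ∈ us.getD j [], Big M s t)



/-- One orientation of the edges of the Coxeter graph of type D̃_{n+2}. -/
def DHalf (n a b : ℕ) : Prop :=
  (a = 0 ∧ b = 2) ∨ (a = 1 ∧ b = 2) ∨ (2 ≤ a ∧ a ≤ n ∧ b = a + 1) ∨ (a = n ∧ b = n + 2)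

/-- Adjacency (bond of order 3) in the Coxeter graph of type D̃_{n+2}:
`s_0, s_1` are joined to `s_2`, `s_2 — s_3 — ⋯ — s_n` is a path, and
`s_{n+1}, s_{n+2}` are joined to `s_n`. -/
def DAdj (n a b : ℕ) : Prop := DHalf n a b ∨ DHalf n b a

instance (n a b : ℕ) : Decidable (DAdj n a b) := by unfold DAdj DHalf; infer_instance

lemma dAdj_symm (n a b : ℕ) : DAdj n a b ↔ DAdj n b a := or_comm

lemma dHalf_ne (n a b : ℕ) (h : DHalf n a b) : a ≠ b := by unfold DHalf at h; omega

lemma dAdj_ne (n a b : ℕ) (h : DAdj n a b) : a ≠ b := by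
  rcases h with h | h
  · exact dHalf_ne n a b h
  · exact (dHalf_ne n b a h).symm

/-- The Coxeter matrix of affine type D̃_{n+2}, with vertices `s_0, …, s_{n+2}`. -/
def DMatrix (n : ℕ) : CoxeterMatrix (Fin (n+3)) where
  M := Matrix.of fun i j : Fin (n+3) ↦
    if DAdj n i j then 3 else if i = j then 1 else 2
  isSymm := by
    apply Matrix.IsSymm.ext
    intro i j
    simp only [Matrix.of_apply]
    by_cases h : DAdj n (i : ℕ) (j : ℕ)
    · rw [if_pos h, if_pos ((dAdj_symm n (i : ℕ) (j : ℕ)).mp h)]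
    · rw [if_neg h, if_neg (fun hh => h ((dAdj_symm n (j : ℕ) (i : ℕ)).mp hh))]
      by_cases h2 : (j : Fin (n+3)) = i
      · simp [h2]
      · rw [if_neg h2, if_neg (fun hh => h2 hh.symm)]
  diagonal i := by
    have : ¬ DAdj n (i : ℕ) (i : ℕ) := fun h => dAdj_ne n i i h rfl
    simp [this]
  off_diagonal i j h := by
    have h2 : (i : Fin (n+3)) ≠ j := h
    by_cases hA : DAdj n (i : ℕ) (j : ℕ) <;> simp [Matrix.of_apply, hA, h2]

/-- The generator `s_k` of type D̃_{n+2}, for `k ≤ n+2`. -/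
def dv (n k : ℕ) : Fin (n+3) := ⟨k % (n+3), Nat.mod_lt _ (Nat.succ_pos _)⟩



variable {n : ℕ} {W : Type*} [Group W]

/-- The generators `{s_3, s_5, …, s_{n-1}}` (odd indices from 3 to n-1). -/
def OddCore (n : ℕ) : Set (Fin (n+3)) :=
  {a | 3 ≤ (a : ℕ) ∧ (a : ℕ) ≤ n - 1 ∧ (a : ℕ) % 2 = 1}

/-- The generators `{s_2, s_4, …, s_n}` (even indices from 2 to n). -/
def EvenCore (n : ℕ) : Set (Fin (n+3)) :=
  {a | 2 ≤ (a : ℕ) ∧ (a : ℕ) ≤ n ∧ (a : ℕ) % 2 = 0}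

/-- A candy element of type D̃_{n+2} (for n even): an FC element whose
Cartier–Foata normal form `u_0 ⋯ u_m` has `m ≥ 2` even,
`supp(u_{2i}) = {s_3, s_5, …, s_{n-1}} ∪ {x_i, y_i}` with `x_i ∈ {s_0, s_1}`,
`y_i ∈ {s_{n+1}, s_{n+2}}`, `x_i ≠ x_{i+1}`, `y_i ≠ y_{i+1}`, and
`supp(u_{2i+1}) = {s_2, s_4, …, s_n}`. -/
def IsCandy (cs : CoxeterSystem (DMatrix n) W) (w : W) : Prop :=
  ∃ (us : List (List (Fin (n+3)))) (m : ℕ) (x y : ℕ → Fin (n+3)),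
    IsCFNF cs w us ∧ us.length = m + 1 ∧ 2 ≤ m ∧ m % 2 = 0 ∧
    (∀ i : ℕ, 2*i ≤ m →
      ((x i : ℕ) = 0 ∨ (x i : ℕ) = 1) ∧ ((y i : ℕ) = n+1 ∨ (y i : ℕ) = n+2) ∧
      {a | a ∈ us.getD (2*i) []} = OddCore n ∪ {x i, y i}) ∧
    (∀ i : ℕ, 2*(i+1) ≤ m → x i ≠ x (i+1) ∧ y i ≠ y (i+1)) ∧
    (∀ i : ℕ, 2*i+1 ≤ m → {a | a ∈ us.getD (2*i+1) []} = EvenCore n)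

/-- The word `A = s_2 s_3 ⋯ s_n s_{n+1} s_{n+2}`. -/
def AWord (n : ℕ) : List (Fin (n+3)) := (List.range' 2 (n+1)).map (dv n)

/-- The word `B = s_n s_{n-1} ⋯ s_2 s_1 s_0`. -/
def BWord (n : ℕ) : List (Fin (n+3)) := ((List.range (n+1)).reverse).map (dv n)

/-- The word `s_0 s_1 (AB)^k A^h`. -/
def ZigWord1 (n k h : ℕ) : List (Fin (n+3)) :=
  [dv n 0, dv n 1] ++ (List.replicate k (AWord n ++ BWord n)).flatten ++
    (List.replicate h (AWord n)).flatten

/-- The word `s_{n+2} s_{n+1} (BA)^k B^h`. -/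
def ZigWord2 (n k h : ℕ) : List (Fin (n+3)) :=
  [dv n (n+2), dv n (n+1)] ++ (List.replicate k (BWord n ++ AWord n)).flatten ++
    (List.replicate h (BWord n)).flatten

/-- A complete zigzag: an element admitting a reduced expression
`s_0 s_1 (AB)^k A^h` or `s_{n+2} s_{n+1} (BA)^k B^h`, `k ≥ 0`, `h ∈ {0,1}`, `k+h > 0`. -/
def IsCompleteZigzag (cs : CoxeterSystem (DMatrix n) W) (w : W) : Prop :=
  ∃ k h : ℕ, h ≤ 1 ∧ 0 < k + h ∧
    ((cs.IsReduced (ZigWord1 n k h) ∧ cs.wordProd (ZigWord1 n k h) = w) ∨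
     (cs.IsReduced (ZigWord2 n k h) ∧ cs.wordProd (ZigWord2 n k h) = w))

/-- A weak zigzag: a factor of a complete zigzag that is not a product of
pairwise commuting generators. -/
def IsWeakZigzag (cs : CoxeterSystem (DMatrix n) W) (w : W) : Prop :=
  (∃ z x y : W, IsCompleteZigzag cs z ∧ z = x * w * y ∧
      cs.length z = cs.length x + cs.length w + cs.length y) ∧ ¬ IsCC cs w

/-- The number of occurrences of the (contiguous) factor `a b` in the word `l`. -/
def CountFactor {n : ℕ} (a b : Fin (n+3)) (l : List (Fin (n+3))) : ℕ :=
  (List.range (l.length - 1)).countP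
    (fun i => (l.getD i a == a) && (l.getD (i+1) b == b))

/-- `f_•(w)`: the maximal number of occurrences of the factor `s_0 s_1` over all
reduced expressions of `w`. -/
noncomputable def fBullet (cs : CoxeterSystem (DMatrix n) W) (w : W) : ℕ :=
  sSup {c | ∃ l, cs.IsReduced l ∧ cs.wordProd l = w ∧
    CountFactor (dv n 0) (dv n 1) l = c}

/-- `f_∘(w)`: the maximal number of occurrences of the factor `s_{n+1} s_{n+2}`
over all reduced expressions of `w`. -/
noncomputable def fCirc (cs : CoxeterSystem (DMatrix n) W) (w : W) : ℕ :=
  sSup {c | ∃ l, cs.IsReduced l ∧ cs.wordProd l = w ∧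
    CountFactor (dv n (n+1)) (dv n (n+2)) l = c}



section

/-- Column of a vertex: the two leaves on either side share a column. -/
def cl {n : ℕ} (a : Fin (n+3)) : ℕ :=
  if a.1 = 0 then 1 else if a.1 = n+2 then n+1 else a.1

def Adj {n : ℕ} (a b : Fin (n+3)) : Prop := cl a + 1 = cl b ∨ cl b + 1 = cl a

instance {n : ℕ} (a b : Fin (n+3)) : Decidable (Adj a b) := by unfold Adj; infer_instance

def Cm {n : ℕ} (a b : Fin (n+3)) : Prop := a ≠ b ∧ ¬ Adj a b

lemma Adj.symm {n : ℕ} {a b : Fin (n+3)} (h : Adj a b) : Adj b a := Or.symm h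
lemma adj_comm {n : ℕ} {a b : Fin (n+3)} : Adj a b ↔ Adj b a := or_comm
lemma Cm.symm {n : ℕ} {a b : Fin (n+3)} (h : Cm a b) : Cm b a :=
  ⟨h.1.symm, fun k => h.2 k.symm⟩
lemma not_adj_self {n : ℕ} (a : Fin (n+3)) : ¬ Adj a a := by unfold Adj; omega
lemma Adj.ne {n : ℕ} {a b : Fin (n+3)} (h : Adj a b) : a ≠ b := by
  rintro rfl; exact not_adj_self a h

lemma cl_ge {n : ℕ} (a : Fin (n+3)) : 1 ≤ cl a := by unfold cl; split_ifs <;> omega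
lemma cl_le {n : ℕ} (a : Fin (n+3)) : cl a ≤ n + 1 := by
  have := a.2
  unfold cl; split_ifs <;> omega

lemma eq_of_cl {n : ℕ} {a b : Fin (n+3)} (h : cl a = cl b) (h2 : 2 ≤ cl a) (h3 : cl a ≤ n) :
    a = b := by
  have := a.2
  have := b.2
  apply Fin.ext
  unfold cl at *; split_ifs at * <;> omega

lemma dAdj_iff {n : ℕ} (hn : 2 ≤ n) (a b : Fin (n+3)) : DAdj n a b ↔ Adj a b := by
  have := a.2
  have := b.2
  unfold DAdj DHalf Adj cl
  split_ifs <;> omega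

lemma dm_apply {n : ℕ} (hn : 2 ≤ n) (a b : Fin (n+3)) :
    DMatrix n a b = if Adj a b then 3 else if a = b then 1 else 2 := by
  have : DMatrix n a b = if DAdj n a b then 3 else if a = b then 1 else 2 := rfl
  rw [this]; simp only [dAdj_iff hn]

lemma dm_two {n : ℕ} (hn : 2 ≤ n) (a b : Fin (n+3)) : DMatrix n a b = 2 ↔ Cm a b := by
  rw [dm_apply hn]; unfold Cm
  split_ifs <;> simp_all

lemma big_iff {n : ℕ} (hn : 2 ≤ n) (a b : Fin (n+3)) : Big (DMatrix n) a b ↔ Adj a b := by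
  unfold Big; rw [dm_apply hn]
  split_ifs <;> simp_all

/-- Commutation equivalence of words. -/
inductive CE {n : ℕ} : List (Fin (n+3)) → List (Fin (n+3)) → Prop
  | refl (l) : CE l l
  | swap (a b l) : Cm a b → CE (a :: b :: l) (b :: a :: l)
  | cons (a) {l l'} : CE l l' → CE (a :: l) (a :: l')
  | trans {l l' l''} : CE l l' → CE l' l'' → CE l l''

local notation "V" => Fin (n+3)

namespace CE

lemma symm {l l' : List V} (h : CE l l') : CE l' l := by
  induction h with
  | refl l => exact .refl l
  | swap a b l h => exact .swap b a l h.symm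
  | cons a _ ih => exact .cons a ih
  | trans _ _ h1 h2 => exact h2.trans h1

lemma perm {l l' : List V} (h : CE l l') : l.Perm l' := by
  induction h with
  | refl l => exact .refl l
  | swap a b l h => exact .swap b a l
  | cons a _ ih => exact .cons a ih
  | trans _ _ h1 h2 => exact h1.trans h2

lemma appl (x : List V) {l l' : List V} (h : CE l l') : CE (x ++ l) (x ++ l') := by
  induction x with
  | nil => exact h
  | cons a x ih => exact .cons a ih

lemma appr (x : List V) {l l' : List V} (h : CE l l') : CE (l ++ x) (l' ++ x) := by
  induction h with
  | refl l => exact .refl _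
  | swap a b l h => exact .swap a b _ h
  | cons a _ ih => exact .cons a ih
  | trans _ _ h1 h2 => exact h1.trans h2

lemma app {x x' l l' : List V} (h : CE x x') (h' : CE l l') : CE (x ++ l) (x' ++ l') :=
  (h.appr l).trans (h'.appl x')

lemma reverse {l l' : List V} (h : CE l l') : CE l.reverse l'.reverse := by
  induction h with
  | refl l => exact .refl _
  | swap a b l h =>
    simp only [List.reverse_cons, List.append_assoc]
    exact (CE.swap b a [] h.symm).appl _
  | cons a _ ih => simp only [List.reverse_cons]; exact ih.appr _
  | trans _ _ h1 h2 => exact h1.trans h2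

lemma of_reverse {l l' : List V} (h : CE l.reverse l'.reverse) : CE l l' := by
  simpa using h.reverse

/-- Move a letter to the front past commuting letters. -/
lemma front {x : List V} {c : V} (y : List V) (h : ∀ b ∈ x, Cm b c) :
    CE (x ++ c :: y) (c :: (x ++ y)) := by
  induction x with
  | nil => exact .refl _
  | cons a x ih =>
    exact (CE.cons a (ih fun b hb => h b (List.mem_cons_of_mem _ hb))).trans
      (.swap a c _ (h a List.mem_cons_self))

end CE

lemma cl_rev (a : V) : cl a.rev = n + 2 - cl a := by
  have := a.2
  unfold cl; rw [Fin.val_rev]; split_ifs <;> omega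

lemma adj_rev {a b : V} : Adj a.rev b.rev ↔ Adj a b := by
  have := cl_ge a
  have := cl_ge b
  have := cl_le a
  have := cl_le b
  unfold Adj; rw [cl_rev, cl_rev]; omega

lemma cm_rev {a b : V} : Cm a.rev b.rev ↔ Cm a b := by
  unfold Cm; rw [adj_rev, Ne, Fin.rev_inj]

lemma CE.rev {l l' : List V} (h : CE l l') : CE (l.map Fin.rev) (l'.map Fin.rev) := by
  induction h with
  | refl l => exact .refl _
  | swap a b l h => exact .swap _ _ _ (cm_rev.2 h)
  | cons a _ ih => exact .cons _ ih
  | trans _ _ h1 h2 => exact h1.trans h2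

lemma map_rev_rev (l : List V) : (l.map Fin.rev).map Fin.rev = l := by
  rw [List.map_map, Fin.rev_involutive.comp_self, List.map_id]

lemma CE.of_rev {l l' : List V} (h : CE (l.map Fin.rev) (l'.map Fin.rev)) : CE l l' := by
  have := h.rev
  rwa [map_rev_rev, map_rev_rev] at this

lemma ce_iff (hn : 2 ≤ n) (l l' : List V) : CE l l' ↔ CommEquiv (DMatrix n) l l' := by
  constructor
  · intro h
    induction h with
    | refl l => exact .refl
    | swap a b l h => exact .single ⟨[], l, a, b, (dm_two hn _ _).2 h, rfl, rfl⟩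
    | cons a _ ih =>
      have key : ∀ l l' : List V, CommStep (DMatrix n) l l' →
          CommStep (DMatrix n) (a :: l) (a :: l') := by
        rintro l l' ⟨x, y, c, d, h, rfl, rfl⟩
        exact ⟨a :: x, y, c, d, h, rfl, rfl⟩
      clear * - ih key
      induction ih with
      | refl => exact .refl
      | tail _ h ih => exact .tail ih (key _ _ h)
    | trans _ _ h1 h2 => exact Relation.ReflTransGen.trans h1 h2
  · intro h
    induction h with
    | refl => exact .refl _
    | tail _ h ih =>
      obtain ⟨x, y, c, d, h, rfl, rfl⟩ := h
      exact ih.trans ((CE.swap c d y ((dm_two hn _ _).1 h)).appl x)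

/-- Star projection. -/
def qf (s a : V) : Option Bool := if a = s then some true else if Adj a s then some false else none

def q (s : V) (l : List V) : List Bool := l.filterMap (qf s)

@[simp] lemma q_nil (s : V) : q s [] = [] := rfl
@[simp] lemma q_append (s : V) (l l' : List V) : q s (l ++ l') = q s l ++ q s l' :=
  List.filterMap_append
lemma q_reverse (s : V) (l : List V) : q s l.reverse = (q s l).reverse := by
  simp [q, List.filterMap_reverse]

lemma q_cons_self (s : V) (l : List V) : q s (s :: l) = true :: q s l := by
  simp [q, qf]
lemma q_cons_adj {s a : V} (h : Adj a s) (l : List V) : q s (a :: l) = false :: q s l := by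
  simp [q, qf, h, h.ne]
lemma q_cons_cm {s a : V} (h : Cm a s) (l : List V) : q s (a :: l) = q s l := by
  simp [q, qf, h.2, h.1]

lemma tri (a s : V) : a = s ∨ Adj a s ∨ Cm a s := by
  unfold Cm; tauto

lemma q_ce {l l' : List V} (h : CE l l') (s : V) : q s l = q s l' := by
  induction h with
  | refl l => rfl
  | swap a b l h =>
    rcases tri a s with rfl | ha | ha
    · rw [q_cons_self, q_cons_cm h.symm, q_cons_cm h.symm, q_cons_self]
    · rcases tri b s with rfl | hb | hb
      · exact absurd ha h.2
      · simp only [q_cons_adj ha, q_cons_adj hb]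
      · simp only [q_cons_adj ha, q_cons_cm hb]
    · simp only [q_cons_cm ha]
      rcases tri b s with rfl | hb | hb
      · simp only [q_cons_cm ha, q_cons_self]
      · simp only [q_cons_cm ha, q_cons_adj hb]
      · simp only [q_cons_cm ha, q_cons_cm hb]
  | cons a _ ih => simp only [q, List.filterMap_cons] at *; rw [ih]
  | trans _ _ h1 h2 => exact h1.trans h2

lemma qf_rev (s a : V) : qf s.rev a.rev = qf s a := by
  unfold qf; simp only [Fin.rev_inj, adj_rev]

lemma q_rev (s : V) (l : List V) : q s.rev (l.map Fin.rev) = q s l := by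
  unfold q
  rw [List.filterMap_map]
  congr 1
  funext a
  exact qf_rev s a

def Gd (t : List Bool) : Prop := ¬ [true, true] <:+: t ∧ ¬ [true, false, true] <:+: t

def Good (l : List V) : Prop := ∀ s : V, Gd (q s l)

lemma Gd.infix {t t' : List Bool} (h : Gd t') (h' : t <:+: t') : Gd t :=
  ⟨fun k => h.1 (k.trans h'), fun k => h.2 (k.trans h')⟩

lemma Good.ce {l l' : List V} (h : Good l) (h' : CE l l') : Good l' := by
  intro s; rw [← q_ce h']; exact h s

lemma Good.right {l l' : List V} (h : Good (l ++ l')) : Good l' := by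
  intro s
  have := h s
  rw [q_append] at this
  exact this.infix ⟨q s l, [], by simp⟩

lemma Good.left {l l' : List V} (h : Good (l ++ l')) : Good l := by
  intro s
  have := h s
  rw [q_append] at this
  exact this.infix ⟨[], q s l', by simp⟩

lemma Gd.reverse {t : List Bool} (h : Gd t) : Gd t.reverse := by
  constructor
  · intro k
    have := List.reverse_infix.2 k
    simp at this
    exact h.1 this
  · intro k
    have := List.reverse_infix.2 k
    simp at this
    exact h.2 this

lemma Good.reverse {l : List V} (h : Good l) : Good l.reverse := by
  intro s; rw [q_reverse]; exact (h s).reverse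

lemma Good.rev {l : List V} (h : Good l) : Good (l.map Fin.rev) := by
  intro s
  have := q_rev s.rev l
  rw [Fin.rev_rev] at this
  rw [this]; exact h _

lemma q_length (s : V) (m : List V) (hs : s ∉ m) :
    q s m = List.replicate (m.countP (fun a => decide (Adj a s))) false := by
  induction m with
  | nil => rfl
  | cons a m ih =>
    have h1 : a ≠ s := fun h => hs (h ▸ List.mem_cons_self)
    have h2 := ih (fun h => hs (List.mem_cons_of_mem _ h))
    rcases tri a s with h | h | h
    · exact absurd h h1
    · rw [q_cons_adj h, h2, List.countP_cons_of_pos (by simpa using h)]; rfl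
    · rw [q_cons_cm h, h2, List.countP_cons_of_neg (by simpa using h.2)]

lemma Good.gap {x m y : List V} {s : V} (h : Good (x ++ s :: (m ++ s :: y))) (hs : s ∉ m) :
    2 ≤ m.countP (fun a => decide (Adj a s)) := by
  by_contra hc
  have h1 := h s
  rw [q_append, q_cons_self, q_append, q_cons_self, q_length s m hs] at h1
  have : m.countP (fun a => decide (Adj a s)) = 0 ∨ m.countP (fun a => decide (Adj a s)) = 1 := by
    omega
  rcases this with h0 | h0
  · rw [h0] at h1
    exact h1.1 ⟨q s x, q s y, by simp⟩
  · rw [h0] at h1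
    exact h1.2 ⟨q s x, q s y, by simp⟩

def LIrr (l : List V) : Prop := ∀ s t m, Adj s t → ¬ CE l (s :: t :: m)
def RIrr (l : List V) : Prop := ∀ s t m, Adj s t → ¬ CE l (m ++ [s, t])

lemma RIrr.reverse {l : List V} (h : RIrr l) : LIrr l.reverse := by
  intro s t m hst k
  apply h t s m.reverse hst.symm
  apply CE.of_reverse
  simpa using k

lemma LIrr.reverse {l : List V} (h : LIrr l) : RIrr l.reverse := by
  intro s t m hst k
  apply h t s m.reverse hst.symm
  apply CE.of_reverse
  simpa using k

lemma LIrr.rev {l : List V} (h : LIrr l) : LIrr (l.map Fin.rev) := by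
  intro s t m hst k
  apply h s.rev t.rev (m.map Fin.rev) (adj_rev.2 hst)
  have k' := k.rev
  rw [map_rev_rev] at k'
  simpa using k'

lemma RIrr.rev {l : List V} (h : RIrr l) : RIrr (l.map Fin.rev) := by
  intro s t m hst k
  apply h s.rev t.rev (m.map Fin.rev) (adj_rev.2 hst)
  have k' := k.rev
  rw [map_rev_rev] at k'
  simpa using k'

lemma LIrr.ce {l l' : List V} (h : LIrr l) (h' : CE l l') : LIrr l' :=
  fun s t m hst k => h s t m hst (h'.trans k)
lemma RIrr.ce {l l' : List V} (h : RIrr l) (h' : CE l l') : RIrr l' :=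
  fun s t m hst k => h s t m hst (h'.trans k)
lemma RIrr.right {l l' : List V} (h : RIrr (l ++ l')) : RIrr l' := by
  intro s t m hst k
  apply h s t (l ++ m) hst
  simpa using k.appl l


end

section
local notation "V" => Fin (n+3)

section
open Classical

/-- signed reflection action of a generator -/
noncomputable def sg (cs : CoxeterSystem (DMatrix n) W) (i : V) : Function.End (W × ZMod 2) :=
  fun p => (cs.simple i * p.1 * cs.simple i, p.2 + if p.1 = cs.simple i then 1 else 0)

lemma sg_word (cs : CoxeterSystem (DMatrix n) W) (l : List V) (t : W) (e : ZMod 2) :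
    ((l.map (sg cs)).prod : Function.End (W × ZMod 2)) (t, e) =
      (cs.wordProd l * t * (cs.wordProd l)⁻¹, e + ((cs.rightInvSeq l).count t : ℕ)) := by
  induction l with
  | nil => simp [Function.End.one_def]
  | cons i l ih =>
    rw [List.map_cons, List.prod_cons]
    change sg cs i ((l.map (sg cs)).prod (t, e)) = _
    rw [ih]
    simp only [sg, CoxeterSystem.rightInvSeq, CoxeterSystem.wordProd_cons]
    refine Prod.ext ?_ ?_
    · simp [mul_assoc]
    · simp only [List.count_cons]
      have : (cs.wordProd l * t * (cs.wordProd l)⁻¹ = cs.simple i) ↔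
          (((cs.wordProd l)⁻¹ * cs.simple i * cs.wordProd l) = t) := by
        constructor
        · intro h; rw [← h]; group
        · intro h; rw [← h]; group
      by_cases h : ((cs.wordProd l)⁻¹ * cs.simple i * cs.wordProd l) = t
      · rw [if_pos (this.2 h)]; simp [h, add_assoc]
      · rw [if_neg (fun k => h (this.1 k))]; simp [h]

lemma sg_lift (hn : 2 ≤ n) (cs : CoxeterSystem (DMatrix n) W) :
    (DMatrix n).IsLiftable (sg cs) := by
  intro i j
  have key : ∀ l : List V, cs.wordProd l = 1 → (∀ t, Even ((cs.rightInvSeq l).count t)) →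
      (l.map (sg cs)).prod = 1 := by
    intro l h1 h2
    funext p
    obtain ⟨t, e⟩ := p
    rw [sg_word, h1]
    have := (ZMod.natCast_eq_zero_iff_even).2 (h2 t)
    rw [this]; simp [Function.End.one_def]
  have hij := cs.simple_mul_simple_pow i j
  have ii := cs.simple_mul_simple_self i
  have jj := cs.simple_mul_simple_self j
  rw [dm_apply hn] at hij ⊢
  split_ifs with h1 h2
  · rw [if_pos h1] at hij
    have : (sg cs i * sg cs j)^3 = ([i,j,i,j,i,j].map (sg cs)).prod := by
      simp [pow_succ, mul_assoc]
    rw [this]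
    apply key
    · simpa [CoxeterSystem.wordProd, pow_succ, mul_assoc] using hij
    · intro t
      have iI : (cs.simple i)⁻¹ = cs.simple i := by simp
      have jJ : (cs.simple j)⁻¹ = cs.simple j := by simp
      have br : cs.simple j * (cs.simple i * cs.simple j) =
        cs.simple i * (cs.simple j * cs.simple i) := by
        have e1 : cs.simple i * cs.simple j * cs.simple i * (cs.simple j * cs.simple i * cs.simple j) = 1 := by
          simpa [pow_succ, mul_assoc] using hij
        have := eq_inv_of_mul_eq_one_left e1
        rw [mul_inv_rev, mul_inv_rev, iI, jJ] at this
        simpa [mul_assoc] using this.symm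
      have : cs.rightInvSeq [i,j,i,j,i,j] = [cs.simple i, cs.simple i * (cs.simple j * cs.simple i), cs.simple j]
        ++ [cs.simple i, cs.simple i * (cs.simple j * cs.simple i), cs.simple j] := by
        have b2 : ∀ z, cs.simple j * (cs.simple i * (cs.simple j * z)) =
          cs.simple i * (cs.simple j * (cs.simple i * z)) := by
          intro z
          have := congrArg (· * z) br
          simpa [mul_assoc] using this
        simp [CoxeterSystem.rightInvSeq, CoxeterSystem.wordProd, mul_assoc, b2, br]
      rw [this, List.count_append]
      exact ⟨_, rfl⟩
  · subst h2
    have : (sg cs i * sg cs i)^1 = ([i,i].map (sg cs)).prod := by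
      simp
    rw [this]
    apply key
    · simpa [CoxeterSystem.wordProd] using ii
    · intro t
      have : cs.rightInvSeq [i,i] = [cs.simple i] ++ [cs.simple i] := by
        simp [CoxeterSystem.rightInvSeq, CoxeterSystem.wordProd]
      rw [this, List.count_append]
      exact ⟨_, rfl⟩
  · rw [if_neg h1, if_neg h2] at hij
    have : (sg cs i * sg cs j)^2 = ([i,j,i,j].map (sg cs)).prod := by
      simp [pow_succ, mul_assoc]
    rw [this]
    apply key
    · simpa [CoxeterSystem.wordProd, pow_succ, mul_assoc] using hij
    · intro t
      have iI : (cs.simple i)⁻¹ = cs.simple i := by simp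
      have jJ : (cs.simple j)⁻¹ = cs.simple j := by simp
      have br : cs.simple j * cs.simple i = cs.simple i * cs.simple j := by
        have e1 : cs.simple i * cs.simple j * (cs.simple i * cs.simple j) = 1 := by
          simpa [pow_succ, mul_assoc] using hij
        have := eq_inv_of_mul_eq_one_left e1
        rw [mul_inv_rev, iI, jJ] at this
        exact this.symm
      have b2 : ∀ z, cs.simple j * (cs.simple i * z) = cs.simple i * (cs.simple j * z) := by
        intro z
        rw [← mul_assoc, br, mul_assoc]
      have : cs.rightInvSeq [i,j,i,j] = [cs.simple i, cs.simple j]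
        ++ [cs.simple i, cs.simple j] := by
        simp [CoxeterSystem.rightInvSeq, CoxeterSystem.wordProd, mul_assoc, b2, br]
      rw [this, List.count_append]
      exact ⟨_, rfl⟩

lemma count_parity (hn : 2 ≤ n) (cs : CoxeterSystem (DMatrix n) W) (l l' : List V)
    (h : cs.wordProd l = cs.wordProd l') (t : W) :
    ((((cs.rightInvSeq l).count t : ℕ)) : ZMod 2) = ((cs.rightInvSeq l').count t : ℕ) := by
  have key : ∀ l : List V, cs.lift ⟨sg cs, sg_lift hn cs⟩ (cs.wordProd l) = (l.map (sg cs)).prod := by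
    intro l
    induction l with
    | nil => simp
    | cons i l ih =>
      rw [CoxeterSystem.wordProd_cons, map_mul, ih, CoxeterSystem.lift_apply_simple]; simp
  have h1 := sg_word cs l t 0
  have h2 := sg_word cs l' t 0
  rw [← key, h, key, h2] at h1
  have := congrArg Prod.snd h1
  simpa using this.symm

lemma exchange_right (hn : 2 ≤ n) (cs : CoxeterSystem (DMatrix n) W) (l : List V)
    (hl : cs.IsReduced l) (s : V) (h : cs.IsRightDescent (cs.wordProd l) s) :
    ∃ j, j < l.length ∧ cs.wordProd l * cs.simple s = cs.wordProd (l.eraseIdx j) := by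
  obtain ⟨l', hl', hw⟩ := cs.exists_isReduced (cs.wordProd l * cs.simple s)
  have e : cs.wordProd (l' ++ [s]) = cs.wordProd l := by
    rw [CoxeterSystem.wordProd_append, ← hw]; simp
  have hr : cs.IsReduced (l' ++ [s]) := by
    unfold CoxeterSystem.IsReduced
    rw [e]
    have := (cs.isRightDescent_iff).1 h
    rw [hw] at this
    have h2 : cs.length (cs.wordProd l') = l'.length := hl'
    simp [← this, h2]
  have hmem : cs.simple s ∈ cs.rightInvSeq l := by
    have hp := count_parity hn cs l (l' ++ [s]) e.symm (cs.simple s)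
    have hin : cs.simple s ∈ cs.rightInvSeq (l' ++ [s]) := by
      rw [← List.concat_eq_append, CoxeterSystem.rightInvSeq_concat]; simp
    have hnd := hr.nodup_rightInvSeq
    rw [List.count_eq_one_of_mem hnd hin] at hp
    by_contra hc
    rw [List.count_eq_zero_of_not_mem hc] at hp
    simp at hp
  obtain ⟨j, hj, hjs⟩ := List.mem_iff_getElem.1 hmem
  refine ⟨j, by simpa using hj, ?_⟩
  rw [← CoxeterSystem.wordProd_mul_getD_rightInvSeq, List.getD_eq_getElem _ _ hj, hjs]

end

lemma exchange (hn : 2 ≤ n) (cs : CoxeterSystem (DMatrix n) W) (l : List V)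
    (hl : cs.IsReduced l) (s : V) (h : cs.IsLeftDescent (cs.wordProd l) s) :
    ∃ j, j < l.length ∧ cs.simple s * cs.wordProd l = cs.wordProd (l.eraseIdx j) := by
  have h' : cs.IsRightDescent (cs.wordProd l.reverse) s := by
    rw [CoxeterSystem.wordProd_reverse]; exact (cs.isRightDescent_inv_iff).2 h
  obtain ⟨j, hj, e⟩ := exchange_right hn cs l.reverse (by simpa using hl) s h'
  rw [List.length_reverse] at hj
  refine ⟨l.length - 1 - j, by omega, ?_⟩
  have e2 : l.reverse.eraseIdx j = (l.eraseIdx (l.length - 1 - j)).reverse := by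
    rw [List.eraseIdx_eq_take_drop_succ, List.eraseIdx_eq_take_drop_succ, List.reverse_append,
      List.reverse_take, List.reverse_drop]
    congr 2 <;> omega
  rw [e2, CoxeterSystem.wordProd_reverse, CoxeterSystem.wordProd_reverse] at e
  have := congrArg (·⁻¹) e
  simpa using this

/-- mod 2 reflection representation -/
def rp (i : V) : Function.End (V → ZMod 2) := fun f j => f j + if Adj i j then f i else 0

lemma zz (x : ZMod 2) : x + x = 0 := CharTwo.add_self_eq_zero x

lemma rp_lift (hn : 2 ≤ n) : (DMatrix n).IsLiftable (rp (n := n)) := by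
  intro i j
  have m : ∀ (x y : Function.End (V → ZMod 2)) (f : V → ZMod 2), (x * y) f = x (y f) :=
    fun _ _ _ => rfl
  have o : ∀ (f : V → ZMod 2), (1 : Function.End (V → ZMod 2)) f = f := fun _ => rfl
  rw [dm_apply hn]
  split_ifs with h1 h2
  · funext f k
    have h3 := h1.symm
    simp only [pow_succ, pow_zero, one_mul, m, o]
    by_cases e1 : Adj i k <;> by_cases e2 : Adj j k <;>
      simp only [rp, h1, h3, e1, e2, not_adj_self, if_true, if_false, add_zero] <;>
      generalize f i = a <;> generalize f j = b <;> generalize f k = c <;>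
      revert a b c <;> decide
  · subst h2
    funext f k
    simp only [pow_succ, pow_zero, one_mul, m, o]
    by_cases e1 : Adj i k <;>
      simp only [rp, e1, not_adj_self, if_true, if_false, add_zero] <;>
      generalize f i = a <;> generalize f k = c <;>
      revert a c <;> decide
  · funext f k
    have h3 : ¬ Adj j i := fun h => h1 h.symm
    simp only [pow_succ, pow_zero, one_mul, m, o]
    by_cases e1 : Adj i k <;> by_cases e2 : Adj j k <;>
      simp only [rp, h1, h3, e1, e2, not_adj_self, if_true, if_false, add_zero] <;>
      generalize f i = a <;> generalize f j = b <;> generalize f k = c <;>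
      revert a b c <;> decide

lemma exists_adj (hn : 2 ≤ n) (i : V) : ∃ k, Adj i k := by
  have := i.2
  by_cases h : cl i = 1
  · exact ⟨⟨2, by omega⟩, by unfold Adj; left; rw [h]; unfold cl; simp; omega⟩
  · have := cl_ge i
    have := cl_le i
    refine ⟨⟨cl i - 1, by omega⟩, ?_⟩
    unfold Adj; right
    have key : ∀ x (hx : x < n + 3), 1 ≤ x → x ≤ n → cl (⟨x, hx⟩ : V) = x := by
      intro x hx h1 h2
      unfold cl
      simp only
      split_ifs <;> omega
    rw [key _ _ (by omega) (by omega)]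
    omega

lemma simple_inj (hn : 2 ≤ n) (cs : CoxeterSystem (DMatrix n) W) {i j : V}
    (h : cs.simple i = cs.simple j) : i = j := by
  by_contra hc
  obtain ⟨k, hk⟩ := exists_adj hn i
  have := congrArg (cs.lift ⟨rp, rp_lift hn⟩) h
  rw [CoxeterSystem.lift_apply_simple, CoxeterSystem.lift_apply_simple] at this
  have h2 := congrFun (congrFun this (fun v => if v = i then 1 else 0)) k
  simp only [rp, hk, if_true] at h2
  have h3 : ¬ j = i := fun e => hc e.symm
  simp [h3] at h2


end

section
local notation "V" => Fin (n+3)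

lemma cs_comm (hn : 2 ≤ n) (cs : CoxeterSystem (DMatrix n) W) {i j : V} (h : Cm i j) :
    cs.simple i * cs.simple j = cs.simple j * cs.simple i := by
  have hij := cs.simple_mul_simple_pow i j
  rw [(dm_two hn i j).2 h, pow_two] at hij
  have := eq_inv_of_mul_eq_one_left hij
  rw [mul_inv_rev] at this
  simpa using this

lemma cs_braid (hn : 2 ≤ n) (cs : CoxeterSystem (DMatrix n) W) {i j : V} (h : Adj i j) :
    cs.simple i * (cs.simple j * cs.simple i) = cs.simple j * (cs.simple i * cs.simple j) := by
  have hij := cs.simple_mul_simple_pow i j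
  rw [dm_apply hn, if_pos h] at hij
  have e1 : (cs.simple i * cs.simple j * cs.simple i) *
      (cs.simple j * cs.simple i * cs.simple j) = 1 := by
    simpa [pow_succ, mul_assoc] using hij
  have := eq_inv_of_mul_eq_one_left e1
  rw [mul_inv_rev, mul_inv_rev] at this
  simpa [mul_assoc] using this

lemma CE.wp (hn : 2 ≤ n) (cs : CoxeterSystem (DMatrix n) W) {l l' : List V} (h : CE l l') :
    cs.wordProd l = cs.wordProd l' := by
  induction h with
  | refl l => rfl
  | swap a b l h =>
    simp only [CoxeterSystem.wordProd_cons, ← mul_assoc, cs_comm hn cs h]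
  | cons a _ ih => simp only [CoxeterSystem.wordProd_cons, ih]
  | trans _ _ h1 h2 => exact h1.trans h2

lemma CE.red (hn : 2 ≤ n) (cs : CoxeterSystem (DMatrix n) W) {l l' : List V} (h : CE l l')
    (hl : cs.IsReduced l) : cs.IsReduced l' := by
  unfold CoxeterSystem.IsReduced at *
  rw [← h.wp hn cs, ← h.perm.length_eq]; exact hl

lemma red_of {cs : CoxeterSystem (DMatrix n) W} {l l' : List V} (hl : cs.IsReduced l)
    (h : cs.wordProd l = cs.wordProd l') (hlen : l.length = l'.length) : cs.IsReduced l' := by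
  unfold CoxeterSystem.IsReduced at *
  rw [← h, ← hlen]; exact hl

lemma red_tail {cs : CoxeterSystem (DMatrix n) W} {a : V} {l : List V}
    (hl : cs.IsReduced (a :: l)) : cs.IsReduced l := by
  simpa using hl.drop 1

lemma red_desc {cs : CoxeterSystem (DMatrix n) W} {a : V} {l : List V}
    (hl : cs.IsReduced (a :: l)) : cs.IsLeftDescent (cs.wordProd (a :: l)) a := by
  have h2 := red_tail hl
  unfold CoxeterSystem.IsReduced at *
  unfold CoxeterSystem.IsLeftDescent
  rw [hl]
  simp [CoxeterSystem.wordProd_cons, h2]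

lemma red_descR {cs : CoxeterSystem (DMatrix n) W} {a : V} {l : List V}
    (hl : cs.IsReduced (l ++ [a])) : cs.IsRightDescent (cs.wordProd (l ++ [a])) a := by
  have h2 : cs.IsReduced l := by simpa using hl.take l.length
  unfold CoxeterSystem.IsReduced at *
  unfold CoxeterSystem.IsRightDescent
  rw [hl]
  simp [CoxeterSystem.wordProd_append, h2]

lemma red_cons {cs : CoxeterSystem (DMatrix n) W} {a : V} {m : List V} {w : W}
    (hm : cs.IsReduced m) (h : cs.wordProd m = cs.simple a * w) (hd : cs.IsLeftDescent w a) :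
    cs.IsReduced (a :: m) ∧ cs.wordProd (a :: m) = w := by
  have e : cs.wordProd (a :: m) = w := by simp [CoxeterSystem.wordProd_cons, h]
  refine ⟨?_, e⟩
  have := (cs.isLeftDescent_iff).1 hd
  unfold CoxeterSystem.IsReduced at *
  rw [e, ← this, ← h, hm]; rfl

lemma red_snoc {cs : CoxeterSystem (DMatrix n) W} {a : V} {m : List V} {w : W}
    (hm : cs.IsReduced m) (h : cs.wordProd m = w * cs.simple a) (hd : cs.IsRightDescent w a) :
    cs.IsReduced (m ++ [a]) ∧ cs.wordProd (m ++ [a]) = w := by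
  have e : cs.wordProd (m ++ [a]) = w := by simp [CoxeterSystem.wordProd_append, h]
  refine ⟨?_, e⟩
  have := (cs.isRightDescent_iff).1 hd
  unfold CoxeterSystem.IsReduced at *
  rw [e, ← this, ← h, hm]; simp

lemma Good.fc (hn : 2 ≤ n) (cs : CoxeterSystem (DMatrix n) W) : ∀ (N : ℕ) (l l' : List V),
    l.length = N → Good l → cs.IsReduced l → cs.IsReduced l' →
    cs.wordProd l = cs.wordProd l' → CE l l' := by
  intro N
  induction N with
  | zero =>
    intro l l' hN _ hl hl' e
    have : l'.length = 0 := by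
      unfold CoxeterSystem.IsReduced at hl hl'
      rw [← hl', ← e, hl, hN]
    rw [List.length_eq_zero_iff] at hN this
    rw [hN, this]; exact .refl _
  | succ N ih =>
    intro l l' hN hg hl hl' e
    have hlen : l'.length = l.length := by
      unfold CoxeterSystem.IsReduced at hl hl'
      rw [← hl', ← e, hl]
    obtain ⟨a, m, rfl⟩ : ∃ a m, l = a :: m := by
      cases l with
      | nil => simp at hN
      | cons a m => exact ⟨a, m, rfl⟩
    obtain ⟨s, k, rfl⟩ : ∃ a m, l' = a :: m := by
      cases l' with
      | nil => simp at hlen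
      | cons a m => exact ⟨a, m, rfl⟩
    simp only [List.length_cons, Nat.add_right_cancel_iff] at hN hlen
    have hm := red_tail hl
    have hk := red_tail hl'
    by_cases has : a = s
    · subst has
      refine .cons a (ih m k hN (Good.right (l := [a]) hg) hm hk ?_)
      simpa [CoxeterSystem.wordProd_cons] using e
    have hd : cs.IsLeftDescent (cs.wordProd (a :: m)) s := by
      rw [e]; exact red_desc hl'
    obtain ⟨j, hj, hje⟩ := exchange hn cs _ hl s hd
    rcases j with _ | j
    · exfalso
      simp only [List.eraseIdx_zero, List.tail_cons, CoxeterSystem.wordProd_cons, ← mul_assoc,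
        mul_eq_right] at hje
      have h3 := eq_inv_of_mul_eq_one_left hje
      rw [CoxeterSystem.inv_simple] at h3
      exact has (simple_inj hn cs h3).symm
    rw [List.eraseIdx_cons_succ] at hje
    have hjm : j < m.length := by simpa using hj
    set m' := m.eraseIdx j with hm'
    have hm'l : m'.length + 1 = m.length := by
      rw [hm', List.length_eraseIdx_of_lt hjm]; omega
    have e2 : cs.wordProd (a :: m) = cs.wordProd (s :: a :: m') := by
      rw [CoxeterSystem.wordProd_cons _ s, ← hje]; simp
    have hr2 : cs.IsReduced (s :: a :: m') := red_of hl e2 (by simp [hm'l])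
    rcases tri a s with h | h | h
    · exact absurd h has
    · exfalso
      have hd2 : cs.IsLeftDescent (cs.wordProd (s :: a :: m')) a := by
        rw [← e2]; exact red_desc hl
      obtain ⟨i, hi, hie⟩ := exchange hn cs _ hr2 a hd2
      have e3 : cs.simple a * cs.wordProd (s :: a :: m') = cs.wordProd m := by
        rw [← e2]; simp [CoxeterSystem.wordProd_cons]
      rw [e3] at hie
      rcases i with _ | _ | i
      · simp only [List.eraseIdx_zero, List.tail_cons] at hie
        have : cs.simple s * cs.wordProd m = cs.simple a * cs.wordProd m := by
          conv_lhs => rw [hie]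
          rw [← CoxeterSystem.wordProd_cons, ← CoxeterSystem.wordProd_cons, e2]
        exact has (simple_inj hn cs (mul_right_cancel this)).symm
      · simp only [List.eraseIdx_cons_succ, List.eraseIdx_zero, List.tail_cons] at hie
        have h5 : cs.simple a * cs.simple s = cs.simple s * cs.simple a := by
          have : cs.wordProd (a :: m) = cs.wordProd (a :: s :: m') := by
            rw [CoxeterSystem.wordProd_cons, hie, ← CoxeterSystem.wordProd_cons]
          rw [e2] at this
          simp only [CoxeterSystem.wordProd_cons, ← mul_assoc] at this
          exact (mul_right_cancel this).symm
        have h6 := cs_braid hn cs h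
        rw [h5, ← h5] at h6
        simp only [← mul_assoc, CoxeterSystem.simple_mul_simple_self, one_mul] at h6
        rw [← h5, mul_assoc, CoxeterSystem.simple_mul_simple_self, mul_one] at h6
        exact has (simple_inj hn cs h6).symm
      · simp only [List.eraseIdx_cons_succ] at hie
        have hi' : i < m'.length := by simpa using hi
        have hr3 : cs.IsReduced (s :: a :: m'.eraseIdx i) := red_of hm hie (by
          simp [List.length_eraseIdx_of_lt hi']; omega)
        have h7 := ih m _ hN (Good.right (l := [a]) hg) hm hr3 hie
        have h8 := hg.ce (CE.cons a h7)
        have h9 := (h8 a).2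
        rw [q_cons_self, q_cons_adj h.symm, q_cons_self] at h9
        exact h9 ⟨[], q a (m'.eraseIdx i), by simp⟩
    · have e3 : cs.wordProd m = cs.wordProd (s :: m') := by
        have : cs.simple a * cs.wordProd m = cs.simple a * cs.wordProd (s :: m') := by
          rw [← CoxeterSystem.wordProd_cons, e2]
          simp only [CoxeterSystem.wordProd_cons, ← mul_assoc, cs_comm hn cs h]
        exact mul_left_cancel this
      have hr3 : cs.IsReduced (s :: m') := red_of hm e3 (by simp [hm'l])
      have c1 := ih m _ hN (Good.right (l := [a]) hg) hm hr3 e3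
      have c2 : CE (a :: m) (s :: a :: m') := (CE.cons a c1).trans (.swap a s m' h)
      have c3 := ih (a :: m') k (by simp; omega) (Good.right (l := [s]) (hg.ce c2)) (red_tail hr2) hk (by
        rw [e2] at e
        simpa [CoxeterSystem.wordProd_cons] using e)
      exact c2.trans (.cons s c3)

lemma Good.isFC (hn : 2 ≤ n) (cs : CoxeterSystem (DMatrix n) W) {l : List V} (hg : Good l)
    (hl : cs.IsReduced l) : IsFC cs (cs.wordProd l) := by
  intro x y hx hy ex ey
  rw [← ce_iff hn]
  exact (Good.fc hn cs _ l x rfl hg hl hx ex.symm).symm.trans (Good.fc hn cs _ l y rfl hg hl hy ey.symm)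

lemma qf_true {s a : V} : qf s a = some true ↔ a = s := by
  unfold qf; split_ifs <;> simp_all
lemma qf_false {s a : V} : qf s a = some false ↔ Adj a s := by
  unfold qf; split_ifs with h1 h2 <;> simp_all [not_adj_self]
lemma qf_none {s a : V} : qf s a = none ↔ Cm a s := by
  unfold qf Cm; split_ifs <;> simp_all

/-- head of the projection -/
lemma q_head_true {s : V} {l : List V} {t : List Bool} (h : q s l = true :: t) :
    ∃ m, CE l (s :: m) ∧ q s m = t := by
  obtain ⟨x, a, y, rfl, h1, h2, h3⟩ := List.filterMap_eq_cons_iff.1 h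
  rw [qf_true] at h2
  subst h2
  refine ⟨x ++ y, CE.front y (fun b hb => qf_none.1 (h1 b hb)), ?_⟩
  have : q a x = [] := List.filterMap_eq_nil_iff.2 h1
  rw [q_append, this]; exact h3

lemma not_gd {s : V} {l : List V} (h : ¬ Gd (q s l)) : ∃ x y, CE l (x ++ s :: s :: y) ∨
    ∃ t, Adj t s ∧ CE l (x ++ s :: t :: s :: y) := by
  unfold Gd at h
  rw [not_and_or, not_not, not_not] at h
  have key : ∀ b t, b :: t <:+: q s l → ∃ x a y, l = x ++ a :: y ∧ qf s a = some b ∧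
      t <+: q s y := by
    rintro b t ⟨u, v, h⟩
    rw [List.append_assoc, List.cons_append] at h
    obtain ⟨l1, l2, rfl, h1, h2⟩ := List.filterMap_eq_append_iff.1 h.symm
    obtain ⟨x, a, y, rfl, h3, h4, h5⟩ := List.filterMap_eq_cons_iff.1 h2
    exact ⟨l1 ++ x, a, y, by simp, h4, ⟨v, h5.symm⟩⟩
  rcases h with h | h
  · obtain ⟨x, a, y, rfl, h1, v, h2⟩ := key _ _ h
    rw [qf_true] at h1
    subst h1
    obtain ⟨m, h3, h4⟩ := q_head_true h2.symm
    exact ⟨x, m, .inl ((CE.cons a h3).appl x)⟩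
  · obtain ⟨x, a, y, rfl, h1, v, h2⟩ := key _ _ h
    rw [qf_true] at h1
    subst h1
    obtain ⟨z, b, y', rfl, h3, h4, h5⟩ := List.filterMap_eq_cons_iff.1 h2.symm
    rw [qf_false] at h4
    obtain ⟨m, h6, h7⟩ := q_head_true h5
    refine ⟨x ++ z, m, .inr ⟨b, h4, ?_⟩⟩
    rw [List.append_assoc]
    refine CE.appl x ?_
    exact (CE.front (c := a) _ (fun b hb => qf_none.1 (h3 b hb))).symm.trans
      (CE.appl z (.cons _ (.cons _ h6)))

lemma fc_good (hn : 2 ≤ n) (cs : CoxeterSystem (DMatrix n) W) {l : List V}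
    (hl : cs.IsReduced l) (hw : IsFC cs (cs.wordProd l)) : Good l := by
  intro s
  by_contra hc
  obtain ⟨x, y, h | ⟨t, ht, h⟩⟩ := not_gd hc
  · have h1 := h.red hn cs hl
    have h2 : cs.IsReduced (s :: s :: y) := by simpa using h1.drop x.length
    have h3 : cs.length (cs.wordProd (s :: s :: y)) = y.length + 2 := h2
    rw [show cs.wordProd (s :: s :: y) = cs.wordProd y by simp [CoxeterSystem.wordProd_cons]] at h3
    have := cs.length_wordProd_le y
    omega
  · have h1 := h.red hn cs hl
    have h2 : cs.wordProd (x ++ s :: t :: s :: y) = cs.wordProd (x ++ t :: s :: t :: y) := by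
      have b := cs_braid hn cs ht
      have := congrArg (fun z => cs.wordProd x * (z * cs.wordProd y)) b
      simpa [CoxeterSystem.wordProd_append, CoxeterSystem.wordProd_cons, mul_assoc] using this.symm
    have h3 := red_of h1 h2 (by simp)
    have h4 := hw l _ hl h3 rfl (by rw [h.wp hn cs, h2])
    rw [← ce_iff hn] at h4
    have h5 := (h.symm.trans h4).perm.count_eq s
    have h6 := ht.ne
    simp [List.count_append, h6] at h5

lemma star_lirr (hn : 2 ≤ n) (cs : CoxeterSystem (DMatrix n) W) {l : List V}
    (hl : cs.IsReduced l) (hw : StarIrreducible cs (cs.wordProd l)) : LIrr l := by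
  intro s t m hst h
  have h1 := h.red hn cs hl
  refine (hw s t).1 ⟨(big_iff hn _ _).2 hst, ?_, ?_⟩
  · rw [h.wp hn cs]; exact red_desc h1
  · rw [h.wp hn cs, CoxeterSystem.wordProd_cons]
    simpa using red_desc (red_tail h1)

lemma star_rirr (hn : 2 ≤ n) (cs : CoxeterSystem (DMatrix n) W) {l : List V}
    (hl : cs.IsReduced l) (hw : StarIrreducible cs (cs.wordProd l)) : RIrr l := by
  intro s t m hst h
  have h1 := h.red hn cs hl
  have e : m ++ [s, t] = (m ++ [s]) ++ [t] := by simp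
  rw [e] at h h1
  refine (hw t s).2 ⟨(big_iff hn _ _).2 hst.symm, ?_, ?_⟩
  · rw [h.wp hn cs]; exact red_descR h1
  · rw [h.wp hn cs, CoxeterSystem.wordProd_append]
    have h2 : cs.IsReduced (m ++ [s]) := by
      have := h1.take (m ++ [s]).length
      rwa [List.take_left] at this
    simpa using red_descR h2

lemma irr_star (hn : 2 ≤ n) (cs : CoxeterSystem (DMatrix n) W) {l : List V}
    (hl : cs.IsReduced l) (hg : Good l) (h1 : LIrr l) (h2 : RIrr l) :
    StarIrreducible cs (cs.wordProd l) := by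
  intro s t
  constructor
  · rintro ⟨hb, d1, d2⟩
    obtain ⟨m, hm, hm2⟩ := cs.exists_isReduced (cs.simple t * (cs.simple s * cs.wordProd l))
    obtain ⟨r1, e1⟩ := red_cons hm hm2.symm d2
    obtain ⟨r2, e2⟩ := red_cons r1 e1 d1
    exact h1 s t m ((big_iff hn _ _).1 hb) (Good.fc hn cs _ l _ rfl hg hl r2 e2.symm)
  · rintro ⟨hb, d1, d2⟩
    obtain ⟨m, hm, hm2⟩ := cs.exists_isReduced (cs.wordProd l * cs.simple s * cs.simple t)
    obtain ⟨r1, e1⟩ := red_snoc hm hm2.symm d2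
    obtain ⟨r2, e2⟩ := red_snoc r1 e1 d1
    exact h2 t s m ((big_iff hn _ _).1 hb).symm
      (Good.fc hn cs _ l _ rfl hg hl (by simpa using r2) (by simpa using e2.symm))

lemma desc_iff (hn : 2 ≤ n) (cs : CoxeterSystem (DMatrix n) W) {l : List V}
    (hl : cs.IsReduced l) (hg : Good l) (a : V) :
    cs.IsLeftDescent (cs.wordProd l) a ↔ ∃ m, CE l (a :: m) := by
  constructor
  · intro d
    obtain ⟨m, hm, hm2⟩ := cs.exists_isReduced (cs.simple a * cs.wordProd l)
    obtain ⟨r1, e1⟩ := red_cons hm hm2.symm d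
    exact ⟨m, Good.fc hn cs _ l _ rfl hg hl r1 e1.symm⟩
  · rintro ⟨m, h⟩
    rw [h.wp hn cs]; exact red_desc (h.red hn cs hl)

lemma front_iff {l : List V} {a : V} : (∃ m, CE l (a :: m)) ↔ (q a l).head? = some true := by
  constructor
  · rintro ⟨m, h⟩
    rw [q_ce h, q_cons_self]; rfl
  · intro h
    cases e : q a l with
    | nil => rw [e] at h; simp at h
    | cons b t =>
      rw [e] at h
      simp at h
      subst h
      obtain ⟨m, h1, _⟩ := q_head_true e
      exact ⟨m, h1⟩


end

section
local notation "V" => Fin (n+3)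

lemma dv_val {k : ℕ} (hk : k ≤ n + 2) : (dv n k).1 = k := Nat.mod_eq_of_lt (by omega)
lemma dv_self (a : V) : dv n a.1 = a := Fin.ext (Nat.mod_eq_of_lt a.2)
lemma cl_dv {k : ℕ} (h1 : 1 ≤ k) (hk : k ≤ n + 1) : cl (dv n k) = k := by
  unfold cl; rw [dv_val (by omega)]; split_ifs <;> omega
lemma cl_dv0 : cl (dv n 0) = 1 := by
  unfold cl; rw [dv_val (by omega)]; simp
lemma cl_dvn : cl (dv n (n+2)) = n + 1 := by
  unfold cl; rw [dv_val (by omega)]; simp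
lemma rev_dv {k : ℕ} (hk : k ≤ n + 2) : (dv n k).rev = dv n (n + 2 - k) := by
  apply Fin.ext
  rw [Fin.val_rev, dv_val hk, dv_val (by omega)]; omega
lemma cl_one {a : V} (h : cl a = 1) (hn : 2 ≤ n) : a = dv n 0 ∨ a = dv n 1 := by
  have : a.1 = 0 ∨ a.1 = 1 := by unfold cl at h; split_ifs at h <;> omega
  rcases this with h | h
  · left; rw [← h, dv_self]
  · right; rw [← h, dv_self]
lemma cl_top {a : V} (h : cl a = n + 1) (hn : 2 ≤ n) : a = dv n (n+1) ∨ a = dv n (n+2) := by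
  have : a.1 = n+1 ∨ a.1 = n+2 := by
    unfold cl at h; have := a.2; split_ifs at h <;> omega
  rcases this with h | h
  · left; rw [← h, dv_self]
  · right; rw [← h, dv_self]
lemma dv_ne {j k : ℕ} (hj : j ≤ n + 2) (hk : k ≤ n + 2) (h : j ≠ k) : dv n j ≠ dv n k := by
  intro e
  have := congrArg Fin.val e
  rw [dv_val hj, dv_val hk] at this; exact h this
lemma eq_dv {a : V} {k : ℕ} (h : cl a = k) (h1 : 2 ≤ k) (h2 : k ≤ n) : a = dv n k :=
  eq_of_cl (by rw [h, cl_dv] <;> omega) (by omega) (by omega)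
lemma cm01 : Cm (dv n 0) (dv n 1) := by
  refine ⟨dv_ne (by omega) (by omega) (by omega), ?_⟩
  unfold Adj; rw [cl_dv0, cl_dv] <;> omega
lemma cmtop : Cm (dv n (n+1)) (dv n (n+2)) := by
  refine ⟨dv_ne (by omega) (by omega) (by omega), ?_⟩
  unfold Adj; rw [cl_dvn, cl_dv] <;> omega

def Ini (y : List V) (c : V) : Prop := ∃ m, CE y (c :: m)

lemma Ini.ce {y y' : List V} {c : V} (h : Ini y c) (e : CE y' y) : Ini y' c := by
  obtain ⟨m, k⟩ := h; exact ⟨m, e.trans k⟩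

lemma exists_ini {y : List V} (h : y ≠ []) : ∃ c, Ini y c := by
  cases y with
  | nil => exact absurd rfl h
  | cons c m => exact ⟨c, m, .refl _⟩

/-- Commuting past the first letter. -/
lemma Ini.cons {b c : V} {y : List V} (h : Ini y c) (hc : Cm b c) : Ini (b :: y) c := by
  obtain ⟨m, k⟩ := h
  exact ⟨b :: m, (CE.cons b k).trans (.swap b c m hc)⟩

lemma good_TT {x y : List V} {c : V} (h : Good (x ++ c :: c :: y)) : False := by
  refine (h c).1 ?_
  rw [q_append, q_cons_self, q_cons_self]
  exact ⟨q c x, q c y, by simp⟩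

lemma good_TT' {x y : List V} {c : V} (h : Good (x ++ y)) (hx : (q c x).getLast? = some true)
    (hy : (q c y).head? = some true) : False := by
  refine (h c).1 ?_
  rw [q_append]
  obtain ⟨u, hu⟩ := List.getLast?_eq_some_iff.1 hx
  obtain ⟨v, hv⟩ := List.head?_eq_some_iff.1 hy
  rw [hu, hv]
  exact ⟨u, v, by simp⟩

lemma good_TFT' {x y : List V} {b c : V} (h : Good (x ++ b :: y)) (hb : Adj b c)
    (hx : (q c x).getLast? = some true)
    (hy : (q c y).head? = some true) : False := by
  refine (h c).2 ?_
  rw [q_append, q_cons_adj hb]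
  obtain ⟨u, hu⟩ := List.getLast?_eq_some_iff.1 hx
  obtain ⟨v, hv⟩ := List.head?_eq_some_iff.1 hy
  rw [hu, hv]
  exact ⟨u, v, by simp⟩

lemma pass_step {P y : List V} {a b : V} (hab : cl b = cl a + 1) (Pl : ∃ P', P = P' ++ [a])
    (hlow : ∀ c, cl c = cl a → (q c P).getLast? = some true) (hg : Good (P ++ y))
    (hr : RIrr (P ++ y)) (hne : y ≠ []) (hin : ∀ c, Ini y c → c = b) :
    ∃ y', CE y (b :: y') ∧ y' ≠ [] ∧ ∀ c, Ini y' c → cl c = cl b + 1 := by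
  obtain ⟨c, hc⟩ := exists_ini hne
  have := hin c hc
  subst this
  obtain ⟨y', hy'⟩ := hc
  have hg' := hg.ce (hy'.appl P)
  refine ⟨y', hy', ?_, ?_⟩
  · rintro rfl
    obtain ⟨P', rfl⟩ := Pl
    exact hr a c P' (by left; omega) (by simpa using hy'.appl (P' ++ [a]))
  · intro d hd
    rcases tri c d with rfl | h | h
    · exfalso
      obtain ⟨m, hm⟩ := hd
      exact good_TT (hg'.ce ((CE.cons c hm).appl P))
    · rcases h with h | h
      · omega
      · exfalso
        exact good_TFT' hg' (Or.inr h) (hlow d (by omega)) (front_iff.1 hd)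
    · exfalso
      exact h.1 (hin d ((hd.cons h).ce hy')).symm

lemma pass_up (hn : 2 ≤ n) {y : List V} (hg : Good ([dv n 0, dv n 1] ++ y))
    (hr : RIrr ([dv n 0, dv n 1] ++ y)) (hne : y ≠ []) (hin : ∀ c, Ini y c → c = dv n 2) :
    ∃ y', CE y (AWord n ++ y') ∧ ∀ c, Ini y' c → c = dv n n := by
  have key : ∀ i, 1 ≤ i → i ≤ n → ∃ z, CE y ((List.range' 2 (i - 1)).map (dv n) ++ z) ∧ z ≠ [] ∧
      ∀ c, Ini z c → cl c = i + 1 := by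
    intro i h1
    induction i, h1 using Nat.le_induction with
    | base =>
      intro _
      refine ⟨y, .refl _, hne, ?_⟩
      intro c hc; rw [hin c hc, cl_dv] <;> omega
    | succ i h1 ih =>
      intro hi
      obtain ⟨z, hz, hzn, hzi⟩ := ih (by omega)
      have hz' := hz.appl [dv n 0, dv n 1]
      rw [← List.append_assoc] at hz'
      obtain ⟨z', e, h2, h3⟩ := pass_step (P := [dv n 0, dv n 1] ++ (List.range' 2 (i - 1)).map (dv n))
        (y := z) (a := dv n i) (b := dv n (i+1)) (by rw [cl_dv, cl_dv] <;> omega)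
        (by
          by_cases h : i = 1
          · subst h; exact ⟨[dv n 0], by simp⟩
          · obtain ⟨k, rfl⟩ : ∃ k, i = k + 2 := ⟨i - 2, by omega⟩
            refine ⟨[dv n 0, dv n 1] ++ (List.range' 2 k).map (dv n), ?_⟩
            rw [show k + 2 - 1 = k + 1 by omega, List.range'_concat]
            simp [Nat.add_comm])
        (by
          intro c hc
          rw [cl_dv (by omega) (by omega)] at hc
          by_cases h : i = 1
          · subst h
            rcases cl_one hc hn with rfl | rfl
            · simp [q_cons_self, q_cons_cm cm01.symm]
            · simp [q_cons_self, q_cons_cm cm01]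
          · rw [eq_dv hc (by omega) (by omega)]
            obtain ⟨k, rfl⟩ : ∃ k, i = k + 2 := ⟨i - 2, by omega⟩
            rw [show k + 2 - 1 = k + 1 by omega, List.range'_concat, List.map_append,
              ← List.append_assoc, q_append]
            rw [show 2 + 1 * k = k + 2 by omega]
            simp [q_cons_self])
        (hg.ce hz') (hr.ce hz') hzn (by
          intro c hc
          exact eq_dv (hzi c hc) (by omega) (by omega))
      refine ⟨z', ?_, h2, ?_⟩
      · obtain ⟨k, rfl⟩ : ∃ k, i = k + 1 := ⟨i - 1, by omega⟩
        rw [show k + 1 + 1 - 1 = k + 1 by omega, List.range'_concat, List.map_append,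
          List.append_assoc]
        rw [show k + 1 - 1 = k by omega] at hz
        refine hz.trans (CE.appl _ ?_)
        rw [show 2 + 1 * k = k + 1 + 1 by omega]
        exact e
      · intro c hc
        rw [h3 c hc, cl_dv] <;> omega
  obtain ⟨z, hz, hzn, hzi⟩ := key n (by omega) (by omega)
  have hz' := hz.appl [dv n 0, dv n 1]
  obtain ⟨k, rfl⟩ : ∃ k, n = k + 2 := ⟨n - 2, by omega⟩
  rw [show k + 2 - 1 = k + 1 by omega, List.range'_concat, List.map_append,
    show 2 + 1 * k = k + 2 by omega] at hz hz'
  set R := (List.range' 2 k).map (dv (k+2)) with hR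
  have hz2 : CE ([dv (k+2) 0, dv (k+2) 1] ++ y)
    (([dv (k+2) 0, dv (k+2) 1] ++ R) ++ dv (k+2) (k+2) :: z) := by simpa using hz'
  have hg2 := hg.ce hz2
  have hr2 := hr.ce hz2
  set P := [dv (k+2) 0, dv (k+2) 1] ++ R with hP
  have adjn : ∀ c : Fin (k+2+3), cl c = k + 2 + 1 → Adj (dv (k+2) (k+2)) c := by
    intro c hc; left; rw [cl_dv] <;> omega
  -- generic: first letter c, second d
  have fin : ∀ c d : Fin (k+2+3), Cm c d → cl c = k+2+1 → cl d = k+2+1 →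
      (∀ e, cl e = k+2+1 → e = c ∨ e = d) → Ini z c →
      ∃ y', CE z (c :: d :: y') ∧ ∀ e, Ini y' e → e = dv (k+2) (k+2) := by
    rintro c d hcd hc hd hall ⟨z1, h1⟩
    have e1 := (CE.cons (dv (k+2) (k+2)) h1).appl P
    have hg3 := hg2.ce e1
    have hr3 := hr2.ce e1
    have hz1 : z1 ≠ [] := by
      rintro rfl
      exact hr3 _ _ P (adjn c hc) (.refl _)
    have z1i : ∀ e, Ini z1 e → e = d := by
      intro e he
      rcases tri c e with rfl | h | h
      · obtain ⟨m, hm⟩ := he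
        have := hg3.ce (((CE.cons c hm).cons _).appl P)
        rw [show P ++ dv (k+2) (k+2) :: c :: c :: m = (P ++ [dv (k+2) (k+2)]) ++ c :: c :: m by simp] at this
        exact (good_TT this).elim
      · exfalso
        have : e = dv (k+2) (k+2) := by
          have := cl_le e
          refine eq_dv ?_ (by omega) (by omega)
          unfold Adj at h
          omega
        subst this
        rw [show P ++ dv (k+2) (k+2) :: c :: z1 = (P ++ [dv (k+2) (k+2)]) ++ c :: z1 by simp] at hg3
        exact good_TFT' hg3 h (by simp [q_cons_self]) (front_iff.1 he)
      · rcases hall e (hzi e ((he.cons h).ce h1)) with rfl | rfl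
        · exact absurd rfl h.1
        · rfl
    obtain ⟨d', hd'⟩ := exists_ini hz1
    have := z1i d' hd'
    subst this
    obtain ⟨y', h2⟩ := hd'
    refine ⟨y', h1.trans (.cons c h2), ?_⟩
    intro e he
    have hg4 := hg3.ce (((CE.cons c h2).cons (dv (k+2) (k+2))).appl P)
    rcases tri d' e with rfl | h | h
    · exfalso
      obtain ⟨m, hm⟩ := he
      have := hg4.ce ((((CE.cons d' hm).cons c).cons _).appl P)
      rw [show P ++ dv (k+2) (k+2) :: c :: d' :: d' :: m = (P ++ [dv (k+2) (k+2), c]) ++ d' :: d' :: m by simp] at this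
      exact good_TT this
    · have := cl_le e
      refine eq_dv ?_ (by omega) (by omega)
      unfold Adj at h
      omega
    · exfalso
      exact h.1 (z1i e ((he.cons h).ce h2)).symm
  have hA : AWord (k+2) = R ++ [dv (k+2) (k+2)] ++ [dv (k+2) (k+2+1), dv (k+2) (k+2+2)] := by
    unfold AWord
    rw [List.range'_concat, List.range'_concat, List.range'_concat]
    simp [hR]
    refine ⟨?_, ?_, ?_⟩ <;> congr 1 <;> omega
  have hall : ∀ e : Fin (k+2+3), cl e = k+2+1 → e = dv (k+2) (k+2+1) ∨ e = dv (k+2) (k+2+2) :=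
    fun e he => cl_top he hn
  have hcl1 : cl (dv (k+2) (k+2+1)) = k+2+1 := cl_dv (by omega) (by omega)
  have hcl2 : cl (dv (k+2) (k+2+2)) = k+2+1 := cl_dvn
  obtain ⟨c, hc⟩ := exists_ini hzn
  have : ∃ y', CE z (dv (k+2) (k+2+1) :: dv (k+2) (k+2+2) :: y') ∧
      ∀ e, Ini y' e → e = dv (k+2) (k+2) := by
    rcases hall c (hzi c hc) with rfl | rfl
    · exact fin _ _ cmtop hcl1 hcl2 hall hc
    · obtain ⟨y', h1, h2⟩ := fin _ _ cmtop.symm hcl2 hcl1 (fun e he => (hall e he).symm) hc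
      exact ⟨y', h1.trans (.swap _ _ _ cmtop.symm), h2⟩
  obtain ⟨y', h1, h2⟩ := this
  refine ⟨y', ?_, h2⟩
  rw [hA]
  refine hz.trans ?_
  simpa using h1.appl (R ++ [dv (k+2) (k+2)])

/-- alternating word A B A B … with `j` blocks -/
def alt (n : ℕ) : ℕ → List (Fin (n+3))
  | 0 => []
  | j+1 => AWord n ++ (alt n j).map Fin.rev

def zg (n j : ℕ) : List (Fin (n+3)) := [dv n 0, dv n 1] ++ alt n j

lemma z_up (hn : 2 ≤ n) : ∀ (N : ℕ) (y : List V), y.length ≤ N →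
    Good ([dv n 0, dv n 1] ++ y) → RIrr ([dv n 0, dv n 1] ++ y) →
    (∀ c, Ini y c → c = dv n 2) → ∃ j, CE y (alt n j) := by
  intro N
  induction N with
  | zero =>
    intro y hy _ _ _
    have : y = [] := by simpa using hy
    exact ⟨0, this ▸ .refl _⟩
  | succ N ih =>
    intro y hy hg hr hin
    by_cases hne : y = []
    · exact ⟨0, hne ▸ .refl _⟩
    obtain ⟨y', h1, h2⟩ := pass_up hn hg hr hne hin
    have hA : ∃ R, AWord n = R ++ [dv n (n+1), dv n (n+2)] := by
      obtain ⟨k, rfl⟩ : ∃ k, n = k + 2 := ⟨n - 2, by omega⟩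
      unfold AWord
      rw [List.range'_concat, List.range'_concat]
      exact ⟨(List.range' 2 (k+1)).map (dv (k+2)), by simp; constructor <;> congr 1 <;> omega⟩
    obtain ⟨R, hR⟩ := hA
    have e1 := h1.appl [dv n 0, dv n 1]
    rw [hR] at e1
    have e2 : [dv n 0, dv n 1] ++ (R ++ [dv n (n+1), dv n (n+2)] ++ y') =
      ([dv n 0, dv n 1] ++ R) ++ ([dv n (n+1), dv n (n+2)] ++ y') := by simp
    rw [e2] at e1
    have e3 : CE (([dv n (n+1), dv n (n+2)] ++ y').map Fin.rev) ([dv n 0, dv n 1] ++ y'.map Fin.rev) := by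
      rw [List.map_append, List.map_cons, List.map_cons, rev_dv (by omega), rev_dv (by omega),
        show n + 2 - (n+1) = 1 by omega, show n + 2 - (n + 2) = 0 by omega]
      exact .swap _ _ _ cm01.symm
    have hlen := h1.perm.length_eq
    rw [hR] at hlen
    simp at hlen
    obtain ⟨j, hj⟩ := ih (y'.map Fin.rev) (by simp; omega) ((hg.ce e1).right.rev.ce e3)
      ((hr.ce e1).right.rev.ce e3) (by
        rintro c ⟨m, hm⟩
        have h3 := hm.rev
        rw [map_rev_rev, List.map_cons] at h3
        have h4 := h2 _ ⟨_, h3⟩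
        rw [← Fin.rev_rev c, h4, rev_dv (by omega)]
        congr 1; omega)
    refine ⟨j+1, h1.trans (CE.appl _ ?_)⟩
    have := hj.rev
    rwa [map_rev_rev] at this

lemma z_start (hn : 2 ≤ n) : ∀ (N : ℕ) (y : List V), y.length ≤ N →
    Good ([dv n 0, dv n 1] ++ y) → RIrr ([dv n 0, dv n 1] ++ y) → dv n 2 ∈ y →
    ∃ p j, 0 < j ∧ dv n 2 ∉ p ∧ CE ([dv n 0, dv n 1] ++ y) (p ++ zg n j) := by
  intro N
  induction N with
  | zero =>
    intro y hy _ _ h2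
    have : y = [] := by simpa using hy
    subst this; simp at h2
  | succ N ih =>
    intro y hy hg hr h2
    by_cases hin : ∀ c, Ini y c → c = dv n 2
    · obtain ⟨j, hj⟩ := z_up hn _ y le_rfl hg hr hin
      refine ⟨[], j, ?_, by simp, hj.appl _⟩
      rcases j with _ | j
      · exfalso
        have := hj.perm.mem_iff.1 h2
        simp [alt] at this
      · omega
    · push Not at hin
      obtain ⟨c, ⟨y1, h1⟩, hc⟩ := hin
      have e1 := h1.appl [dv n 0, dv n 1]
      have hg1 := hg.ce e1
      have c1 : Cm (dv n 1) c := by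
        rcases tri (dv n 1) c with rfl | h | h
        · exact (good_TT (x := [dv n 0]) hg1).elim
        · exfalso; apply hc
          have := cl_ge c
          refine eq_dv ?_ le_rfl hn
          unfold Adj at h; rw [cl_dv (by omega) (by omega)] at h; omega
        · exact h
      have c0 : Cm (dv n 0) c := by
        rcases tri (dv n 0) c with rfl | h | h
        · exact (good_TT (x := [dv n 1]) (hg1.ce (.swap _ _ _ cm01))).elim
        · exfalso; apply hc
          have := cl_ge c
          refine eq_dv ?_ le_rfl hn
          unfold Adj at h; rw [cl_dv0] at h; omega
        · exact h
      have e2 : CE ([dv n 0, dv n 1] ++ y) (c :: ([dv n 0, dv n 1] ++ y1)) := by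
        refine e1.trans (CE.front (x := [dv n 0, dv n 1]) y1 ?_)
        intro b hb
        simp at hb
        rcases hb with rfl | rfl
        · exact c0
        · exact c1
      have hl := h1.perm.length_eq
      simp at hl
      obtain ⟨p, j, hj, hp, hp2⟩ := ih y1 (by omega) (Good.right (l := [c]) (hg.ce e2))
        (RIrr.right (l := [c]) (hr.ce e2)) (by
          have := h1.perm.mem_iff.1 h2
          rw [List.mem_cons] at this
          rcases this with h | h
          · exact absurd h.symm hc
          · exact h)
      refine ⟨c :: p, j, hj, ?_, e2.trans (.cons c hp2)⟩
      simp [hp, Ne.symm hc]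


end

section
local notation "V" => Fin (n+3)

lemma q_nil_of {s : V} {l : List V} (h : ∀ a ∈ l, Cm a s) : q s l = [] :=
  List.filterMap_eq_nil_iff.2 (fun a ha => qf_none.2 (h a ha))

lemma cm_of_cl {a s : V} (h : cl a + 1 < cl s ∨ cl s + 1 < cl a) : Cm a s := by
  refine ⟨?_, ?_⟩
  · rintro rfl; omega
  · unfold Adj; omega

/-- segment s_a … s_{a+m-1} -/
def seg (n a m : ℕ) : List (Fin (n+3)) := (List.range' a m).map (dv n)

lemma seg_add (a m k : ℕ) : seg n a (m + k) = seg n a m ++ seg n (a + m) k := by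
  unfold seg; rw [← List.map_append, List.range'_append_1]

lemma seg_succ (a m : ℕ) : seg n a (m+1) = dv n a :: seg n (a+1) m := by
  unfold seg; rw [List.range'_succ]; rfl

lemma AWord_eq : AWord n = seg n 2 (n+1) := rfl

lemma mem_seg {a m : ℕ} {c : V} (h : c ∈ seg n a m) (ham : a + m ≤ n + 3) :
    a ≤ c.1 ∧ c.1 < a + m := by
  unfold seg at h
  obtain ⟨x, hx, rfl⟩ := List.mem_map.1 h
  rw [List.mem_range'_1] at hx
  rw [dv_val (by omega)]; exact hx

lemma seg_low {a m : ℕ} {s : V} (h1 : 2 ≤ a) (h2 : a + m ≤ n + 2) (h : a + m < cl s ∨ m = 0) :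
    q s (seg n a m) = [] := by
  apply q_nil_of
  intro c hc
  rcases h with h | h
  · have h3 := mem_seg hc (by omega)
    apply cm_of_cl
    left
    unfold cl at h ⊢; split_ifs at h ⊢ <;> omega
  · subst h; simp [seg] at hc

lemma seg_high {a m : ℕ} {s : V} (h1 : 2 ≤ a) (h2 : a + m ≤ n + 3) (ha : a ≤ n + 1) (h : cl s + 1 < a) :
    q s (seg n a m) = [] := by
  apply q_nil_of
  intro c hc
  have h3 := mem_seg hc (by omega)
  apply cm_of_cl
  right
  unfold cl at h ⊢; split_ifs at h ⊢ <;> omega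

lemma qA1 (hn : 2 ≤ n) {s : V} (h : cl s = 1) : q s (AWord n) = [false] := by
  rw [AWord_eq, seg_succ, q_cons_adj, seg_high] <;> try omega
  unfold Adj; rw [cl_dv] <;> omega

lemma qA2 (hn : 3 ≤ n) : q (dv n 2) (AWord n) = [true, false] := by
  obtain ⟨k, rfl⟩ : ∃ k, n = k + 3 := ⟨n - 3, by omega⟩
  have e : cl (dv (k+3) 2) = 2 := cl_dv (by omega) (by omega)
  rw [AWord_eq, show k + 3 + 1 = (k + 2) + 1 + 1 by omega, seg_succ, seg_succ, q_cons_self,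
    q_cons_adj, seg_high] <;> try omega
  unfold Adj; rw [e, cl_dv] <;> omega

lemma qA22 : q (dv 2 2) (AWord 2) = [true, false, false] := by decide

lemma qAi {k : ℕ} (h1 : 3 ≤ k) (h2 : k + 1 ≤ n) : q (dv n k) (AWord n) = [false, true, false] := by
  have e : cl (dv n k) = k := cl_dv (by omega) (by omega)
  obtain ⟨j, rfl⟩ : ∃ j, k = j + 3 := ⟨k - 3, by omega⟩
  obtain ⟨i, rfl⟩ : ∃ i, n = i + j + 4 := ⟨n - j - 4, by omega⟩
  rw [AWord_eq, show i + j + 4 + 1 = j + ((i + 2) + 1 + 1 + 1) by omega, seg_add, seg_succ,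
    seg_succ, seg_succ, q_append, seg_low, q_cons_adj, show 2 + j + 1 = j + 3 by omega, q_cons_self,
    q_cons_adj, seg_high] <;> try omega
  · simp
  · unfold Adj; rw [e, cl_dv] <;> omega
  · unfold Adj; rw [e, cl_dv] <;> omega

lemma qAn (h1 : 3 ≤ n) : q (dv n n) (AWord n) = [false, true, false, false] := by
  have e : cl (dv n n) = n := cl_dv (by omega) (by omega)
  obtain ⟨j, rfl⟩ : ∃ j, n = j + 3 := ⟨n - 3, by omega⟩
  rw [AWord_eq, show j + 3 + 1 = j + 4 by omega, seg_add, q_append, seg_low, seg_succ, q_cons_adj,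
    seg_succ, show 2 + j + 1 = j + 3 by omega, q_cons_self, seg_succ, q_cons_adj, seg_succ,
    q_cons_adj] <;> try omega
  · simp [seg]
  · unfold Adj; rw [show j + 3 + 1 + 1 = j + 3 + 2 by omega, e, cl_dvn]; omega
  · unfold Adj; rw [e, cl_dv] <;> omega
  · unfold Adj; rw [e, cl_dv] <;> omega

lemma qAt (hn : 2 ≤ n) {s : V} (h : cl s = n + 1) : q s (AWord n) = [false, true] := by
  obtain ⟨j, rfl⟩ : ∃ j, n = j + 2 := ⟨n - 2, by omega⟩
  rw [AWord_eq, show j + 2 + 1 = j + 3 by omega, seg_add, q_append, seg_low, seg_succ, q_cons_adj,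
    seg_succ, seg_succ] <;> try omega
  · rw [show 2 + j + 1 = j + 2 + 1 by omega, show j + 2 + 1 + 1 = j + 2 + 2 by omega]
    rcases cl_top h hn with rfl | rfl
    · rw [q_cons_self, q_cons_cm cmtop.symm]; simp [seg]
    · rw [q_cons_cm cmtop, q_cons_self]; simp [seg]
  · unfold Adj; rw [h, cl_dv] <;> omega

lemma q01a {s : V} (h : cl s = 1) (hn : 2 ≤ n) : q s [dv n 0, dv n 1] = [true] := by
  rcases cl_one h hn with rfl | rfl
  · simp [q_cons_self, q_cons_cm cm01.symm]
  · simp [q_cons_self, q_cons_cm cm01]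

lemma q01b (hn : 2 ≤ n) : q (dv n 2) [dv n 0, dv n 1] = [false, false] := by
  have e : cl (dv n 2) = 2 := cl_dv (by omega) (by omega)
  rw [q_cons_adj, q_cons_adj, q_nil] <;> unfold Adj
  · rw [e, cl_dv] <;> omega
  · rw [e, cl_dv0]; omega

lemma q01c {s : V} (h : 3 ≤ cl s) : q s [dv n 0, dv n 1] = [] := by
  rw [q_cons_cm, q_cons_cm, q_nil] <;> apply cm_of_cl
  · rw [cl_dv] <;> omega
  · rw [cl_dv0]; omega

/-- every column ≥ 3 has projection of `A` beginning with F T. -/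
lemma qA_ge3 (hn : 2 ≤ n) {s : V} (h : 3 ≤ cl s) : ∃ t, q s (AWord n) = false :: true :: t := by
  have := cl_le s
  by_cases h1 : cl s = n + 1
  · exact ⟨_, qAt hn h1⟩
  by_cases h2 : cl s = n
  · rw [eq_dv h2 (by omega) (by omega)]
    exact ⟨_, qAn (by omega)⟩
  · rw [eq_dv rfl (by omega) (by omega : cl s ≤ n)]
    exact ⟨_, qAi h (by omega)⟩

lemma p_nil (hn : 2 ≤ n) {p : List V} {j : ℕ} (hj : 0 < j) (hg : Good (p ++ zg n j))
    (h2 : dv n 2 ∉ p) : p = [] := by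
  by_contra hc
  obtain ⟨p', a, rfl⟩ := List.eq_nil_or_concat'  p |>.resolve_left hc
  obtain ⟨j, rfl⟩ : ∃ i, j = i + 1 := ⟨j - 1, by omega⟩
  have := cl_ge a
  have h := hg a
  unfold zg alt at h
  rw [q_append, q_append, q_cons_self, q_append] at h
  by_cases h1 : cl a = 1
  · rw [q01a h1 hn] at h
    exact h.1 ⟨q a p', q a (AWord n ++ List.map Fin.rev (alt n j)), by simp⟩
  by_cases h3 : cl a = 2
  · apply h2
    rw [← eq_dv h3 le_rfl hn]; simp
  · rw [q01c (by omega)] at h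
    obtain ⟨t, ht⟩ := qA_ge3 hn (by omega : 3 ≤ cl a)
    rw [q_append, ht] at h
    exact h.2 ⟨q a p', t ++ q a (List.map Fin.rev (alt n j)), by simp⟩

lemma z_start' (hn : 2 ≤ n) {y : List V}
    (hg : Good ([dv n 0, dv n 1] ++ y)) (hr : RIrr ([dv n 0, dv n 1] ++ y)) (h2 : dv n 2 ∈ y) :
    ∃ j, 0 < j ∧ CE ([dv n 0, dv n 1] ++ y) (zg n j) := by
  obtain ⟨p, j, hj, hp, h⟩ := z_start hn _ y le_rfl hg hr h2
  have := p_nil hn hj (hg.ce h) hp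
  subst this
  exact ⟨j, hj, h⟩

def StartsZ (l : List V) : Prop := ∃ y, dv n 2 ∈ y ∧
  (CE l ([dv n 0, dv n 1] ++ y) ∨ CE l (([dv n 0, dv n 1] ++ y).map Fin.rev))

def IsZ (l : List V) : Prop := ∃ j, 0 < j ∧ (CE l (zg n j) ∨ CE l ((zg n j).map Fin.rev))

lemma StartsZ.isZ (hn : 2 ≤ n) {l : List V} (hg : Good l) (hr : RIrr l) (h : StartsZ l) : IsZ l := by
  obtain ⟨y, hy, h | h⟩ := h
  · obtain ⟨j, hj, k⟩ := z_start' hn (hg.ce h) (hr.ce h) hy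
    exact ⟨j, hj, .inl (h.trans k)⟩
  · have h' := h.rev
    rw [map_rev_rev] at h'
    obtain ⟨j, hj, k⟩ := z_start' hn (hg.rev.ce h') (hr.rev.ce h') hy
    refine ⟨j, hj, .inr ?_⟩
    have := (h'.trans k).rev
    rwa [map_rev_rev] at this

lemma alt_end (hn : 2 ≤ n) (j : ℕ) : ∃ v, dv n 2 ∈ v ∧ (alt n (j+1) = v ++ [dv n 1, dv n 0] ∨
    alt n (j+1) = (v ++ [dv n 1, dv n 0]).map Fin.rev) := by
  induction j with
  | zero =>
    obtain ⟨k, rfl⟩ : ∃ k, n = k + 2 := ⟨n - 2, by omega⟩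
    refine ⟨(seg (k+2) 2 (k+1)).map Fin.rev, ?_, .inr ?_⟩
    · rw [seg_add]
      rw [List.map_append]
      apply List.mem_append_right
      have : dv (k+2) 2 = Fin.rev (dv (k+2) (2+k)) := by
        rw [rev_dv (by omega)]; congr 1; omega
      rw [this]
      simp [seg]
    · rw [List.map_append, map_rev_rev]
      unfold alt alt
      rw [AWord_eq, show k + 2 + 1 = (k + 1) + 2 by omega, seg_add]
      rw [seg_succ, seg_succ]
      simp [seg, rev_dv]
      constructor <;> congr 1 <;> omega
  | succ j ih =>
    obtain ⟨v, hv, h⟩ := ih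
    have e : alt n (j+1+1) = AWord n ++ (alt n (j+1)).map Fin.rev := rfl
    rw [e]
    rcases h with h | h
    · rw [h]
      refine ⟨(AWord n).map Fin.rev ++ v, by simp [hv], .inr ?_⟩
      simp only [List.map_append, map_rev_rev, List.append_assoc]
    · rw [h, map_rev_rev]
      exact ⟨AWord n ++ v, by simp [hv], .inl (by simp)⟩

lemma alt_starts (hn : 2 ≤ n) {j : ℕ} (hj : 0 < j) (x : List V) : StartsZ ((alt n j).reverse ++ x) := by
  obtain ⟨j, rfl⟩ : ∃ i, j = i + 1 := ⟨j - 1, by omega⟩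
  obtain ⟨v, hv, h | h⟩ := alt_end hn j
  · rw [h]
    exact ⟨v.reverse ++ x, by simp [hv], .inl (by simpa using CE.refl _)⟩
  · rw [h]
    refine ⟨v.reverse ++ x.map Fin.rev, by simp [hv], .inr ?_⟩
    have := map_rev_rev x
    rw [List.map_append, List.map_append, List.map_append, this, List.map_reverse]
    simpa using CE.refl _

lemma StartsZ.ce {l l' : List V} (h : StartsZ l) (e : CE l' l) : StartsZ l' := by
  obtain ⟨y, hy, h⟩ := h
  exact ⟨y, hy, h.imp e.trans e.trans⟩

lemma StartsZ.rev {l : List V} (h : StartsZ l) : StartsZ (l.map Fin.rev) := by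
  obtain ⟨y, hy, h | h⟩ := h
  · exact ⟨y, hy, .inr h.rev⟩
  · have := h.rev
    rw [map_rev_rev] at this
    exact ⟨y, hy, .inl this⟩

lemma IsZ.reverse (hn : 2 ≤ n) {l : List V} (h : IsZ l.reverse) : StartsZ l := by
  have k : ∀ j, 0 < j → StartsZ (zg n j).reverse := by
    intro j hj
    unfold zg
    rw [List.reverse_append]
    exact alt_starts hn hj _
  obtain ⟨j, hj, h | h⟩ := h
  · exact (k j hj).ce (by simpa using h.reverse)
  · refine (k j hj).rev.ce ?_
    have := h.reverse
    rw [← List.map_reverse] at this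
    simpa using this

lemma z_thm_y (hn : 2 ≤ n) {l x y : List V} (hg : Good l) (hL : LIrr l) (hR : RIrr l)
    (h : CE l (x ++ ([dv n 0, dv n 1] ++ y))) (h2 : dv n 2 ∈ y) : IsZ l := by
  obtain ⟨j, hj, k⟩ := z_start' hn (hg.ce h).right (hR.ce h).right h2
  have k1 := h.trans (k.appl x)
  by_cases hx : dv n 2 ∈ x
  · have k2 := k1.reverse
    unfold zg at k2
    rw [List.reverse_append, List.reverse_append, List.append_assoc] at k2
    have k3 : CE l.reverse ((alt n j).reverse ++ ([dv n 0, dv n 1] ++ x.reverse)) :=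
      k2.trans (CE.appl _ (.swap _ _ _ cm01.symm))
    have := (alt_starts hn hj _).ce k3
    exact ((this.isZ hn hg.reverse hL.reverse).reverse hn).isZ hn hg hR
  · have := p_nil hn hj (hg.ce k1) hx
    subst this
    exact ⟨j, hj, .inl k1⟩

lemma z_thm (hn : 2 ≤ n) {l x y : List V} (hg : Good l) (hL : LIrr l) (hR : RIrr l)
    (h : CE l (x ++ ([dv n 0, dv n 1] ++ y))) (h2 : dv n 2 ∈ l) : IsZ l := by
  by_cases hy : dv n 2 ∈ y
  · exact z_thm_y hn hg hL hR h hy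
  · have hx : dv n 2 ∈ x := by
      have := h.perm.mem_iff.1 h2
      have e0 : dv n 2 ≠ dv n 0 := dv_ne (by omega) (by omega) (by omega)
      have e1 : dv n 2 ≠ dv n 1 := dv_ne (by omega) (by omega) (by omega)
      simpa [hy, e0, e1] using this
    have k := h.reverse
    rw [List.reverse_append, List.reverse_append, List.append_assoc] at k
    have k2 : CE l.reverse (y.reverse ++ ([dv n 0, dv n 1] ++ x.reverse)) :=
      k.trans (CE.appl _ (.swap _ _ _ cm01.symm))
    have := z_thm_y hn hg.reverse hR.reverse hL.reverse k2 (by simpa using hx)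
    exact (this.reverse hn).isZ hn hg hR

lemma IsZ.rev {l : List V} (h : IsZ (l.map Fin.rev)) : IsZ l := by
  obtain ⟨j, hj, h | h⟩ := h
  · have := h.rev
    rw [map_rev_rev] at this
    exact ⟨j, hj, .inr this⟩
  · exact ⟨j, hj, .inl h.of_rev⟩

lemma alt_even (k : ℕ) : alt n (2 * k) = (List.replicate k (AWord n ++ (AWord n).map Fin.rev)).flatten := by
  induction k with
  | zero => rfl
  | succ k ih =>
    rw [show 2 * (k+1) = 2 * k + 1 + 1 by omega]
    change AWord n ++ (AWord n ++ (alt n (2*k)).map Fin.rev).map Fin.rev = _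
    rw [List.map_append, map_rev_rev, ih, List.replicate_succ]; simp

lemma alt_odd (k : ℕ) : alt n (2 * k + 1) = (List.replicate k (AWord n ++ (AWord n).map Fin.rev)).flatten ++ AWord n := by
  induction k with
  | zero => simp [alt]
  | succ k ih =>
    rw [show 2 * (k+1) + 1 = 2 * k + 1 + 1 + 1 by omega]
    change AWord n ++ (AWord n ++ (alt n (2*k+1)).map Fin.rev).map Fin.rev = _
    rw [List.map_append, map_rev_rev, ih, List.replicate_succ]; simp

lemma BWord_eq : BWord n = (AWord n).map Fin.rev := by
  unfold BWord AWord
  apply List.ext_getElem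
  · simp
  · intro i h1 h2
    simp at h1
    simp only [List.getElem_map, List.getElem_reverse, List.getElem_range, List.getElem_range',
      List.length_range]
    rw [rev_dv (by omega)]
    congr 1; omega

lemma zig1_eq {k h : ℕ} (hh : h ≤ 1) : ZigWord1 n k h = zg n (2 * k + h) := by
  unfold ZigWord1 zg
  have : h = 0 ∨ h = 1 := by omega
  rcases this with rfl | rfl
  · rw [show 2 * k + 0 = 2 * k from rfl, alt_even, BWord_eq]; simp
  · rw [alt_odd, BWord_eq]; simp

lemma zig2_eq {k h : ℕ} (hh : h ≤ 1) : ZigWord2 n k h = (zg n (2 * k + h)).map Fin.rev := by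
  rw [← zig1_eq hh]
  unfold ZigWord1 ZigWord2
  have e1 := rev_dv (n := n) (k := 0) (by omega)
  have e2 := rev_dv (n := n) (k := 1) (by omega)
  have e3 := map_rev_rev (AWord n)
  rw [BWord_eq]
  simp only [List.map_append, List.map_cons, List.map_nil, e1, e2, List.map_flatten,
    List.map_replicate, e3]
  rfl


end

section
local notation "V" => Fin (n+3)

/-- automaton: `r` = number of `false` still needed before the next `true`. -/
def gd : ℕ → List Bool → Prop
  | _, [] => True
  | r, true :: t => r = 0 ∧ gd 2 t
  | r, false :: t => gd (r - 1) t

lemma gd_mono : ∀ (t : List Bool) (r r' : ℕ), r' ≤ r → gd r t → gd r' t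
  | [], _, _, _, _ => trivial
  | true :: t, r, r', h, h' => ⟨by have := h'.1; omega, h'.2⟩
  | false :: t, r, r', h, h' => gd_mono t (r - 1) (r' - 1) (by omega) h'

lemma gd_two : ∀ (t : List Bool), gd 2 t → ¬ [true] <+: t ∧ ¬ [false, true] <+: t := by
  intro t h
  constructor
  · rintro ⟨u, rfl⟩
    exact absurd h.1 (by omega)
  · rintro ⟨u, rfl⟩
    exact absurd h.1 (by omega)

lemma gd_Gd : ∀ (t : List Bool) (r : ℕ), gd r t → Gd t
  | [], _, _ => ⟨by simp, by simp⟩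
  | true :: t, r, h => by
    have ih := gd_Gd t 2 h.2
    have := gd_two t h.2
    constructor
    · rw [List.infix_cons_iff]
      rintro (h1 | h1)
      · rw [List.cons_prefix_cons] at h1; exact this.1 h1.2
      · exact ih.1 h1
    · rw [List.infix_cons_iff]
      rintro (h1 | h1)
      · rw [List.cons_prefix_cons] at h1; exact this.2 h1.2
      · exact ih.2 h1
  | false :: t, r, h => by
    have ih := gd_Gd t _ h
    constructor
    · rw [List.infix_cons_iff]
      rintro (h1 | h1)
      · rw [List.cons_prefix_cons] at h1; simp at h1
      · exact ih.1 h1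
    · rw [List.infix_cons_iff]
      rintro (h1 | h1)
      · rw [List.cons_prefix_cons] at h1; simp at h1
      · exact ih.2 h1

lemma q_rev' (s : V) (l : List V) : q s (l.map Fin.rev) = q s.rev l := by
  have := q_rev s.rev l
  rwa [Fin.rev_rev] at this

lemma q_alt_succ (s : V) (j : ℕ) : q s (alt n (j+1)) = q s (AWord n) ++ q s.rev (alt n j) := by
  rw [alt, q_append, q_rev']

lemma alt_gd (hn : 2 ≤ n) (j : ℕ) : ∀ s : V, (cl s = 1 → gd 2 (q s (alt n j))) ∧
    (cl s = n + 1 → gd 1 (q s (alt n j))) ∧ (cl s = 2 → gd 0 (q s (alt n j))) ∧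
    (3 ≤ cl s → cl s ≤ n → gd 1 (q s (alt n j))) := by
  induction j with
  | zero => intro s; simp [alt, gd]
  | succ j ih =>
    intro s
    rw [q_alt_succ]
    obtain ⟨i1, i2, i3, i4⟩ := ih s.rev
    rw [cl_rev] at i1 i2 i3 i4
    refine ⟨?_, ?_, ?_, ?_⟩
    · intro h
      rw [qA1 hn h]
      exact i2 (by omega)
    · intro h
      rw [qAt hn h]
      exact ⟨rfl, i1 (by omega)⟩
    · intro h
      by_cases hn3 : n = 2
      · subst hn3
        rw [eq_dv h le_rfl le_rfl, qA22, ← eq_dv h le_rfl le_rfl]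
        exact ⟨rfl, i3 (by omega)⟩
      · rw [eq_dv h le_rfl hn, qA2 (by omega), ← eq_dv h le_rfl hn]
        exact ⟨rfl, i4 (by omega) (by omega)⟩
    · intro h1 h2
      by_cases h3 : cl s = n
      · rw [eq_dv h3 hn le_rfl, qAn (by omega), ← eq_dv h3 hn le_rfl]
        exact ⟨rfl, i3 (by omega)⟩
      · have e := eq_dv (a := s) rfl (by omega) (by omega)
        rw [e, qAi h1 (by omega), ← e]
        exact ⟨rfl, i4 (by omega) (by omega)⟩

lemma zg_good (hn : 2 ≤ n) (j : ℕ) : Good (zg n j) := by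
  intro s
  obtain ⟨i1, i2, i3, i4⟩ := alt_gd hn j s
  unfold zg
  rw [q_append]
  have := cl_ge s
  have := cl_le s
  apply gd_Gd _ 0
  by_cases h1 : cl s = 1
  · rw [q01a h1 hn]; exact ⟨rfl, i1 h1⟩
  by_cases h2 : cl s = 2
  · rw [eq_dv h2 le_rfl hn, q01b hn, ← eq_dv h2 le_rfl hn]; exact i3 h2
  rw [q01c (by omega)]
  by_cases h3 : cl s = n + 1
  · exact gd_mono _ 1 0 (by omega) (i2 h3)
  · exact gd_mono _ 1 0 (by omega) (i4 (by omega) (by omega))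

/-- criterion for left irreducibility -/
lemma lirr_of {l : List V} (h : ∀ s t, Adj s t → (q s l).head? = some true →
    ¬ [false, true] <+: q t l) : LIrr l := by
  intro s t m hst k
  refine h s t hst (front_iff.1 ⟨_, k⟩) ?_
  rw [q_ce k, q_cons_adj hst, q_cons_self]
  exact ⟨q t m, rfl⟩

lemma zg_head (hn : 2 ≤ n) {j : ℕ} (hj : 0 < j) {s : V} (h : 2 ≤ cl s) :
    (q s (zg n j)).head? = some false := by
  obtain ⟨j, rfl⟩ : ∃ i, j = i + 1 := ⟨j - 1, by omega⟩
  unfold zg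
  rw [q_append]
  by_cases h2 : cl s = 2
  · rw [eq_dv h2 le_rfl hn, q01b hn]; rfl
  · rw [q01c (by omega), q_alt_succ]
    obtain ⟨t, ht⟩ := qA_ge3 hn (by omega : 3 ≤ cl s)
    rw [ht]; rfl

lemma zg_lirr (hn : 2 ≤ n) {j : ℕ} (hj : 0 < j) : LIrr (zg n j) := by
  apply lirr_of
  intro s t hst hs
  have := cl_ge s
  by_cases h : cl s = 1
  · have ht : cl t = 2 := by
      have := cl_ge t
      unfold Adj at hst; omega
    rw [eq_dv ht le_rfl hn]
    unfold zg
    rw [q_append, q01b hn]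
    rintro ⟨u, hu⟩
    simp at hu
  · rw [zg_head hn hj (by omega)] at hs
    simp at hs

/-- end behaviour -/
def EndOK (l : List V) : Prop := (∀ s : V, (q s l).getLast? = some true → cl s = n + 1) ∧
  [false, false] <:+ q (dv n n) l ∧ ∀ s : V, q s l ≠ []

lemma A_end (hn : 2 ≤ n) : EndOK (AWord n) := by
  have key : ∀ s : V, q s (AWord n) ≠ [] ∧ ((q s (AWord n)).getLast? = some true → cl s = n + 1) := by
    intro s
    have := cl_ge s
    have := cl_le s
    by_cases h1 : cl s = 1
    · rw [qA1 hn h1]; simp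
    by_cases h2 : cl s = n + 1
    · rw [qAt hn h2]; simp [h2]
    by_cases h3 : cl s = 2
    · by_cases hn3 : n = 2
      · subst hn3
        rw [eq_dv h3 le_rfl le_rfl, qA22]; simp
      · rw [eq_dv h3 le_rfl hn, qA2 (by omega)]; simp
    by_cases h4 : cl s = n
    · rw [eq_dv h4 hn le_rfl, qAn (by omega)]; simp
    · have e := eq_dv (a := s) rfl (by omega) (by omega)
      rw [e, qAi (by omega) (by omega)]; simp
  refine ⟨fun s => (key s).2, ?_, fun s => (key s).1⟩
  by_cases hn3 : n = 2
  · subst hn3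
    rw [qA22]; exact ⟨[true], rfl⟩
  · rw [qAn (by omega)]; exact ⟨[false, true], rfl⟩

lemma EndOK.append {l : List V} (h : EndOK l) (x : List V) : EndOK (x ++ l) := by
  refine ⟨?_, ?_, ?_⟩
  · intro s hs
    apply h.1
    rw [q_append, List.getLast?_append_of_ne_nil _ (h.2.2 s)] at hs
    exact hs
  · rw [q_append]
    obtain ⟨u, hu⟩ := h.2.1
    exact ⟨q (dv n n) x ++ u, by rw [← hu]; simp⟩
  · intro s
    rw [q_append]
    simp [h.2.2 s]

lemma alt_endOK (hn : 2 ≤ n) (j : ℕ) : EndOK (alt n (j+1)) ∨ EndOK ((alt n (j+1)).map Fin.rev) := by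
  induction j with
  | zero =>
    left
    have := A_end hn
    simpa [alt] using this
  | succ j ih =>
    have e : alt n (j+1+1) = AWord n ++ (alt n (j+1)).map Fin.rev := rfl
    rw [e]
    rcases ih with h | h
    · right
      rw [List.map_append, map_rev_rev]
      exact h.append _
    · left
      exact h.append _

lemma EndOK.rirr (hn : 2 ≤ n) {l : List V} (h : EndOK l) : RIrr l := by
  intro s t m hst k
  have h1 : (q t l).getLast? = some true := by
    rw [q_ce k, show m ++ [s,t] = (m ++ [s]) ++ [t] by simp, q_append, q_cons_self]; simp
  have h2 := h.1 t h1
  have h3 : s = dv n n := by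
    have := cl_le s
    refine eq_dv ?_ hn le_rfl
    unfold Adj at hst; omega
  subst h3
  obtain ⟨u, hu⟩ := h.2.1
  rw [q_ce k, q_append, q_cons_self, q_cons_adj hst.symm, q_nil] at hu
  have := congrArg List.reverse hu
  simp at this

lemma zg_rirr (hn : 2 ≤ n) {j : ℕ} (hj : 0 < j) : RIrr (zg n j) := by
  obtain ⟨j, rfl⟩ : ∃ i, j = i + 1 := ⟨j - 1, by omega⟩
  rcases alt_endOK hn j with h | h
  · exact (h.append _).rirr hn
  · have := (h.append ([dv n 0, dv n 1].map Fin.rev)).rirr hn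
    rw [← List.map_append] at this
    have h2 := this.rev
    rwa [map_rev_rev] at h2


end

section
local notation "V" => Fin (n+3)

/-- edge projection: columns `i` (false) and `i+1` (true). -/
def ef (i : ℕ) (a : V) : Option Bool :=
  if cl a = i then some false else if cl a = i + 1 then some true else none
def E (i : ℕ) (l : List V) : List Bool := l.filterMap (ef i)

lemma ef_false {i : ℕ} {a : V} : ef i a = some false ↔ cl a = i := by
  unfold ef; split_ifs <;> simp_all
lemma ef_true {i : ℕ} {a : V} : ef i a = some true ↔ cl a = i + 1 := by
  unfold ef; split_ifs <;> simp_all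
lemma ef_none {i : ℕ} {a : V} : ef i a = none ↔ cl a ≠ i ∧ cl a ≠ i + 1 := by
  unfold ef; split_ifs <;> simp_all

@[simp] lemma E_nil (i : ℕ) : E i ([] : List V) = [] := rfl
@[simp] lemma E_append (i : ℕ) (l l' : List V) : E i (l ++ l') = E i l ++ E i l' :=
  List.filterMap_append
lemma E_cons (i : ℕ) (a : V) (l : List V) : E i (a :: l) = E i [a] ++ E i l :=
  E_append i [a] l
lemma E_reverse (i : ℕ) (l : List V) : E i l.reverse = (E i l).reverse := by
  simp [E, List.filterMap_reverse]
lemma E_false {i : ℕ} {a : V} (h : cl a = i) : E i [a] = [false] := by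
  simp [E, ef_false.2 h]
lemma E_true {i : ℕ} {a : V} (h : cl a = i + 1) : E i [a] = [true] := by
  simp [E, ef_true.2 h]
lemma E_none {i : ℕ} {a : V} (h : cl a ≠ i ∧ cl a ≠ i + 1) : E i [a] = [] := by
  simp [E, ef_none.2 h]

lemma E_swap (i : ℕ) {a b : V} (h : Cm a b) : E i [a] ++ E i [b] = E i [b] ++ E i [a] := by
  have h2 := h.2
  unfold Adj at h2
  by_cases h1 : cl a = i ∨ cl a = i + 1
  · by_cases h3 : cl b = i ∨ cl b = i + 1
    · have : cl a = cl b := by omega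
      rcases h1 with h1 | h1
      · rw [E_false h1, E_false (by omega)]
      · rw [E_true h1, E_true (by omega)]
    · rw [E_none (a := b) (by omega)]; simp
  · rw [E_none (a := a) (by omega)]; simp

lemma E_ce (i : ℕ) {l l' : List V} (h : CE l l') : E i l = E i l' := by
  induction h with
  | refl l => rfl
  | swap a b l h =>
    rw [show a :: b :: l = [a] ++ [b] ++ l from rfl, show b :: a :: l = [b] ++ [a] ++ l from rfl,
      E_append, E_append, E_append, E_append, E_swap i h]
  | cons a _ ih => rw [E_cons, ih, ← E_cons]
  | trans _ _ h1 h2 => exact h1.trans h2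

lemma E_rev {i : ℕ} (hi : i ≤ n + 1) (l : List V) : E i (l.map Fin.rev) = (E (n + 1 - i) l).map not := by
  unfold E
  rw [List.filterMap_map, List.map_filterMap]
  congr 1
  funext a
  have := cl_ge a
  have := cl_le a
  simp only [Function.comp_apply]
  by_cases h1 : cl a = n + 1 - i
  · rw [ef_false.2 h1, ef_true.2 (by rw [cl_rev]; omega)]; rfl
  by_cases h2 : cl a = n + 1 - i + 1
  · rw [ef_true.2 h2, ef_false.2 (by rw [cl_rev]; omega)]; rfl
  · rw [ef_none.2 ⟨h1, h2⟩, ef_none.2 (by rw [cl_rev]; omega)]; rfl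

lemma E_rep_false {i : ℕ} {m : List V} (h : ∀ a ∈ m, cl a ≠ i + 1) :
    E i m = List.replicate (m.countP (fun a => decide (cl a = i))) false := by
  induction m with
  | nil => rfl
  | cons a m ih =>
    have ih := ih (fun b hb => h b (List.mem_cons_of_mem _ hb))
    have ha := h a List.mem_cons_self
    rw [E_cons, ih]
    by_cases h1 : cl a = i
    · rw [E_false h1, List.countP_cons_of_pos (by simpa using h1)]; rfl
    · rw [E_none ⟨h1, ha⟩, List.countP_cons_of_neg (by simpa using h1)]; rfl

def NP (l : List V) : Prop := dv n 2 ∈ l → ∀ x y, ¬ CE l (x ++ ([dv n 0, dv n 1] ++ y))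

structure Ctx (l : List V) : Prop where
  g : Good l
  L : LIrr l
  R : RIrr l
  p : NP l
  p2 : NP (l.map Fin.rev)

lemma Ctx.rev {l : List V} (h : Ctx l) : Ctx (l.map Fin.rev) :=
  ⟨h.g.rev, h.L.rev, h.R.rev, h.p2, by rw [map_rev_rev]; exact h.p⟩

lemma NP.reverse {l : List V} (h : NP l) : NP l.reverse := by
  intro h2 x y k
  refine h (by simpa using h2) y.reverse x.reverse ?_
  have := k.reverse
  rw [List.reverse_append, List.reverse_append, List.reverse_reverse, List.append_assoc] at this
  exact this.trans (CE.appl _ (.swap _ _ _ cm01.symm))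

lemma Ctx.reverse {l : List V} (h : Ctx l) : Ctx l.reverse :=
  ⟨h.g.reverse, h.R.reverse, h.L.reverse, h.p.reverse, by
    rw [List.map_reverse]; exact h.p2.reverse⟩

/-- decomposition of a two-letter infix of the edge projection -/
lemma E_infix2 {i : ℕ} {l : List V} {b b' : Bool} (h : [b, b'] <:+: E i l) :
    ∃ x c m d y, l = x ++ c :: (m ++ d :: y) ∧ ef i c = some b ∧ ef i d = some b' ∧
      ∀ a ∈ m, ef i a = none := by
  obtain ⟨u, v, h⟩ := h
  rw [List.append_assoc] at h
  obtain ⟨l1, l2, rfl, h1, h2⟩ := List.filterMap_eq_append_iff.1 h.symm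
  obtain ⟨x, c, y, rfl, h3, h4, h5⟩ := List.filterMap_eq_cons_iff.1 h2
  obtain ⟨m, d, z, rfl, h6, h7, h8⟩ := List.filterMap_eq_cons_iff.1 h5
  exact ⟨l1 ++ x, c, m, d, z, by simp, h4, h7, h6⟩

lemma dv2_mem (hn : 2 ≤ n) {l : List V} {a : V} (ha : a ∈ l) (h : cl a = 2) : dv n 2 ∈ l := by
  rw [← eq_dv h le_rfl hn]; exact ha

lemma noFF (hn : 2 ≤ n) {l : List V} (h : Ctx l) : ∀ i, 1 ≤ i → i ≤ n →
    (i = 1 → dv n 2 ∈ l) → ¬ [false, false] <:+: E i l := by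
  intro i h1
  induction i, h1 using Nat.le_induction with
  | base =>
    intro _ h2 hk
    have h2 := h2 rfl
    obtain ⟨x, c, m, d, y, rfl, hc, hd, hm⟩ := E_infix2 hk
    rw [ef_false] at hc hd
    have hcm : ∀ a ∈ m, Cm a d := by
      intro a ha
      have := ef_none.1 (hm a ha)
      have := cl_ge a
      exact cm_of_cl (by omega)
    by_cases hcd : c = d
    · subst hcd
      have e : CE (x ++ c :: (m ++ c :: y)) (x ++ c :: c :: (m ++ y)) :=
        CE.appl x (.cons c (CE.front y hcm))
      exact good_TT (h.g.ce e)
    · have e : CE (x ++ c :: (m ++ d :: y)) (x ++ c :: d :: (m ++ y)) :=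
        CE.appl x (.cons c (CE.front y hcm))
      rcases cl_one hc hn with rfl | rfl <;> rcases cl_one hd hn with rfl | rfl
      · exact hcd rfl
      · exact h.p h2 x (m ++ y) e
      · exact h.p h2 x (m ++ y) (e.trans (CE.appl x (.swap _ _ _ cm01.symm)))
      · exact hcd rfl
  | succ i h1 ih =>
    intro hi _ hk
    obtain ⟨x, c, m, d, y, rfl, hc, hd, hm⟩ := E_infix2 hk
    rw [ef_false] at hc hd
    have hcd : c = d := eq_of_cl (by omega) (by omega) (by omega)
    subst hcd
    have hcm : c ∉ m := by
      intro hh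
      have := ef_none.1 (hm c hh)
      omega
    have hgap := h.g.gap hcm
    refine ih (by omega) ?_ ?_
    · rintro rfl
      exact dv2_mem hn (a := c) (by simp) hc
    · have hE : E i m = List.replicate (m.countP (fun a => decide (cl a = i))) false := by
        apply E_rep_false
        intro a ha
        exact (ef_none.1 (hm a ha)).1
      have hle : m.countP (fun a => decide (Adj a c)) ≤ m.countP (fun a => decide (cl a = i)) := by
        apply List.countP_mono_left
        intro a ha hA
        simp only [decide_eq_true_eq] at hA ⊢
        have := ef_none.1 (hm a ha)
        unfold Adj at hA
        omega
      obtain ⟨k, hk⟩ : ∃ k, m.countP (fun a => decide (cl a = i)) = k + 2 :=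
        ⟨m.countP (fun a => decide (cl a = i)) - 2, by omega⟩
      rw [hk, Nat.add_comm k 2, List.replicate_add] at hE
      rw [E_append, E_cons, E_append, hE]
      refine ⟨E i x ++ E i [c], List.replicate k false ++ E i (c :: y), ?_⟩
      simp [List.replicate]

lemma map_not_infix {t u : List Bool} (h : t <:+: u) : t.map not <:+: u.map not := by
  obtain ⟨x, y, rfl⟩ := h
  exact ⟨x.map not, y.map not, by simp⟩

lemma mem_rev {l : List V} {k : ℕ} (hk : k ≤ n + 2) (h : dv n k ∈ l) : dv n (n + 2 - k) ∈ l.map Fin.rev := by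
  rw [← rev_dv hk]; exact List.mem_map_of_mem h

lemma noTT (hn : 2 ≤ n) {l : List V} (h : Ctx l) (i : ℕ) (h1 : 1 ≤ i) (h2 : i ≤ n)
    (h3 : i = n → dv n n ∈ l) : ¬ [true, true] <:+: E i l := by
  intro hk
  refine noFF hn h.rev (n + 1 - i) (by omega) (by omega) ?_ ?_
  · intro h4
    have := mem_rev (by omega) (h3 (by omega))
    rwa [show n + 2 - n = 2 by omega] at this
  · rw [E_rev (by omega), show n + 1 - (n + 1 - i) = i by omega]
    exact map_not_infix hk

/-- A column-`t` letter. -/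
def Has (t : ℕ) (l : List V) : Prop := ∃ a ∈ l, cl a = t

lemma head_some_mem {i : ℕ} {l : List V} {b : Bool} (h : (E i l).head? = some b) :
    ∃ p c s, l = p ++ c :: s ∧ ef i c = some b ∧ ∀ a ∈ p, ef i a = none := by
  obtain ⟨t, ht⟩ := List.head?_eq_some_iff.1 h
  obtain ⟨x, c, y, rfl, h3, h4, h5⟩ := List.filterMap_eq_cons_iff.1 ht
  exact ⟨x, c, y, rfl, h4, h3⟩

lemma has_false {i : ℕ} {l : List V} : Has i l ↔ false ∈ E i l := by
  unfold E Has
  rw [List.mem_filterMap]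
  simp only [ef_false]
lemma has_true {i : ℕ} {l : List V} : Has (i+1) l ↔ true ∈ E i l := by
  unfold E Has
  rw [List.mem_filterMap]
  simp only [ef_true]

lemma head_true_has {i : ℕ} {l : List V} (h : (E i l).head? = some true) : Has (i+1) l := by
  rw [has_true]; exact List.mem_of_mem_head? h
lemma head_false_has {i : ℕ} {l : List V} (h : (E i l).head? = some false) : Has i l := by
  rw [has_false]; exact List.mem_of_mem_head? h

lemma head_of_ne {t : List Bool} (h : t ≠ []) (h2 : t.head? ≠ some true) : t.head? = some false := by
  cases t with
  | nil => exact absurd rfl h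
  | cons b t => cases b <;> simp_all

lemma st1 (hn : 2 ≤ n) {l : List V} (h : Ctx l) : ∀ t, 1 ≤ t → t ≤ n → Has (t+1) l →
    (E t l).head? = some false → (E (t+1) l).head? = some true := by
  intro t h1
  induction t, h1 using Nat.le_induction with
  | base =>
    intro h1 ht hh
    by_contra hc
    have hf : (E (1+1) l).head? = some false := by
      refine head_of_ne ?_ hc
      intro he
      rw [has_false, he] at ht; simp at ht
    obtain ⟨p, d, s, rfl, hd, hp⟩ := head_some_mem hf
    rw [ef_false] at hd
    have hE : E 1 p = List.replicate (p.countP (fun a => decide (cl a = 1))) false := by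
      apply E_rep_false
      intro a ha
      exact (ef_none.1 (hp a ha)).1
    have hE2 : E 1 (p ++ d :: s) = E 1 p ++ true :: E 1 s := by
      rw [E_append, E_cons, E_true hd]; rfl
    rcases hk : p.countP (fun a => decide (cl a = 1)) with _ | _ | k
    · rw [hE2, hE, hk] at hh; simp at hh
    · obtain ⟨c, hcp, hc1⟩ := List.countP_pos_iff.1 (by rw [hk]; omega : 0 < p.countP (fun a => decide (cl a = 1)))
      obtain ⟨p1, p2, rfl⟩ := List.append_of_mem hcp
      simp only [decide_eq_true_eq] at hc1
      rw [List.countP_append, List.countP_cons_of_pos (by simpa using hc1)] at hk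
      have k1 : p1.countP (fun a => decide (cl a = 1)) = 0 := by omega
      have k2 : p2.countP (fun a => decide (cl a = 1)) = 0 := by omega
      rw [List.countP_eq_zero] at k1 k2
      have e1 : CE (p2 ++ d :: s) (d :: (p2 ++ s)) := by
        apply CE.front
        intro b hb
        have := ef_none.1 (hp b (by simp [hb]))
        have h3 := k2 b hb
        simp only [decide_eq_true_eq] at h3
        have := cl_ge b
        exact cm_of_cl (by omega)
      have e2 : CE (p1 ++ c :: d :: (p2 ++ s)) (c :: (p1 ++ d :: (p2 ++ s))) := by
        apply CE.front
        intro b hb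
        have := ef_none.1 (hp b (by simp [hb]))
        have h3 := k1 b hb
        simp only [decide_eq_true_eq] at h3
        have := cl_ge b
        exact cm_of_cl (by omega)
      have e3 : CE (p1 ++ d :: (p2 ++ s)) (d :: (p1 ++ (p2 ++ s))) := by
        apply CE.front
        intro b hb
        have := ef_none.1 (hp b (by simp [hb]))
        have h3 := k1 b hb
        simp only [decide_eq_true_eq] at h3
        have := cl_ge b
        exact cm_of_cl (by omega)
      refine h.L c d (p1 ++ (p2 ++ s)) (by unfold Adj; omega) ?_
      rw [List.append_assoc, List.cons_append]
      exact (((CE.cons c e1).appl p1).trans e2).trans (.cons c e3)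
    · refine noFF hn h 1 le_rfl (by omega) (fun _ => dv2_mem hn (a := d) (by simp) hd) ?_
      rw [hE2, hE, hk, show k + 1 + 1 = 2 + k by omega, List.replicate_add]
      exact ⟨[], List.replicate k false ++ true :: E 1 s, by simp [List.replicate]⟩
  | succ t h1 ih =>
    intro htn ht hh
    by_contra hc
    have hf : (E (t+1+1) l).head? = some false := by
      refine head_of_ne ?_ hc
      intro he
      rw [has_false, he] at ht; simp at ht
    obtain ⟨p, d, s, rfl, hd, hp⟩ := head_some_mem hf
    rw [ef_false] at hd
    have hE : E (t+1) p = List.replicate (p.countP (fun a => decide (cl a = t+1))) false := by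
      apply E_rep_false
      intro a ha
      exact (ef_none.1 (hp a ha)).1
    have hE2 : E (t+1) (p ++ d :: s) = E (t+1) p ++ true :: E (t+1) s := by
      rw [E_append, E_cons, E_true hd]; rfl
    rcases hk : p.countP (fun a => decide (cl a = t+1)) with _ | _ | k
    · rw [hE2, hE, hk] at hh; simp at hh
    · obtain ⟨c, hcp, hc1⟩ := List.countP_pos_iff.1 (by rw [hk]; omega : 0 < p.countP (fun a => decide (cl a = t+1)))
      obtain ⟨p1, p2, rfl⟩ := List.append_of_mem hcp
      simp only [decide_eq_true_eq] at hc1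
      rw [List.countP_append, List.countP_cons_of_pos (by simpa using hc1)] at hk
      have k1 : p1.countP (fun a => decide (cl a = t+1)) = 0 := by omega
      have k2 : p2.countP (fun a => decide (cl a = t+1)) = 0 := by omega
      rw [List.countP_eq_zero] at k1 k2
      -- no column t letter in p1
      have k3 : ∀ b ∈ p1, cl b ≠ t := by
        intro b hb hbt
        have hEt : E t p1 = List.replicate (p1.countP (fun a => decide (cl a = t))) false := by
          apply E_rep_false
          intro a ha
          simpa using k1 a ha
        have hpos : 0 < p1.countP (fun a => decide (cl a = t)) :=
          List.countP_pos_iff.2 ⟨b, hb, by simpa using hbt⟩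
        have : (E t (p1 ++ c :: p2 ++ d :: s)).head? = some false := by
          rw [List.append_assoc, E_append, hEt]
          obtain ⟨k, hk'⟩ : ∃ k, p1.countP (fun a => decide (cl a = t)) = k + 1 :=
            ⟨p1.countP (fun a => decide (cl a = t)) - 1, by omega⟩
          rw [hk']; rfl
        have := ih (by omega) ⟨c, by simp, hc1⟩ this
        rw [hh] at this; simp at this
      have e1 : CE (p2 ++ d :: s) (d :: (p2 ++ s)) := by
        apply CE.front
        intro b hb
        have := ef_none.1 (hp b (by simp [hb]))
        have h3 := k2 b hb
        simp only [decide_eq_true_eq] at h3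
        exact cm_of_cl (by omega)
      have e2 : CE (p1 ++ c :: d :: (p2 ++ s)) (c :: (p1 ++ d :: (p2 ++ s))) := by
        apply CE.front
        intro b hb
        have := ef_none.1 (hp b (by simp [hb]))
        have h3 := k1 b hb
        have := k3 b hb
        simp only [decide_eq_true_eq] at h3
        exact cm_of_cl (by omega)
      have e3 : CE (p1 ++ d :: (p2 ++ s)) (d :: (p1 ++ (p2 ++ s))) := by
        apply CE.front
        intro b hb
        have := ef_none.1 (hp b (by simp [hb]))
        have h3 := k1 b hb
        simp only [decide_eq_true_eq] at h3
        exact cm_of_cl (by omega)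
      refine h.L c d (p1 ++ (p2 ++ s)) (by unfold Adj; omega) ?_
      rw [List.append_assoc, List.cons_append]
      exact (((CE.cons c e1).appl p1).trans e2).trans (.cons c e3)
    · refine noFF hn h (t+1) (by omega) (by omega) (by omega) ?_
      rw [hE2, hE, hk, show k + 1 + 1 = 2 + k by omega, List.replicate_add]
      exact ⟨[], List.replicate k false ++ true :: E (t+1) s, by simp [List.replicate]⟩


end

section
local notation "V" => Fin (n+3)

lemma Has.rev {t : ℕ} {l : List V} (h : Has t l) : Has (n + 2 - t) (l.map Fin.rev) := by
  obtain ⟨a, ha, hc⟩ := h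
  exact ⟨a.rev, List.mem_map_of_mem ha, by rw [cl_rev, hc]⟩
lemma Has.reverse {t : ℕ} {l : List V} (h : Has t l) : Has t l.reverse := by
  obtain ⟨a, ha, hc⟩ := h
  exact ⟨a, by simpa using ha, hc⟩

lemma head_map_not {t : List Bool} {b : Bool} (h : t.head? = some b) :
    (t.map not).head? = some (!b) := by
  rw [List.head?_map, h]; rfl

lemma E_rev_head {l : List V} {i : ℕ} {b : Bool} (hi : i ≤ n + 1) (h : (E i l).head? = some b) :
    (E (n + 1 - i) (l.map Fin.rev)).head? = some (!b) := by
  rw [E_rev (by omega), show n + 1 - (n + 1 - i) = i by omega]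
  exact head_map_not h

lemma E0 (l : List V) : (E 0 l).head? ≠ some false := by
  intro h
  obtain ⟨a, -, h⟩ := head_false_has h
  have := cl_ge a
  omega
lemma En (l : List V) : (E (n+1) l).head? ≠ some true := by
  intro h
  obtain ⟨a, -, h⟩ := head_true_has h
  have := cl_le a
  omega

lemma st2 (hn : 2 ≤ n) {l : List V} (h : Ctx l) (t : ℕ) (h1 : t + 1 ≤ n) (h2 : Has (t+1) l)
    (h3 : (E (t+1) l).head? = some true) : (E t l).head? = some false := by
  have h4 := st1 hn h.rev (n - t) (by omega) (by omega)
    (by rw [show n - t + 1 = n + 2 - (t+1) by omega]; exact h2.rev)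
    (by rw [show n - t = n + 1 - (t+1) by omega]; exact E_rev_head (by omega) h3)
  have h5 := E_rev_head (by omega) h4
  rwa [map_rev_rev, show n + 1 - (n - t + 1) = t by omega] at h5

/-- column `t+1` is present and is preceded by both neighbouring columns -/
def Sk (t : ℕ) (l : List V) : Prop :=
  Has (t+1) l ∧ (E t l).head? = some false ∧ (E (t+1) l).head? = some true

lemma Sk.rev {t : ℕ} {l : List V} (h : Sk t l) (ht : t + 1 ≤ n) : Sk (n - t) (l.map Fin.rev) := by
  refine ⟨?_, ?_, ?_⟩
  · rw [show n - t + 1 = n + 2 - (t+1) by omega]; exact h.1.rev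
  · rw [show n - t = n + 1 - (t+1) by omega]; exact E_rev_head (by omega) h.2.2
  · rw [show n - t + 1 = n + 1 - t by omega]; exact E_rev_head (by omega) h.2.1

lemma Sk.bd {t : ℕ} {l : List V} (h : Sk t l) : 1 ≤ t ∧ t + 1 ≤ n := by
  refine ⟨?_, ?_⟩
  · rcases t with _ | t
    · exact absurd h.2.1 (E0 l)
    · omega
  · obtain ⟨a, -, ha⟩ := h.1
    have := cl_le a
    by_contra hc
    have : t = n := by omega
    subst this
    exact En l h.2.2

lemma sk_exists (hn : 2 ≤ n) {l : List V} (h : Ctx l) {i : ℕ} (h1 : Has i l) (h2 : Has (i+1) l) :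
    ∃ t, Sk t l := by
  obtain ⟨a, ha, hai⟩ := h1
  have := cl_ge a
  obtain ⟨b, hb, hbi⟩ := h2
  have := cl_le b
  by_cases hE : (E i l).head? = some true
  · obtain ⟨j, rfl⟩ : ∃ j, i = j + 1 := ⟨i - 1, by omega⟩
    exact ⟨j, ⟨a, ha, hai⟩, st2 hn h j (by omega) ⟨a, ha, hai⟩ hE, hE⟩
  · have hE : (E i l).head? = some false := by
      refine head_of_ne ?_ hE
      intro he
      have := has_false.1 ⟨a, ha, hai⟩
      rw [he] at this; simp at this
    exact ⟨i, ⟨b, hb, hbi⟩, hE, st1 hn h i (by omega) (by omega) ⟨b, hb, hbi⟩ hE⟩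

lemma countP_E_true (i : ℕ) (l : List V) :
    (E i l).count true = l.countP (fun a => decide (cl a = i + 1)) := by
  induction l with
  | nil => rfl
  | cons a l ih =>
    rw [E_cons, List.count_append, ih, List.countP_cons]
    by_cases h1 : cl a = i + 1
    · rw [E_true h1]; simp [h1]; omega
    · by_cases h2 : cl a = i
      · rw [E_false h2]; simp [h1]
      · rw [E_none ⟨h2, h1⟩]; simp [h1]
lemma countP_E_false (i : ℕ) (l : List V) :
    (E i l).count false = l.countP (fun a => decide (cl a = i)) := by
  induction l with
  | nil => rfl
  | cons a l ih =>
    rw [E_cons, List.count_append, ih, List.countP_cons]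
    by_cases h1 : cl a = i
    · rw [E_false h1]; simp [h1]; omega
    · by_cases h2 : cl a = i + 1
      · rw [E_true h2]; simp [h1]
      · rw [E_none ⟨h1, h2⟩]; simp [h1]

lemma Sk.up (hn : 2 ≤ n) {l : List V} (h : Ctx l) {t : ℕ} (hs : Sk t l) (ht : t + 2 ≤ n) :
    Sk (t+2) l := by
  have hb := hs.bd
  have hp2 : Has (t+2) l := head_true_has hs.2.2
  have hp3 : Has (t+3) l := by
    by_contra hc
    have e2 : E (t+2) l = List.replicate (l.countP (fun a => decide (cl a = t+2))) false := by
      apply E_rep_false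
      intro a ha hh
      exact hc ⟨a, ha, hh⟩
    have hcnt : l.countP (fun a => decide (cl a = t+2)) ≤ 1 := by
      by_contra hcc
      obtain ⟨k, hk⟩ : ∃ k, l.countP (fun a => decide (cl a = t+2)) = 2 + k :=
        ⟨l.countP (fun a => decide (cl a = t+2)) - 2, by omega⟩
      refine noFF hn h (t+2) (by omega) ht (by omega) ?_
      rw [e2, hk, List.replicate_add]
      exact ⟨[], List.replicate k false, by simp [List.replicate]⟩
    rw [← countP_E_true (t+1)] at hcnt
    obtain ⟨r, hr⟩ := List.head?_eq_some_iff.1 hs.2.2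
    have hf : false ∈ E (t+1) l := has_false.1 hs.1
    rw [hr] at hf hcnt
    simp only [List.count_cons_self] at hcnt
    have hr0 : true ∉ r := by rw [← List.count_eq_zero]; omega
    have hlast : (E (t+1) l.reverse).head? = some false := by
      rw [E_reverse, hr]
      refine head_of_ne (by simp) ?_
      rw [List.head?_reverse]
      intro hh
      cases r with
      | nil => simp at hf
      | cons b r =>
        rw [List.getLast?_cons_cons] at hh
        exact hr0 (List.mem_of_mem_getLast? hh)
    have := head_true_has (st1 hn h.reverse (t+1) (by omega) (by omega) hp2.reverse hlast)
    exact hc (by simpa using this.reverse)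
  have hE2 : (E (t+2) l).head? = some false := by
    refine head_of_ne ?_ ?_
    · intro he
      have := has_false.1 hp2
      rw [he] at this; simp at this
    · intro hh
      have := st2 hn h (t+1) (by omega) hp2 hh
      rw [hs.2.2] at this; simp at this
  exact ⟨hp3, hE2, st1 hn h (t+2) (by omega) (by omega) hp3 hE2⟩

lemma Sk.down (hn : 2 ≤ n) {l : List V} (h : Ctx l) {t : ℕ} (hs : Sk (t+2) l) : Sk t l := by
  have hb := hs.bd
  have h1 := (hs.rev hb.2).up hn h.rev (by omega)
  have h2 := h1.rev h1.bd.2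
  rwa [map_rev_rev, show n - (n - (t+2) + 2) = t by omega] at h2

lemma Sk.one (hn : 2 ≤ n) {l : List V} (h : Ctx l) : ∀ {t : ℕ}, Sk t l → Sk 1 l
  | 0, hs => absurd hs.bd.1 (by omega)
  | 1, hs => hs
  | t+2, hs => (hs.down hn h).one hn h

lemma Sk.all (hn : 2 ≤ n) {l : List V} (h : Ctx l) (hs : Sk 1 l) : ∀ k, 2*k+2 ≤ n → Sk (2*k+1) l
  | 0, _ => hs
  | k+1, hk => (Sk.all hn h hs k (by omega)).up hn h (by omega)

lemma Sk.even (hn : 2 ≤ n) {l : List V} (h : Ctx l) (hs : Sk 1 l) : n % 2 = 0 := by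
  by_contra hc
  have h1 := (Sk.all hn h hs ((n-3)/2) (by omega)).up hn h (by omega)
  have := h1.bd
  omega

lemma Sk.heads (hn : 2 ≤ n) {l : List V} (h : Ctx l) (hs : Sk 1 l) (i : ℕ) (h1 : 1 ≤ i) (h2 : i ≤ n) :
    (E i l).head? = some (decide (i % 2 = 0)) := by
  have he := hs.even hn h
  have h3 := Sk.all hn h hs ((i-1)/2) (by omega)
  by_cases hi : i % 2 = 0
  · have := h3.2.2
    rw [show 2 * ((i-1)/2) + 1 + 1 = i by omega] at this
    rw [this]; simp [hi]
  · have := h3.2.1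
    rw [show 2 * ((i-1)/2) + 1 = i by omega] at this
    rw [this]; simp [hi]

def ab (b : Bool) : ℕ → List Bool
  | 0 => [b]
  | M+1 => b :: (!b) :: ab b M

lemma ab_of : ∀ (N : ℕ) (t : List Bool) (b : Bool), t.length ≤ N → t.head? = some b → t.getLast? = some b →
    ¬ [false, false] <:+: t → ¬ [true, true] <:+: t → ∃ M, t = ab b M := by
  intro N
  induction N with
  | zero => intro t b hl h1; cases t <;> simp_all
  | succ N ih =>
    intro t b hl h1 h2 h3 h4
    match t, hl, h1, h2, h3, h4 with
    | [c], _, h1, _, _, _ =>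
      simp at h1
      exact ⟨0, by simp [ab, h1]⟩
    | [c, d], _, h1, h2, h3, h4 =>
      simp at h1 h2; subst h1; subst h2
      cases d
      · exact absurd (List.infix_refl _) h3
      · exact absurd (List.infix_refl _) h4
    | c :: d :: e :: t, hl, h1, h2, h3, h4 =>
      simp at h1; subst h1
      have i1 : e :: t <:+: c :: d :: e :: t := ⟨[c, d], [], by simp⟩
      have hc : ∀ x y (r r' : List Bool), c :: d :: e :: t = r ++ x :: y :: r' → y = !x := by
        intro x y r r' hr
        cases x <;> cases y
        · exact absurd ⟨r, r', by rw [hr]; simp⟩ h3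
        · rfl
        · rfl
        · exact absurd ⟨r, r', by rw [hr]; simp⟩ h4
      have hd := hc c d [] (e :: t) rfl
      have he := hc d e [c] t rfl
      have : e = c := by rw [he, hd]; simp
      obtain ⟨M, hM⟩ := ih (e :: t) c (by simp at hl ⊢; omega) (by simp [this])
        (by rw [← h2, List.getLast?_cons_cons, List.getLast?_cons_cons])
        (fun k => h3 (k.trans i1)) (fun k => h4 (k.trans i1))
      exact ⟨M+1, by simp [ab, hM, hd]⟩

lemma ab_count (b : Bool) : ∀ M, (ab b M).count b = M + 1 ∧ (ab b M).count (!b) = M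
  | 0 => by cases b <;> simp [ab]
  | M+1 => by have := ab_count b M; cases b <;> simp_all [ab]

lemma sk_ab (hn : 2 ≤ n) {l : List V} (h : Ctx l) (hs : Sk 1 l) :
    ∃ M, 1 ≤ M ∧ ∀ i, 1 ≤ i → i ≤ n → E i l = ab (decide (i % 2 = 0)) M := by
  have he := hs.even hn h
  have hs' : Sk 1 l.reverse := by
    obtain ⟨t, ht⟩ := sk_exists hn h.reverse (head_false_has hs.2.1).reverse hs.1.reverse
    exact ht.one hn h.reverse
  have h2 : dv n 2 ∈ l := by
    obtain ⟨a, ha, hc⟩ := hs.1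
    exact dv2_mem hn ha hc
  have hnn : dv n n ∈ l := by
    obtain ⟨a, ha, hc⟩ := (Sk.all hn h hs ((n-2)/2) (by omega)).1
    have : a = dv n n := eq_dv (by omega) (by omega) le_rfl
    rw [← this]; exact ha
  have key : ∀ i, 1 ≤ i → i ≤ n → ∃ M, E i l = ab (decide (i % 2 = 0)) M := by
    intro i hi1 hi2
    refine ab_of _ _ _ le_rfl (hs.heads hn h i hi1 hi2) ?_ (noFF hn h i hi1 hi2 (fun _ => h2))
      (noTT hn h i hi1 hi2 (fun _ => hnn))
    have := hs'.heads hn h.reverse i hi1 hi2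
    rwa [E_reverse, List.head?_reverse] at this
  obtain ⟨M, hM⟩ := key 1 le_rfl (by omega)
  refine ⟨M, ?_, ?_⟩
  · rcases M with _ | M
    · have := has_true.1 hs.1
      rw [hM] at this
      simp [ab] at this
    · omega
  · intro i hi1
    induction i, hi1 using Nat.le_induction with
    | base => intro _; exact hM
    | succ i hi ih =>
      intro hi2
      have ih := ih (by omega)
      obtain ⟨M', hM'⟩ := key (i+1) (by omega) hi2
      rw [hM']
      have c1 := countP_E_true i l
      rw [← countP_E_false (i+1) l, ih, hM'] at c1
      have a1 := ab_count (decide (i % 2 = 0)) M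
      have a2 := ab_count (decide ((i+1) % 2 = 0)) M'
      by_cases hp : i % 2 = 0
      · have hp' : ¬ (i+1) % 2 = 0 := by omega
        simp only [hp, hp', decide_true, decide_false, Bool.not_true, Bool.not_false] at c1 a1 a2 ⊢
        have : M = M' := by omega
        rw [this]
      · have hp' : (i+1) % 2 = 0 := by omega
        simp only [hp, hp', decide_true, decide_false, Bool.not_true, Bool.not_false] at c1 a1 a2 ⊢
        have : M = M' := by omega
        rw [this]


end

section
local notation "V" => Fin (n+3)

/-- the letters of column `i`, in order -/
def Fc (i : ℕ) (l : List V) : List V := l.filter (fun a => decide (cl a = i))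

lemma Fc_append (i : ℕ) (l l' : List V) : Fc i (l ++ l') = Fc i l ++ Fc i l' := List.filter_append ..
lemma Fc_cons_self {a : V} (l : List V) : Fc (cl a) (a :: l) = a :: Fc (cl a) l := by
  simp [Fc]
lemma Fc_cons_ne {i : ℕ} {a : V} (h : cl a ≠ i) (l : List V) : Fc i (a :: l) = Fc i l := by
  simp [Fc, h]
lemma Fc_length (i : ℕ) (l : List V) : (Fc i l).length = l.countP (fun a => decide (cl a = i)) := by
  rw [Fc, List.countP_eq_length_filter]

lemma recon : ∀ (l l' : List V), (∀ i, 1 ≤ i → i ≤ n → E i l = E i l') →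
    (∀ i, 1 ≤ i → i ≤ n + 1 → Fc i l = Fc i l') → CE l l'
  | [], l', _, h2 => by
    cases l' with
    | nil => exact .refl _
    | cons b l' =>
      have := h2 (cl b) (cl_ge b) (cl_le b)
      rw [Fc_cons_self] at this
      simp [Fc] at this
  | a :: l, l', h1, h2 => by
    have h3 := h2 (cl a) (cl_ge a) (cl_le a)
    rw [Fc_cons_self] at h3
    obtain ⟨p, s, rfl, hp, ha, hs⟩ := List.filter_eq_cons_iff.1 h3.symm
    have hcm : ∀ b ∈ p, Cm b a := by
      intro b hb
      have hne : cl b ≠ cl a := by simpa using hp b hb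
      refine ⟨fun h => hne (by rw [h]), ?_⟩
      have hb1 := cl_ge b
      have hb2 := cl_le b
      have ha1 := cl_ge a
      have ha2 := cl_le a
      rintro (hA | hA)
      · have e := h1 (cl b) hb1 (by omega)
        rw [E_cons, E_true hA.symm, E_append] at e
        have hmem : false ∈ E (cl b) p := has_false.1 ⟨b, hb, rfl⟩
        have hno : true ∉ E (cl b) p := by
          intro hh
          obtain ⟨d, hd, hdc⟩ := has_true.2 hh
          have : cl d ≠ cl a := by simpa using hp d hd
          omega
        cases hE : E (cl b) p with
        | nil => rw [hE] at hmem; simp at hmem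
        | cons c r =>
          rw [hE] at e hno
          simp at e hno
          exact absurd (hno.1.symm.trans e.1) (by simp)
      · have e := h1 (cl a) ha1 (by omega)
        rw [E_cons, E_false rfl, E_append] at e
        have hmem : true ∈ E (cl a) p := has_true.1 ⟨b, hb, hA.symm⟩
        have hno : false ∉ E (cl a) p := by
          intro hh
          obtain ⟨d, hd, hdc⟩ := has_false.2 hh
          have : cl d ≠ cl a := by simpa using hp d hd
          omega
        cases hE : E (cl a) p with
        | nil => rw [hE] at hmem; simp at hmem
        | cons c r =>
          rw [hE] at e hno
          simp at e hno
          exact absurd (hno.1.symm.trans e.1) (by simp)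
    have hce : CE (p ++ a :: s) (a :: (p ++ s)) := CE.front s hcm
    have hrec : CE l (p ++ s) := by
      apply recon
      · intro i hi1 hi2
        have := h1 i hi1 hi2
        rw [E_ce i hce, E_cons, E_cons i a (p ++ s)] at this
        exact List.append_cancel_left this
      · intro i hi1 hi2
        have := h2 i hi1 hi2
        by_cases hi : cl a = i
        · subst hi
          have hp0 : Fc (cl a) p = [] := by
            unfold Fc
            rw [List.filter_eq_nil_iff]; exact hp
          rw [Fc_cons_self, Fc_append, Fc_cons_self, hp0] at this
          rw [Fc_append, hp0]
          simpa using this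
        · rwa [Fc_cons_ne hi, Fc_append, Fc_cons_ne hi, ← Fc_append] at this
    exact (CE.cons a hrec).trans hce.symm

/-- odd layer -/
def OL (x y : V) : List V := (List.finRange (n+3)).filter
  (fun a => decide (a = x ∨ a = y ∨ (3 ≤ a.1 ∧ a.1 ≤ n - 1 ∧ a.1 % 2 = 1)))
/-- even layer -/
def EL (n : ℕ) : List (Fin (n+3)) := (List.finRange (n+3)).filter
  (fun a => decide (2 ≤ a.1 ∧ a.1 ≤ n ∧ a.1 % 2 = 0))

lemma mem_OL {x y a : V} : a ∈ OL x y ↔ a = x ∨ a = y ∨ (3 ≤ a.1 ∧ a.1 ≤ n - 1 ∧ a.1 % 2 = 1) := by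
  simp [OL]
lemma mem_EL {a : V} : a ∈ EL n ↔ (2 ≤ a.1 ∧ a.1 ≤ n ∧ a.1 % 2 = 0) := by
  simp [EL]
lemma nodup_OL (x y : V) : (OL x y).Nodup := (List.nodup_finRange _).filter _
lemma nodup_EL : (EL n).Nodup := (List.nodup_finRange _).filter _

lemma cl_mid {a : V} (h1 : 2 ≤ a.1) (h2 : a.1 ≤ n) : cl a = a.1 := by
  rw [← dv_self a, cl_dv (by omega) (by omega), dv_self]

lemma val_mid {a : V} (h1 : 2 ≤ cl a) (h2 : cl a ≤ n) : a.1 = cl a := by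
  conv_lhs => rw [eq_dv rfl h1 h2]
  rw [dv_val (by omega)]

lemma mem_EL' {a : V} : a ∈ EL n ↔ (2 ≤ cl a ∧ cl a ≤ n ∧ cl a % 2 = 0) := by
  rw [mem_EL]
  constructor
  · rintro ⟨h1, h2, h3⟩
    rw [cl_mid h1 h2]; exact ⟨h1, h2, h3⟩
  · rintro ⟨h1, h2, h3⟩
    rw [val_mid h1 h2]; exact ⟨h1, h2, h3⟩

lemma mem_OL' {x y a : V} : a ∈ OL x y ↔ a = x ∨ a = y ∨ (3 ≤ cl a ∧ cl a ≤ n - 1 ∧ cl a % 2 = 1) := by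
  rw [mem_OL]
  refine or_congr Iff.rfl (or_congr Iff.rfl ?_)
  constructor
  · rintro ⟨h1, h2, h3⟩
    rw [cl_mid (by omega) (by omega)]; exact ⟨h1, h2, h3⟩
  · rintro ⟨h1, h2, h3⟩
    rw [val_mid (by omega) (by omega)]; exact ⟨h1, h2, h3⟩

lemma Fc_single {L : List V} (hL : L.Nodup) {c : V} (hc : c ∈ L) (h : ∀ a ∈ L, cl a = cl c → a = c) :
    Fc (cl c) L = [c] := by
  have : Fc (cl c) L = L.filter (fun a => a == c) := by
    unfold Fc
    apply List.filter_congr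
    intro a ha
    by_cases hac : a = c
    · simp [hac]
    · have : cl a ≠ cl c := fun hh => hac (h a ha hh)
      simp [hac, this]
  rw [this, List.filter_beq, List.count_eq_one_of_mem hL hc]; rfl

lemma Fc_nil {L : List V} {i : ℕ} (h : ∀ a ∈ L, cl a ≠ i) : Fc i L = [] := by
  unfold Fc
  rw [List.filter_eq_nil_iff]
  intro a ha
  simpa using h a ha

/-- validity of a layer -/
structure Lay (x y : V) : Prop where
  hn : 2 ≤ n
  ev : n % 2 = 0
  x : cl x = 1
  y : cl y = n + 1

lemma Lay.inj {x y : V} (h : Lay x y) {a b : V} (ha : a ∈ OL x y) (hb : b ∈ OL x y) (hab : cl a = cl b) :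
    a = b := by
  have := h.hn; have := h.x; have := h.y
  rw [mem_OL'] at ha hb
  rcases ha with rfl | rfl | ha <;> rcases hb with rfl | rfl | hb <;> first
    | rfl
    | (exfalso; omega)
    | exact eq_of_cl hab (by omega) (by omega)

lemma Lay.odd {x y : V} (h : Lay x y) {a : V} (ha : a ∈ OL x y) : cl a % 2 = 1 := by
  have := h.hn; have := h.x; have := h.y; have := h.ev
  rw [mem_OL'] at ha
  rcases ha with rfl | rfl | ha <;> omega

lemma Lay.ex {x y : V} (h : Lay x y) {i : ℕ} (hi : i % 2 = 1) (h2 : i ≤ n + 1) : ∃ c ∈ OL x y, cl c = i := by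
  have := h.hn; have := h.x; have := h.y; have := h.ev
  by_cases h1 : i = 1
  · exact ⟨x, by rw [mem_OL']; simp, by omega⟩
  by_cases h3 : i = n + 1
  · exact ⟨y, by rw [mem_OL']; simp, by omega⟩
  refine ⟨dv n i, ?_, cl_dv (by omega) (by omega)⟩
  rw [mem_OL', cl_dv (by omega) (by omega)]
  right; right; omega

lemma Lay.Fc_odd {x y : V} (h : Lay x y) {c : V} (hc : c ∈ OL x y) : Fc (cl c) (OL x y) = [c] :=
  Fc_single (nodup_OL _ _) hc (fun _ ha e => h.inj ha hc e)
lemma Lay.Fc_even {x y : V} (h : Lay x y) {i : ℕ} (hi : i % 2 = 0) : Fc i (OL x y) = [] :=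
  Fc_nil (fun a ha => by have := h.odd ha; omega)
lemma EL_Fc_even {c : V} (hc : c ∈ EL n) : Fc (cl c) (EL n) = [c] := by
  refine Fc_single nodup_EL hc (fun a ha e => ?_)
  have := mem_EL'.1 ha
  exact eq_of_cl e (by omega) (by omega)
lemma EL_Fc_odd {i : ℕ} (hi : i % 2 = 1) : Fc i (EL n) = [] :=
  Fc_nil (fun a ha => by have := mem_EL'.1 ha; omega)

lemma E_of_Fc {i : ℕ} {L : List V} (h : Fc (i+1) L = []) : E i L = List.replicate (Fc i L).length false := by
  rw [Fc_length]
  apply E_rep_false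
  intro a ha hh
  have : a ∈ Fc (i+1) L := by simp [Fc, ha, hh]
  rw [h] at this; simp at this

lemma E_rep_true {i : ℕ} {m : List V} (h : ∀ a ∈ m, cl a ≠ i) :
    E i m = List.replicate (m.countP (fun a => decide (cl a = i + 1))) true := by
  induction m with
  | nil => rfl
  | cons a m ih =>
    have ih := ih (fun b hb => h b (List.mem_cons_of_mem _ hb))
    have ha := h a List.mem_cons_self
    rw [E_cons, ih]
    by_cases h1 : cl a = i + 1
    · rw [E_true h1, List.countP_cons_of_pos (by simpa using h1)]; rfl
    · rw [E_none ⟨ha, h1⟩, List.countP_cons_of_neg (by simpa using h1)]; rfl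

lemma E_of_Fc' {i : ℕ} {L : List V} (h : Fc i L = []) : E i L = List.replicate (Fc (i+1) L).length true := by
  rw [Fc_length]
  apply E_rep_true
  intro a ha hh
  have : a ∈ Fc i L := by simp [Fc, ha, hh]
  rw [h] at this; simp at this

lemma Lay.E {x y : V} (h : Lay x y) {i : ℕ} (h2 : i ≤ n) : E i (OL x y) = [decide (i % 2 = 0)] := by
  by_cases hi : i % 2 = 0
  · rw [E_of_Fc' (h.Fc_even hi)]
    obtain ⟨c, hc, e⟩ := h.ex (i := i+1) (by omega) (by omega)
    rw [← e, h.Fc_odd hc]; simp [hi]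
  · rw [E_of_Fc (h.Fc_even (by omega))]
    obtain ⟨c, hc, e⟩ := h.ex (i := i) (by omega) (by omega)
    rw [← e, h.Fc_odd hc]; simp [e, hi]

lemma EL_ex (i : ℕ) (h1 : 2 ≤ i) (h2 : i ≤ n) (h : i % 2 = 0) : ∃ c ∈ EL n, cl c = i := by
  refine ⟨dv n i, ?_, cl_dv (by omega) (by omega)⟩
  rw [mem_EL', cl_dv (by omega) (by omega)]
  exact ⟨h1, h2, h⟩

lemma EL_E (hev : n % 2 = 0) {i : ℕ} (h1 : 1 ≤ i) (h2 : i ≤ n) : E i (EL n) = [!decide (i % 2 = 0)] := by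
  by_cases hi : i % 2 = 0
  · rw [E_of_Fc (EL_Fc_odd (by omega))]
    obtain ⟨c, hc, e⟩ := EL_ex (n := n) i (by omega) (by omega) hi
    rw [← e, EL_Fc_even hc]; simp [e, hi]
  · rw [E_of_Fc' (EL_Fc_odd (by omega))]
    obtain ⟨c, hc, e⟩ := EL_ex (n := n) (i+1) (by omega) (by omega) (by omega)
    rw [← e, EL_Fc_even hc]; simp [hi]

/-- candy layers -/
def cw (x y : ℕ → V) : ℕ → List (List V)
  | 0 => [OL (x 0) (y 0)]
  | M+1 => OL (x 0) (y 0) :: EL n :: cw (fun i => x (i+1)) (fun i => y (i+1)) M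

structure CV (x y : ℕ → V) (M : ℕ) : Prop where
  l : ∀ i ≤ M, Lay (x i) (y i)

lemma CV.succ {x y : ℕ → V} {M : ℕ} (h : CV x y (M+1)) : CV (fun i => x (i+1)) (fun i => y (i+1)) M :=
  ⟨fun i hi => h.l (i+1) (by omega)⟩

lemma CV.E : ∀ {M : ℕ} {x y : ℕ → V} (_ : CV x y M) {i : ℕ}, 1 ≤ i → i ≤ n →
    E i (cw x y M).flatten = ab (decide (i % 2 = 0)) M
  | 0, x, y, h, i, h1, h2 => by
    simp [cw, ab, (h.l 0 le_rfl).E h2]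
  | M+1, x, y, h, i, h1, h2 => by
    have h0 := h.l 0 (by omega)
    simp [cw, ab, h0.E h2, EL_E h0.ev h1 h2, h.succ.E h1 h2]

lemma CV.Fx : ∀ {M : ℕ} {x y : ℕ → V} (_ : CV x y M),
    Fc 1 (cw x y M).flatten = (List.range (M+1)).map x
  | 0, x, y, h => by
    have h0 := h.l 0 le_rfl
    have := h0.Fc_odd (c := x 0) (by rw [mem_OL']; simp)
    rw [h0.x] at this
    simp [cw, this]
  | M+1, x, y, h => by
    have h0 := h.l 0 (by omega)
    have := h0.Fc_odd (c := x 0) (by rw [mem_OL']; simp)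
    rw [h0.x] at this
    simp only [cw, List.flatten_cons, Fc_append, this, EL_Fc_odd, h.succ.Fx]
    rw [List.range_succ_eq_map (n := M+1)]
    simp [Function.comp_def]

lemma CV.Fy : ∀ {M : ℕ} {x y : ℕ → V} (_ : CV x y M),
    Fc (n+1) (cw x y M).flatten = (List.range (M+1)).map y
  | 0, x, y, h => by
    have h0 := h.l 0 le_rfl
    have := h0.Fc_odd (c := y 0) (by rw [mem_OL']; simp)
    rw [h0.y] at this
    simp [cw, this]
  | M+1, x, y, h => by
    have h0 := h.l 0 (by omega)
    have := h0.Fc_odd (c := y 0) (by rw [mem_OL']; simp)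
    rw [h0.y] at this
    have he : Fc (n+1) (EL n) = [] := EL_Fc_odd (by have := h0.ev; omega)
    simp only [cw, List.flatten_cons, Fc_append, this, he, h.succ.Fy]
    rw [List.range_succ_eq_map (n := M+1)]
    simp [Function.comp_def]

lemma Fc_mid {i : ℕ} (h1 : 2 ≤ i) (h2 : i ≤ n) (l : List V) :
    Fc i l = List.replicate ((E i l).count false) (dv n i) := by
  rw [countP_E_false, ← Fc_length, List.eq_replicate_iff]
  refine ⟨rfl, ?_⟩
  intro b hb
  have : cl b = i := by simpa using (List.mem_filter.1 hb).2
  exact eq_dv this h1 h2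

lemma list_fun {α : Type*} (d : α) (l : List α) : l = (List.range l.length).map (fun i => l.getD i d) := by
  apply List.ext_getElem
  · simp
  · intro i h1 h2
    simp [List.getD_eq_getElem?_getD, h1]

lemma CV.ce (hn : 2 ≤ n) {l : List V} {M : ℕ} (hev : n % 2 = 0)
    (h : ∀ i, 1 ≤ i → i ≤ n → CoxFC.E i l = ab (decide (i % 2 = 0)) M) :
    ∃ x y : ℕ → V, CV x y M ∧ Fc 1 l = (List.range (M+1)).map x ∧ Fc (n+1) l = (List.range (M+1)).map y ∧
      CE l (cw x y M).flatten := by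
  have l1 : (Fc 1 l).length = M + 1 := by
    rw [Fc_length, ← countP_E_false, h 1 le_rfl (by omega)]
    exact (ab_count false M).1
  have l2 : (Fc (n+1) l).length = M + 1 := by
    rw [Fc_length, ← countP_E_true, h n (by omega) le_rfl]
    simp only [hev, decide_true]
    exact (ab_count true M).1
  have e1 := list_fun (dv n 0) (Fc 1 l)
  have e2 := list_fun (dv n 0) (Fc (n+1) l)
  rw [l1] at e1
  rw [l2] at e2
  have hcv : CV (fun i => (Fc 1 l).getD i (dv n 0)) (fun i => (Fc (n+1) l).getD i (dv n 0)) M := by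
    refine ⟨fun i hi => ⟨hn, hev, ?_, ?_⟩⟩
    · have : (Fc 1 l).getD i (dv n 0) ∈ Fc 1 l := by
        rw [List.getD_eq_getElem _ _ (by omega)]; exact List.getElem_mem _
      simpa using (List.mem_filter.1 this).2
    · have : (Fc (n+1) l).getD i (dv n 0) ∈ Fc (n+1) l := by
        rw [List.getD_eq_getElem _ _ (by omega)]; exact List.getElem_mem _
      simpa using (List.mem_filter.1 this).2
  refine ⟨_, _, hcv, e1, e2, ?_⟩
  apply recon
  · intro i h1 h2
    rw [h i h1 h2, hcv.E h1 h2]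
  · intro i h1 h2
    by_cases hi : i = 1
    · subst hi; rw [hcv.Fx]; exact e1
    by_cases hi' : i = n + 1
    · subst hi'; rw [hcv.Fy]; exact e2
    · rw [Fc_mid (by omega) (by omega), Fc_mid (by omega) (by omega), h i h1 (by omega), hcv.E h1 (by omega)]


end

section
local notation "V" => Fin (n+3)

lemma range_split (i k : ℕ) : ∃ B : List ℕ, List.range (i + k + 2) = List.range i ++ i :: (i+1) :: B := by
  rw [show i + k + 2 = i + (k + 1 + 1) by omega, List.range_add, List.range_succ_eq_map,
    List.range_succ_eq_map]
  exact ⟨_, by simp; rfl⟩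

lemma x_ne (hn : 2 ≤ n) {l : List V} (h : Ctx l) {x : ℕ → V} {M : ℕ}
    (hx : Fc 1 l = (List.range (M+1)).map x) {i : ℕ} (hi : i < M) : x i ≠ x (i+1) := by
  intro he
  obtain ⟨B, hB⟩ := range_split i (M - i - 1)
  rw [show i + (M - i - 1) + 2 = M + 1 by omega] at hB
  rw [hB, List.map_append, List.map_cons, List.map_cons, ← he] at hx
  obtain ⟨l1, l2, rfl, h1, h2⟩ := List.filter_eq_append_iff.1 hx
  obtain ⟨p, s, rfl, h3, h4, h5⟩ := List.filter_eq_cons_iff.1 h2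
  obtain ⟨m, r, rfl, h6, h7, h8⟩ := List.filter_eq_cons_iff.1 h5
  have hc : cl (x i) = 1 := by simpa using h4
  have hm : x i ∉ m := fun hh => h6 _ hh (by simpa using hc)
  have hg := h.g
  rw [← List.append_assoc] at hg
  have hgap := hg.gap hm
  refine noTT hn h 1 le_rfl (by omega) ?_ ?_
  · intro hh; omega
  · have hE : E 1 m = List.replicate (m.countP (fun a => decide (cl a = 1 + 1))) true := by
      apply E_rep_true
      intro a ha
      simpa using h6 a ha
    have hle : m.countP (fun a => decide (Adj a (x i))) ≤ m.countP (fun a => decide (cl a = 1 + 1)) := by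
      apply List.countP_mono_left
      intro a ha hA
      simp only [decide_eq_true_eq] at hA ⊢
      have := cl_ge a
      unfold Adj at hA
      omega
    obtain ⟨k, hk⟩ : ∃ k, m.countP (fun a => decide (cl a = 1 + 1)) = 2 + k :=
      ⟨m.countP (fun a => decide (cl a = 1 + 1)) - 2, by omega⟩
    rw [hk, List.replicate_add] at hE
    rw [← List.append_assoc, E_append, E_cons, E_append 1 m, hE]
    refine ⟨E 1 (l1 ++ p) ++ E 1 [x i], List.replicate k true ++ E 1 (x i :: r), ?_⟩
    simp [List.replicate]

lemma Fc_rev (l : List V) : Fc 1 (l.map Fin.rev) = (Fc (n+1) l).map Fin.rev := by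
  unfold Fc
  rw [List.filter_map]
  congr 1
  apply List.filter_congr
  intro a _
  simp only [Function.comp_apply, cl_rev]
  have := cl_le a
  have := cl_ge a
  by_cases h : cl a = n + 1
  · simp [h]
  · simp [h]; omega

lemma y_ne (hn : 2 ≤ n) {l : List V} (h : Ctx l) {y : ℕ → V} {M : ℕ}
    (hy : Fc (n+1) l = (List.range (M+1)).map y) {i : ℕ} (hi : i < M) : y i ≠ y (i+1) := by
  have h1 := x_ne hn h.rev (x := fun i => (y i).rev) (M := M) (by rw [Fc_rev, hy, List.map_map]; rfl) hi
  exact fun he => h1 (by simp only [he])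

/-- validity of candy data, including alternation -/
structure CVV (x y : ℕ → V) (M : ℕ) : Prop extends CV x y M where
  nx : ∀ i < M, x i ≠ x (i+1)
  ny : ∀ i < M, y i ≠ y (i+1)

lemma CVV.succ {x y : ℕ → V} {M : ℕ} (h : CVV x y (M+1)) : CVV (fun i => x (i+1)) (fun i => y (i+1)) M :=
  ⟨h.toCV.succ, fun i hi => h.nx (i+1) (by omega), fun i hi => h.ny (i+1) (by omega)⟩

lemma countP_adj (s : V) (L : List V) : L.countP (fun a => decide (Adj a s)) =
    (Fc (cl s - 1) L).length + (Fc (cl s + 1) L).length := by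
  rw [Fc_length, Fc_length]
  induction L with
  | nil => rfl
  | cons a L ih =>
    rw [List.countP_cons, List.countP_cons, List.countP_cons, ih]
    have := cl_ge s
    have := cl_ge a
    by_cases h1 : cl a = cl s - 1
    · have hA : Adj a s := by unfold Adj; omega
      have h2 : cl a ≠ cl s + 1 := by omega
      rw [if_pos (by simpa using hA), if_pos (by simpa using h1), if_neg (by simpa using h2)]; omega
    · by_cases h2 : cl a = cl s + 1
      · have hA : Adj a s := by unfold Adj; omega
        rw [if_pos (by simpa using hA), if_neg (by simpa using h1), if_pos (by simpa using h2)]; omega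
      · have hA : ¬ Adj a s := by unfold Adj; omega
        rw [if_neg (by simpa using hA), if_neg (by simpa using h1), if_neg (by simpa using h2)]; omega

lemma q_out {s : V} {L : List V} (h : s ∉ L) :
    q s L = List.replicate ((Fc (cl s - 1) L).length + (Fc (cl s + 1) L).length) false := by
  rw [q_length s L h, countP_adj]

lemma q_in {s : V} {L : List V} (hL : L.Nodup) (h : s ∈ L) (h2 : ∀ a ∈ L, ¬ Adj a s) : q s L = [true] := by
  obtain ⟨u, v, rfl⟩ := List.append_of_mem h
  have hu : q s u = [] := by
    refine q_nil_of ?_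
    intro b hb
    exact ⟨by rintro rfl; simp [List.nodup_append] at hL; exact hL.2.2 b hb |>.1 rfl, h2 b (by simp [hb])⟩
  have hv : q s v = [] := by
    refine q_nil_of ?_
    intro b hb
    exact ⟨by rintro rfl; simp [List.nodup_append] at hL; exact hL.2.1.1 hb, h2 b (by simp [hb])⟩
  rw [q_append, q_cons_self, hu, hv]; rfl

lemma Lay.nadj {x y : V} (h : Lay x y) {a s : V} (ha : a ∈ OL x y) (hs : cl s % 2 = 1) : ¬ Adj a s := by
  have := h.odd ha
  unfold Adj; omega
lemma EL_nadj {a s : V} (ha : a ∈ EL n) (hs : cl s % 2 = 0) : ¬ Adj a s := by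
  have := mem_EL'.1 ha
  unfold Adj; omega

lemma Fc_one {L : List V} {i : ℕ} (h : ∃ c ∈ L, cl c = i) (h2 : ∀ c ∈ L, Fc (cl c) L = [c]) :
    (Fc i L).length = 1 := by
  obtain ⟨c, hc, rfl⟩ := h
  rw [h2 c hc]; rfl

lemma Lay.q_even {x y : V} (h : Lay x y) {s : V} (hs : cl s % 2 = 0) : q s (OL x y) = [false, false] := by
  have h1 := cl_ge s
  have h2 := cl_le s
  have h3 := h.ev
  rw [q_out (fun hh => by have := h.odd hh; omega),
    Fc_one (h.ex (by omega) (by omega)) (fun c hc => h.Fc_odd hc),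
    Fc_one (h.ex (by omega) (by omega)) (fun c hc => h.Fc_odd hc)]
  rfl

lemma Lay.q_in {x y : V} (h : Lay x y) {s : V} (hs : s ∈ OL x y) : q s (OL x y) = [true] :=
  CoxFC.q_in (nodup_OL _ _) hs (fun _ ha => h.nadj ha (h.odd hs))

lemma Lay.q_notin {x y : V} (h : Lay x y) {s : V} (hs : cl s % 2 = 1) (h2 : s ∉ OL x y) : q s (OL x y) = [] :=
  q_nil_of (fun b hb => ⟨fun e => h2 (e ▸ hb), h.nadj hb hs⟩)

lemma EL_q_even (hev : n % 2 = 0) {s : V} (hs : cl s % 2 = 0) : q s (EL n) = [true] := by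
  refine q_in nodup_EL ?_ (fun a ha => EL_nadj ha hs)
  have := cl_ge s
  have := cl_le s
  rw [mem_EL']; omega

lemma EL_q_odd (hev : n % 2 = 0) {s : V} (hs : cl s % 2 = 1) (h1 : 2 ≤ cl s) (h2 : cl s ≤ n) :
    q s (EL n) = [false, false] := by
  rw [q_out (fun hh => by have := mem_EL'.1 hh; omega),
    Fc_one (EL_ex _ (by omega) (by omega) (by omega)) (fun c hc => EL_Fc_even hc),
    Fc_one (EL_ex _ (by omega) (by omega) (by omega)) (fun c hc => EL_Fc_even hc)]
  rfl

lemma EL_q_end (hn : 2 ≤ n) (hev : n % 2 = 0) {s : V} (h : cl s = 1 ∨ cl s = n + 1) :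
    q s (EL n) = [false] := by
  rw [q_out (fun hh => by have := mem_EL'.1 hh; omega)]
  rcases h with h | h
  · rw [Fc_nil (i := cl s - 1) (fun a _ => by have := cl_ge a; omega),
      Fc_one (EL_ex _ (by omega) (by omega) (by omega)) (fun c hc => EL_Fc_even hc)]
    rfl
  · rw [Fc_nil (i := cl s + 1) (fun a _ => by have := cl_le a; omega),
      Fc_one (EL_ex _ (by omega) (by omega) (by omega)) (fun c hc => EL_Fc_even hc)]
    rfl

lemma CVV.gd_even {s : V} (hs : cl s % 2 = 0) : ∀ {M : ℕ} {x y : ℕ → V}, CVV x y M →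
    gd 2 (q s (cw x y M).flatten)
  | 0, x, y, h => by
    simp [cw, (h.l 0 le_rfl).q_even hs, gd]
  | M+1, x, y, h => by
    have h0 := h.l 0 (by omega)
    simpa [cw, h0.q_even hs, EL_q_even h0.ev hs, gd] using h.succ.gd_even hs

lemma CVV.gd_odd {s : V} (hs : cl s % 2 = 1) (h1 : 2 ≤ cl s) (h2 : cl s ≤ n) :
    ∀ {M : ℕ} {x y : ℕ → V}, CVV x y M → gd 0 (q s (cw x y M).flatten)
  | 0, x, y, h => by
    have h0 := h.l 0 le_rfl
    have hm : s ∈ OL (x 0) (y 0) := by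
      have := h0.ev
      rw [mem_OL']; omega
    simp [cw, h0.q_in hm, gd]
  | M+1, x, y, h => by
    have h0 := h.l 0 (by omega)
    have hm : s ∈ OL (x 0) (y 0) := by
      have := h0.ev
      rw [mem_OL']; omega
    simpa [cw, h0.q_in hm, EL_q_odd h0.ev hs h1 h2, gd] using h.succ.gd_odd hs h1 h2

lemma Lay.memx {x y s : V} (h : Lay x y) (hs : cl s = 1) : s ∈ OL x y ↔ s = x := by
  rw [mem_OL']
  have := h.y; have := h.hn
  constructor
  · rintro (h | rfl | h)
    · exact h
    · omega
    · omega
  · exact Or.inl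
lemma Lay.memy {x y s : V} (h : Lay x y) (hs : cl s = n + 1) : s ∈ OL x y ↔ s = y := by
  rw [mem_OL']
  have := h.x; have := h.hn
  constructor
  · rintro (rfl | h | h)
    · omega
    · exact h
    · omega
  · exact fun h => .inr (.inl h)

lemma CVV.gd_end {s : V} (hs : cl s = 1 ∨ cl s = n + 1) :
    ∀ {M : ℕ} {x y : ℕ → V}, CVV x y M → gd 0 (q s (cw x y M).flatten) ∧
      (s ∉ OL (x 0) (y 0) → gd 1 (q s (cw x y M).flatten))
  | 0, x, y, h => by
    have h0 := h.l 0 le_rfl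
    have h3 := h0.ev
    by_cases hm : s ∈ OL (x 0) (y 0)
    · simp [cw, h0.q_in hm, gd, hm]
    · simp [cw, h0.q_notin (by omega) hm, gd]
  | M+1, x, y, h => by
    have h0 := h.l 0 (by omega)
    have h1 := h.l 1 (by omega)
    have h3 := h0.ev
    have ih := h.succ.gd_end hs
    have hE := EL_q_end h0.hn h0.ev hs
    by_cases hm : s ∈ OL (x 0) (y 0)
    · have hm' : s ∉ OL (x 1) (y 1) := by
        rcases hs with hs | hs
        · rw [h0.memx hs] at hm
          rw [h1.memx hs, hm]
          exact h.nx 0 (by omega)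
        · rw [h0.memy hs] at hm
          rw [h1.memy hs, hm]
          exact h.ny 0 (by omega)
      simpa [cw, h0.q_in hm, gd, hm, hE] using ih.2 hm'
    · simpa [cw, h0.q_notin (by omega) hm, gd, hE, hm] using ih.1

lemma CVV.good {M : ℕ} {x y : ℕ → V} (h : CVV x y M) : Good (cw x y M).flatten := by
  intro s
  have h1 := cl_ge s
  have h2 := cl_le s
  by_cases hs : cl s % 2 = 0
  · exact gd_Gd _ _ (h.gd_even hs)
  · by_cases he : cl s = 1 ∨ cl s = n + 1
    · exact gd_Gd _ _ (h.gd_end he).1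
    · exact gd_Gd _ _ (h.gd_odd (by omega) (by omega) (by omega))

lemma CVV.pre {M : ℕ} {x y : ℕ → V} (h : CVV x y M) {s : V} (hs : cl s % 2 = 0) :
    [false, false] <+: q s (cw x y M).flatten := by
  have h0 := h.l 0 (by omega)
  cases M with
  | zero => simp [cw, h0.q_even hs]
  | succ M => simp [cw, h0.q_even hs]

lemma CVV.suf {s : V} (hs : cl s % 2 = 0) : ∀ {M : ℕ} {x y : ℕ → V} (_ : CVV x y M),
    [false, false] <:+ q s (cw x y M).flatten
  | 0, x, y, h => by simp [cw, (h.l 0 le_rfl).q_even hs]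
  | M+1, x, y, h => by
    have ih := h.succ.suf hs
    rw [cw, List.flatten_cons, List.flatten_cons, q_append, q_append]
    exact ih.trans ((List.suffix_append _ _).trans (List.suffix_append _ _))

lemma lirr_FF {l : List V} (h : ∀ s : V, cl s % 2 = 0 → [false, false] <+: q s l) : LIrr l := by
  apply lirr_of
  intro s t hA hs ht
  have hs1 : cl s % 2 = 1 := by
    by_contra hc
    obtain ⟨r, hr⟩ := h s (by omega)
    rw [← hr] at hs; simp at hs
  obtain ⟨r, hr⟩ := h t (by unfold Adj at hA; omega)
  obtain ⟨r', hr'⟩ := ht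
  rw [← hr'] at hr
  simp at hr

lemma CVV.lirr {M : ℕ} {x y : ℕ → V} (h : CVV x y M) : LIrr (cw x y M).flatten :=
  lirr_FF (fun _ hs => h.pre hs)

lemma CVV.rirr {M : ℕ} {x y : ℕ → V} (h : CVV x y M) : RIrr (cw x y M).flatten := by
  have : LIrr (cw x y M).flatten.reverse := by
    apply lirr_FF
    intro s hs
    rw [q_reverse]
    have := h.suf hs
    rw [← List.reverse_prefix] at this
    simpa using this
  have := this.reverse
  rwa [List.reverse_reverse] at this

lemma CVV.headT {M : ℕ} {x y : ℕ → V} (h : CVV x y M) (hM : 1 ≤ M) (s : V) :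
    (q s (cw x y M).flatten).head? = some true ↔ s ∈ OL (x 0) (y 0) := by
  obtain ⟨M, rfl⟩ : ∃ k, M = k + 1 := ⟨M - 1, by omega⟩
  have h0 := h.l 0 (by omega)
  by_cases hs : s ∈ OL (x 0) (y 0)
  · simp [cw, h0.q_in hs, hs]
  · have h1 := cl_ge s
    have h2 := cl_le s
    have h3 := h0.ev
    by_cases h4 : cl s % 2 = 0
    · simp [cw, h0.q_even h4, hs]
    · have he : cl s = 1 ∨ cl s = n + 1 := by
        by_contra hc
        apply hs
        rw [mem_OL']; omega
      simp [cw, h0.q_notin (by omega) hs, EL_q_end h0.hn h3 he, hs]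

lemma cw_length : ∀ (M : ℕ) (x y : ℕ → V), (cw x y M).length = 2 * M + 1
  | 0, _, _ => rfl
  | M+1, x, y => by simp [cw, cw_length M]; omega

lemma cw_even : ∀ (M : ℕ) (x y : ℕ → V) (i : ℕ), i ≤ M → (cw x y M).getD (2*i) [] = OL (x i) (y i)
  | 0, _, _, 0, _ => rfl
  | M+1, x, y, 0, _ => rfl
  | M+1, x, y, i+1, h => by
    rw [cw, show 2 * (i+1) = 2*i + 1 + 1 by omega, List.getD_cons_succ, List.getD_cons_succ,
      cw_even M _ _ i (by omega)]

lemma cw_odd : ∀ (M : ℕ) (x y : ℕ → V) (i : ℕ), i < M → (cw x y M).getD (2*i+1) [] = EL n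
  | M+1, x, y, 0, _ => rfl
  | M+1, x, y, i+1, h => by
    rw [cw, show 2 * (i+1) + 1 = 2*i + 1 + 1 + 1 by omega, List.getD_cons_succ, List.getD_cons_succ,
      cw_odd M _ _ i (by omega)]

lemma cw_mem : ∀ (M : ℕ) (x y : ℕ → V) (L : List V), L ∈ cw x y M → L = EL n ∨ ∃ i ≤ M, L = OL (x i) (y i)
  | 0, x, y, L, h => by simp [cw] at h; exact .inr ⟨0, le_rfl, h⟩
  | M+1, x, y, L, h => by
    simp only [cw, List.mem_cons] at h
    rcases h with h | h | h
    · exact .inr ⟨0, by omega, h⟩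
    · exact .inl h
    · rcases cw_mem M _ _ L h with h | ⟨i, hi, h⟩
      · exact .inl h
      · exact .inr ⟨i+1, by omega, h⟩


end

section
local notation "V" => Fin (n+3)

/-- no two letters of `l` are adjacent -/
def NA (l : List V) : Prop := ∀ a ∈ l, ∀ b ∈ l, ¬ Adj a b

lemma NA.ce {l l' : List V} (h : NA l) (e : CE l l') : NA l' :=
  fun a ha b hb => h a (e.perm.mem_iff.2 ha) b (e.perm.mem_iff.2 hb)

lemma NA.rev {l : List V} (h : NA l) : NA (l.map Fin.rev) := by
  intro a ha b hb hA
  obtain ⟨c, hc, rfl⟩ := List.mem_map.1 ha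
  obtain ⟨d, hd, rfl⟩ := List.mem_map.1 hb
  exact h c hc d hd (adj_rev.1 hA)

lemma not_red_dup {cs : CoxeterSystem (DMatrix n) W} {a : V} {m : List V} : ¬ cs.IsReduced (a :: a :: m) := by
  intro h
  unfold CoxeterSystem.IsReduced at h
  rw [CoxeterSystem.wordProd_cons, CoxeterSystem.wordProd_cons, CoxeterSystem.simple_mul_simple_cancel_left] at h
  have := cs.length_wordProd_le m
  simp at h; omega

lemma red_nodup (hn : 2 ≤ n) (cs : CoxeterSystem (DMatrix n) W) : ∀ {l : List V}, cs.IsReduced l → NA l → l.Nodup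
  | [], _, _ => List.nodup_nil
  | a :: l, hl, h => by
    rw [List.nodup_cons]
    refine ⟨?_, red_nodup hn cs (red_tail hl) (fun b hb c hc => h b (List.mem_cons_of_mem _ hb) c (List.mem_cons_of_mem _ hc))⟩
    intro ha
    obtain ⟨u, v, rfl, hu⟩ := List.eq_append_cons_of_mem ha
    have e : CE (u ++ a :: v) (a :: (u ++ v)) := CE.front v (fun b hb =>
      ⟨fun hh => hu (hh ▸ hb), h b (by simp [hb]) a (by simp)⟩)
    exact not_red_dup ((CE.cons a e).red hn cs hl)

lemma na_iff (hn : 2 ≤ n) (l : List V) : (∀ a ∈ l, ∀ b ∈ l, a ≠ b → DMatrix n a b = 2) ↔ NA l := by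
  constructor
  · intro h a ha b hb hA
    exact ((dm_two hn a b).1 (h a ha b hb hA.ne)).2 hA
  · intro h a ha b hb hab
    exact (dm_two hn a b).2 ⟨hab, h a ha b hb⟩

lemma NA.good {l : List V} (h : NA l) (hd : l.Nodup) : Good l := by
  intro s
  by_cases hs : s ∈ l
  · rw [q_in hd hs (fun a ha => h a ha s hs)]
    exact gd_Gd _ 0 (by simp [gd])
  · rw [q_length s l hs]
    constructor
    · intro hh
      have := hh.subset (show true ∈ [true, true] by simp)
      simp at this
    · intro hh
      have := hh.subset (show true ∈ [true, false, true] by simp)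
      simp at this

lemma NA.lirr {l : List V} (h : NA l) : LIrr l := by
  intro s t m hA e
  exact h.ce e s (by simp) t (by simp) hA
lemma NA.rirr {l : List V} (h : NA l) : RIrr l := by
  intro s t m hA e
  exact h.ce e s (by simp) t (by simp) hA

lemma cc_to (hn : 2 ≤ n) (cs : CoxeterSystem (DMatrix n) W) {w : W} (h : IsCC cs w) :
    ∃ l, cs.IsReduced l ∧ cs.wordProd l = w ∧ NA l ∧ Good l := by
  obtain ⟨l, hl, hw, h⟩ := h
  rw [na_iff hn] at h
  exact ⟨l, hl, hw, h, h.good (red_nodup hn cs hl h)⟩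

lemma ce_perm {l l' : List V} (h : l.Perm l') (h2 : l.Pairwise Cm) : CE l l' := by
  induction h with
  | nil => exact .refl _
  | cons a _ ih => exact .cons a (ih (List.pairwise_cons.1 h2).2)
  | swap a b l => exact .swap _ _ _ ((List.pairwise_cons.1 h2).1 a (by simp))
  | trans h3 _ ih1 ih2 =>
    exact (ih1 h2).trans (ih2 ((h3.pairwise_iff (fun h => h.symm)).1 h2))

lemma NA.pw {l : List V} (h : NA l) (hd : l.Nodup) : l.Pairwise Cm := by
  refine List.Pairwise.imp_of_mem ?_ hd
  intro a b ha hb hab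
  exact ⟨hab, h a ha b hb⟩

lemma cw_ce : ∀ (M : ℕ) (us : List (List V)) (x y : ℕ → V), us.length = 2 * M + 1 →
    (∀ i ≤ M, CE (us.getD (2*i) []) (OL (x i) (y i))) → (∀ i < M, CE (us.getD (2*i+1) []) (EL n)) →
    CE us.flatten (cw x y M).flatten
  | 0, [u], x, y, _, h1, _ => by simpa [cw] using h1 0 le_rfl
  | M+1, u :: v :: us, x, y, hl, h1, h2 => by
    have a1 : CE u (OL (x 0) (y 0)) := h1 0 (by omega)
    have a2 : CE v (EL n) := h2 0 (by omega)
    rw [cw, List.flatten_cons, List.flatten_cons, List.flatten_cons, List.flatten_cons]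
    refine a1.app (a2.app (cw_ce M us _ _ ?_ ?_ ?_))
    · simp at hl; omega
    · intro i hi
      have := h1 (i+1) (by omega)
      rwa [show 2 * (i+1) = 2*i + 1 + 1 by omega, List.getD_cons_succ, List.getD_cons_succ] at this
    · intro i hi
      have := h2 (i+1) (by omega)
      rwa [show 2 * (i+1) + 1 = 2*i + 1 + 1 + 1 by omega, List.getD_cons_succ, List.getD_cons_succ] at this

lemma red_layer {cs : CoxeterSystem (DMatrix n) W} {us : List (List V)} (h : cs.IsReduced us.flatten)
    {L : List V} (hL : L ∈ us) : cs.IsReduced L := by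
  obtain ⟨u, v, rfl⟩ := List.append_of_mem hL
  rw [List.flatten_append, List.flatten_cons] at h
  have h1 := h.drop u.flatten.length
  rw [List.drop_left] at h1
  have h2 := h1.take L.length
  rwa [List.take_left] at h2

lemma OL_NA {x y : V} (h : Lay x y) : NA (OL x y) := fun _ ha _ hb => h.nadj ha (h.odd hb)
lemma EL_NA : NA (EL n) := fun _ ha _ hb => EL_nadj ha (mem_EL'.1 hb).2.2

lemma cl_lo (hn : 2 ≤ n) {a : V} (h : (a : ℕ) = 0 ∨ (a : ℕ) = 1) : cl a = 1 := by
  unfold cl; split_ifs <;> omega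
lemma cl_hi (hn : 2 ≤ n) {a : V} (h : (a : ℕ) = n + 1 ∨ (a : ℕ) = n + 2) : cl a = n + 1 := by
  unfold cl; split_ifs <;> omega
lemma of_cl_lo (hn : 2 ≤ n) {a : V} (h : cl a = 1) : (a : ℕ) = 0 ∨ (a : ℕ) = 1 := by
  unfold cl at h; split_ifs at h <;> omega
lemma of_cl_hi (hn : 2 ≤ n) {a : V} (h : cl a = n + 1) : (a : ℕ) = n + 1 ∨ (a : ℕ) = n + 2 := by
  unfold cl at h; split_ifs at h <;> omega

lemma getD_mem {α : Type*} {us : List (List α)} {i : ℕ} (h : i < us.length) : us.getD i [] ∈ us := by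
  rw [List.getD_eq_getElem _ _ h]; exact List.getElem_mem _

lemma candy_even (hn : 2 ≤ n) (cs : CoxeterSystem (DMatrix n) W) {w : W} (h : IsCandy cs w) : n % 2 = 0 := by
  obtain ⟨us, m, x, y, ⟨-, -, -, -, -, hcf⟩, hlen, hm, -, hxy, -, hev⟩ := h
  have h1 := hxy 1 (by omega)
  have hy : y 1 ∈ us.getD 2 [] := by
    have : y 1 ∈ {a | a ∈ us.getD (2*1) []} := by rw [h1.2.2]; simp
    exact this
  obtain ⟨s, hs, hb⟩ := hcf 1 (by omega) (y 1) hy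
  rw [big_iff hn] at hb
  have hs' : s ∈ {a | a ∈ us.getD (2*0+1) []} := hs
  rw [hev 0 (by omega)] at hs'
  obtain ⟨h2, h3, h4⟩ := hs'
  have h5 := cl_mid h2 h3
  have h6 := cl_hi hn h1.2.1
  unfold Adj at hb
  omega

lemma candy_to (hn : 2 ≤ n) (cs : CoxeterSystem (DMatrix n) W) {w : W} (h : IsCandy cs w) :
    ∃ x y M, 1 ≤ M ∧ CVV x y M ∧ cs.IsReduced (cw x y M).flatten ∧ cs.wordProd (cw x y M).flatten = w := by
  have hev' := candy_even hn cs h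
  obtain ⟨us, m, x, y, ⟨-, hw, hred, hcomm, -, hcf⟩, hlen, hm, hm2, hxy, hne, hev⟩ := h
  obtain ⟨M, rfl⟩ : ∃ M, m = 2 * M := ⟨m / 2, by omega⟩
  have hcv : CVV x y M := by
    refine ⟨⟨fun i hi => ?_⟩, fun i hi => (hne i (by omega)).1, fun i hi => (hne i (by omega)).2⟩
    have := hxy i (by omega)
    exact ⟨hn, hev', cl_lo hn this.1, cl_hi hn this.2.1⟩
  have key : ∀ i < us.length, ∀ L' : List V, L'.Nodup → (∀ a, a ∈ us.getD i [] ↔ a ∈ L') →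
      CE (us.getD i []) L' := by
    intro i hi L' hd hmem
    have hL := getD_mem hi
    have hna : NA (us.getD i []) := (na_iff hn _).1 (hcomm _ hL)
    have hnd := red_nodup hn cs (red_layer hred hL) hna
    exact ce_perm ((List.perm_ext_iff_of_nodup hnd hd).2 hmem) (hna.pw hnd)
  have hce : CE us.flatten (cw x y M).flatten := by
    apply cw_ce M us x y hlen
    · intro i hi
      apply key _ (by omega) _ (nodup_OL _ _)
      intro a
      have := (hxy i (by omega)).2.2
      have : a ∈ {a | a ∈ us.getD (2*i) []} ↔ a ∈ OddCore n ∪ {x i, y i} := by rw [this]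
      rw [mem_OL]
      simp only [Set.mem_setOf_eq, Set.mem_union, OddCore, Set.mem_insert_iff, Set.mem_singleton_iff] at this
      rw [this]; tauto
    · intro i hi
      apply key _ (by omega) _ nodup_EL
      intro a
      have : a ∈ {a | a ∈ us.getD (2*i+1) []} ↔ a ∈ EvenCore n := by rw [hev i (by omega)]
      rw [mem_EL]
      exact this
  exact ⟨x, y, M, by omega, hcv, hce.red hn cs hred, by rw [← hce.wp hn cs, hw]⟩

lemma cw_cf (hn : 2 ≤ n) {x y : ℕ → V} {M : ℕ} (h : CVV x y M) (j : ℕ) (hj : j + 1 < 2 * M + 1)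
    (t : V) (ht : t ∈ (cw x y M).getD (j+1) []) : ∃ s ∈ (cw x y M).getD j [], Adj s t := by
  have hev := (h.l 0 (by omega)).ev
  have t1 := cl_ge t
  have t2 := cl_le t
  rcases Nat.even_or_odd' j with ⟨i, rfl | rfl⟩
  · rw [cw_odd M x y i (by omega)] at ht
    rw [cw_even M x y i (by omega)]
    have h0 := h.l i (by omega)
    have := mem_EL'.1 ht
    obtain ⟨c, hc, e⟩ := h0.ex (i := cl t - 1) (by omega) (by omega)
    exact ⟨c, hc, by unfold Adj; omega⟩
  · rw [show 2 * i + 1 + 1 = 2 * (i+1) by omega, cw_even M x y (i+1) (by omega)] at ht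
    rw [cw_odd M x y i (by omega)]
    have h0 := h.l (i+1) (by omega)
    have := h0.odd ht
    by_cases h1 : cl t = 1
    · obtain ⟨c, hc, e⟩ := EL_ex (n := n) 2 le_rfl hn (by omega)
      exact ⟨c, hc, by unfold Adj; omega⟩
    · obtain ⟨c, hc, e⟩ := EL_ex (n := n) (cl t - 1) (by omega) (by omega) (by omega)
      exact ⟨c, hc, by unfold Adj; omega⟩

lemma candy_of (hn : 2 ≤ n) (cs : CoxeterSystem (DMatrix n) W) {x y : ℕ → V} {M : ℕ} (hM : 1 ≤ M)
    (h : CVV x y M) (hred : cs.IsReduced (cw x y M).flatten) :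
    IsCandy cs (cs.wordProd (cw x y M).flatten) := by
  refine ⟨cw x y M, 2 * M, x, y, ⟨?_, rfl, hred, ?_, ?_, ?_⟩, cw_length M x y, by omega, by omega, ?_, ?_, ?_⟩
  · intro L hL
    rcases cw_mem M x y L hL with rfl | ⟨i, hi, rfl⟩
    · obtain ⟨c, hc, -⟩ := EL_ex (n := n) 2 le_rfl hn (by omega)
      exact List.ne_nil_of_mem hc
    · have : x i ∈ OL (x i) (y i) := by rw [mem_OL]; simp
      exact List.ne_nil_of_mem this
  · intro L hL
    rw [na_iff hn]
    rcases cw_mem M x y L hL with rfl | ⟨i, hi, rfl⟩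
    · exact EL_NA
    · exact OL_NA (h.l i hi)
  · intro a
    rw [desc_iff hn cs hred h.good, front_iff, h.headT hM]
    obtain ⟨M, rfl⟩ : ∃ k, M = k + 1 := ⟨M - 1, by omega⟩
    simp [cw]
  · intro j hj t ht
    rw [cw_length] at hj
    obtain ⟨s, hs, hA⟩ := cw_cf hn h j hj t ht
    exact ⟨s, hs, (big_iff hn _ _).2 hA⟩
  · intro i hi
    have h0 := h.l i (by omega)
    refine ⟨of_cl_lo hn h0.x, of_cl_hi hn h0.y, ?_⟩
    ext a
    rw [cw_even M x y i (by omega)]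
    simp only [Set.mem_setOf_eq, Set.mem_union, OddCore, Set.mem_insert_iff, Set.mem_singleton_iff, mem_OL]
    tauto
  · intro i hi
    exact ⟨h.nx i (by omega), h.ny i (by omega)⟩
  · intro i hi
    ext a
    rw [cw_odd M x y i (by omega)]
    simp only [Set.mem_setOf_eq, EvenCore, mem_EL]

lemma zig_to (hn : 2 ≤ n) (cs : CoxeterSystem (DMatrix n) W) {w : W} (h : IsCompleteZigzag cs w) :
    ∃ j l, 0 < j ∧ (l = zg n j ∨ l = (zg n j).map Fin.rev) ∧ cs.IsReduced l ∧ cs.wordProd l = w := by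
  obtain ⟨k, h, hh, hp, ⟨h1, h2⟩ | ⟨h1, h2⟩⟩ := h
  · rw [zig1_eq hh] at h1 h2
    exact ⟨2*k+h, _, by omega, .inl rfl, h1, h2⟩
  · rw [zig2_eq hh] at h1 h2
    exact ⟨2*k+h, _, by omega, .inr rfl, h1, h2⟩

lemma zig_of (hn : 2 ≤ n) (cs : CoxeterSystem (DMatrix n) W) {l : List V} (h : IsZ l) (hl : cs.IsReduced l) :
    IsCompleteZigzag cs (cs.wordProd l) := by
  obtain ⟨j, hj, h⟩ := h
  have e : j = 2 * (j / 2) + j % 2 := by omega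
  refine ⟨j / 2, j % 2, by omega, by omega, ?_⟩
  rw [zig1_eq (by omega), zig2_eq (by omega), ← e]
  rcases h with h | h
  · exact .inl ⟨h.red hn cs hl, (h.wp hn cs).symm⟩
  · exact .inr ⟨h.red hn cs hl, (h.wp hn cs).symm⟩

lemma zig_props (hn : 2 ≤ n) {j : ℕ} (hj : 0 < j) {l : List V} (h : l = zg n j ∨ l = (zg n j).map Fin.rev) :
    Good l ∧ LIrr l ∧ RIrr l ∧ ¬ NA l := by
  have hna : ¬ NA (zg n j) := by
    intro h
    obtain ⟨j, rfl⟩ : ∃ k, j = k + 1 := ⟨j - 1, by omega⟩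
    refine h (dv n 0) (by simp [zg]) (dv n 2) ?_ ?_
    · simp [zg, alt, AWord, List.range'_succ]
    · left; rw [cl_dv0, cl_dv (by omega) (by omega)]
  rcases h with rfl | rfl
  · exact ⟨zg_good hn j, zg_lirr hn hj, zg_rirr hn hj, hna⟩
  · refine ⟨(zg_good hn j).rev, (zg_lirr hn hj).rev, (zg_rirr hn hj).rev, fun h => hna ?_⟩
    have := h.rev
    rwa [map_rev_rev] at this

lemma main_fwd (hn : 2 ≤ n) (cs : CoxeterSystem (DMatrix n) W) {l : List V} (hl : cs.IsReduced l)
    (hfc : IsFC cs (cs.wordProd l)) (hs : StarIrreducible cs (cs.wordProd l)) :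
    IsCandy cs (cs.wordProd l) ∨ IsCompleteZigzag cs (cs.wordProd l) ∨ IsCC cs (cs.wordProd l) := by
  have hg := fc_good hn cs hl hfc
  have hL := star_lirr hn cs hl hs
  have hR := star_rirr hn cs hl hs
  by_cases hz : IsZ l
  · exact .inr (.inl (zig_of hn cs hz hl))
  have hC : Ctx l := ⟨hg, hL, hR, fun h2 x y k => hz (z_thm hn hg hL hR k h2),
    fun h2 x y k => hz (z_thm hn hg.rev hL.rev hR.rev k h2).rev⟩
  by_cases hna : NA l
  · exact .inr (.inr ⟨l, hl, rfl, (na_iff hn l).2 hna⟩)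
  left
  have hex : ∃ i, Has i l ∧ Has (i+1) l := by
    unfold NA at hna
    push Not at hna
    obtain ⟨a, ha, b, hb, hA | hA⟩ := hna
    · exact ⟨cl a, ⟨a, ha, rfl⟩, ⟨b, hb, hA.symm⟩⟩
    · exact ⟨cl b, ⟨b, hb, rfl⟩, ⟨a, ha, hA.symm⟩⟩
  obtain ⟨i, h1, h2⟩ := hex
  obtain ⟨t, ht⟩ := sk_exists hn hC h1 h2
  have hk := ht.one hn hC
  obtain ⟨M, hM, hE⟩ := sk_ab hn hC hk
  obtain ⟨x, y, hcv, hx, hy, hce⟩ := CV.ce hn (hk.even hn hC) hE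
  rw [hce.wp hn cs]
  exact candy_of hn cs hM ⟨hcv, fun i hi => x_ne hn hC hx hi, fun i hi => y_ne hn hC hy hi⟩ (hce.red hn cs hl)


end

theorem stmt18 (n : ℕ) (hn : 2 ≤ n) {W : Type*} [Group W]
    (cs : CoxeterSystem (DMatrix n) W) :
    (∀ w : W, (IsFC cs w ∧ StarIrreducible cs w) ↔
      (IsCandy cs w ∨ IsCompleteZigzag cs w ∨ IsCC cs w)) ∧
    (∀ w : W, ¬ (IsCandy cs w ∧ IsCompleteZigzag cs w)) ∧
    (∀ w : W, ¬ (IsCandy cs w ∧ IsCC cs w)) ∧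
    (∀ w : W, ¬ (IsCompleteZigzag cs w ∧ IsCC cs w)) ∧
    (n % 2 = 1 → ∀ w : W, ¬ IsCandy cs w) := by
  refine ⟨fun w => ⟨?_, ?_⟩, ?_, ?_, ?_, ?_⟩
  · rintro ⟨h1, h2⟩
    obtain ⟨l, hl, rfl⟩ := cs.exists_isReduced w
    exact main_fwd hn cs hl h1 h2
  · rintro (h | h | h)
    · obtain ⟨x, y, M, hM, hcv, hr, rfl⟩ := candy_to hn cs h
      exact ⟨hcv.good.isFC hn cs hr, irr_star hn cs hr hcv.good hcv.lirr hcv.rirr⟩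
    · obtain ⟨j, l, hj, hl, hr, rfl⟩ := zig_to hn cs h
      obtain ⟨hg, hL, hR, -⟩ := zig_props hn hj hl
      exact ⟨hg.isFC hn cs hr, irr_star hn cs hr hg hL hR⟩
    · obtain ⟨l, hr, rfl, hna, hg⟩ := cc_to hn cs h
      exact ⟨hg.isFC hn cs hr, irr_star hn cs hr hg hna.lirr hna.rirr⟩
  · rintro w ⟨h, h'⟩
    obtain ⟨x, y, M, hM, hcv, hr, rfl⟩ := candy_to hn cs h
    obtain ⟨j, l, hj, hl, hr', hw⟩ := zig_to hn cs h'
    have hce := Good.fc hn cs _ _ l rfl hcv.good hr hr' hw.symm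
    have h0 := hcv.l 0 (by omega)
    rcases hl with rfl | rfl
    · have h1 := (hcv.headT hM (y 0)).2 (by rw [mem_OL]; simp)
      rw [q_ce hce, zg_head hn hj (by rw [h0.y]; omega)] at h1
      simp at h1
    · have h1 := (hcv.headT hM (x 0)).2 (by rw [mem_OL]; simp)
      rw [q_ce hce, q_rev', zg_head hn hj (by rw [cl_rev, h0.x]; omega)] at h1
      simp at h1
  · rintro w ⟨h, h'⟩
    obtain ⟨x, y, M, hM, hcv, hr, rfl⟩ := candy_to hn cs h
    obtain ⟨l, hr', hw, hna, hg⟩ := cc_to hn cs h'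
    have hce := Good.fc hn cs _ _ l rfl hcv.good hr hr' hw.symm
    have hE := hcv.toCV.E (i := 1) le_rfl (by omega)
    obtain ⟨M, rfl⟩ : ∃ k, M = k + 1 := ⟨M - 1, by omega⟩
    have hf : Has 1 (cw x y (M+1)).flatten := has_false.2 (by rw [hE]; simp [ab])
    have ht : Has 2 (cw x y (M+1)).flatten := has_true.2 (by rw [hE]; simp [ab])
    obtain ⟨a, ha, ha1⟩ := hf
    obtain ⟨b, hb, hb1⟩ := ht
    exact hna.ce hce.symm a ha b hb (by unfold Adj; omega)
  · rintro w ⟨h, h'⟩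
    obtain ⟨j, l, hj, hl, hr, rfl⟩ := zig_to hn cs h
    obtain ⟨l', hr', hw, hna, hg⟩ := cc_to hn cs h'
    obtain ⟨hg, hL, hR, hz⟩ := zig_props hn hj hl
    have hce := Good.fc hn cs _ _ l' rfl hg hr hr' hw.symm
    exact hz (hna.ce hce.symm)
  · intro ho w h
    have := candy_even hn cs h
    omega

end CoxFC
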